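/- Let n ≥ 1, let r = (r₁,…,rₙ) be a weight in ℝⁿ, let U ⊆ ℝ be an open interval, let φ : U → ℝⁿ be a nondegenerate analytic map, and for 1 ≤ i ≤ n let θ̃ᵢ : U → ℝ be Lipschitz functions. Let μ be a (C,α)-Ahlfors regular Borel measure on ℝ with U ∩ supp μ ≠ ∅. Then the set {x ∈ U : liminf over q ∈ ℤ\{0}, |q|→∞, of max_{1≤i≤n} |q·φᵢ(x) − θ̃ᵢ(x)|_ℤ^{1/rᵢ}·|q| > 0} has nonempty intersection with supp μ. -/

import Mathlib

/- STATEMENT 18: inhomogeneous bad set on an analytic nondegenerate curve, with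
Lipschitz inhomogeneous functions defined directly on `U`, meets the support of
any Ahlfors regular measure. -/

open Filter Set MeasureTheory
open scoped ENNReal

/-- distance from `y` to the nearest integer, `|y|_ℤ`. -/
noncomputable def distInt (y : ℝ) : ℝ := |y - round y|

/-- `wpow t s = t ^ (1/s)`, with the convention `t ^ (1/0) := 0`. -/
noncomputable def wpow (t s : ℝ) : ℝ := if s = 0 then 0 else t ^ (1 / s)

/-- `liminf` over `q ∈ ℤ \ {0}`, `|q| → ∞`, of
`max_{1 ≤ i ≤ n} |q·yᵢ − θᵢ|_ℤ^{1/rᵢ} · |q|` (valued in `ℝ≥0∞`). -/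
noncomputable def badLiminf {n : ℕ} (r y θv : Fin n → ℝ) : ℝ≥0∞ :=
  Filter.liminf
    (fun q : ℤ =>
      ENNReal.ofReal ((⨆ i, wpow (distInt ((q : ℝ) * y i - θv i)) (r i)) * |(q : ℝ)|))
    (Filter.comap (fun q : ℤ => |q|) Filter.atTop)

/-- support of a measure on `ℝ`. -/
def msupport (μ : Measure ℝ) : Set ℝ := {x | ∀ ρ > 0, 0 < μ (Metric.ball x ρ)}

/-- Iterated Rolle theorem for a sequence of successive derivatives. -/
theorem exists_jet_eq_zero {D : Set ℝ} (hD : D.OrdConnected) (k : ℕ) :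
    ∀ (F : ℕ → ℝ → ℝ) (_ : ∀ i, ∀ x ∈ D, HasDerivAt (F i) (F (i + 1) x) x) (x : ℕ → ℝ)
      (_ : ∀ i ≤ k, x i ∈ D) (_ : ∀ i < k, x i < x (i + 1)) (_ : ∀ i ≤ k, F 0 (x i) = 0),
      ∃ ξ ∈ D, F k ξ = 0 := by
  induction k with
  | zero => intro F _ x hx _ h0; exact ⟨x 0, hx 0 le_rfl, h0 0 le_rfl⟩
  | succ k ih =>
    intro F hF x hx hlt h0
    have hsub : ∀ i ≤ k, Icc (x i) (x (i + 1)) ⊆ D := fun i hi =>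
      hD.out (hx i (by lia)) (hx (i + 1) (by lia))
    have key : ∀ i, ∃ y, i ≤ k → y ∈ Ioo (x i) (x (i + 1)) ∧ F 1 y = 0 := by
      intro i
      by_cases hi : i ≤ k
      · obtain ⟨y, hy, hy0⟩ := exists_hasDerivAt_eq_zero (f := F 0) (f' := F 1)
          (hlt i (by lia))
          (fun z hz => (hF 0 z (hsub i hi hz)).continuousAt.continuousWithinAt)
          (by rw [h0 i (by lia), h0 (i + 1) (by lia)])
          (fun z hz => hF 0 z (hsub i hi (Ioo_subset_Icc_self hz)))
        exact ⟨y, fun _ => ⟨hy, hy0⟩⟩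
      · exact ⟨0, fun h => absurd h hi⟩
    choose y hy using key
    obtain ⟨ξ, hξ, h⟩ := ih (fun i => F (i + 1)) (fun i z hz => hF (i + 1) z hz) y
      (fun i hi => hsub i hi (Ioo_subset_Icc_self (hy i hi).1))
      (fun i hi => (hy i hi.le).1.2.trans (hy (i + 1) hi).1.1)
      (fun i hi => (hy i hi).2)
    exact ⟨ξ, hξ, h⟩

/-- Mean value theorem for divided differences. -/
theorem exists_jet_eq_dividedDiff {D : Set ℝ} (hD : D.OrdConnected) (k : ℕ)
    (F : ℕ → ℝ → ℝ) (hF : ∀ i, ∀ x ∈ D, HasDerivAt (F i) (F (i + 1) x) x)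
    (s : Finset ℝ) (hs : s.card = k + 1) (hsD : ∀ y ∈ s, y ∈ D) :
    ∃ ξ ∈ D, F k ξ = k.factorial * ∑ y ∈ s, F 0 y / ∏ z ∈ s.erase y, (y - z) := by
  classical
  set P := Lagrange.interpolate s id (F 0) with hP
  have hinj : Set.InjOn (id : ℝ → ℝ) s := Function.injective_id.injOn
  have hdeg : P.degree < s.card := Lagrange.degree_interpolate_lt _ hinj
  have hnat : P.natDegree ≤ k := by
    by_cases h0 : P = 0
    · simp [h0]
    · rw [hs, Polynomial.degree_eq_natDegree h0] at hdeg
      have : P.natDegree < k + 1 := by exact_mod_cast hdeg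
      lia
  have hPs : ∀ y ∈ s, P.eval y = F 0 y := fun y hy =>
    Lagrange.eval_interpolate_at_node (v := id) (F 0) hinj hy
  have hcoeff := Lagrange.coeff_eq_sum hinj hdeg
  rw [hs, Nat.add_sub_cancel] at hcoeff
  let x : ℕ → ℝ := fun i => if h : i < k + 1 then s.orderEmbOfFin hs ⟨i, h⟩ else 0
  have hx : ∀ i ≤ k, x i ∈ s := fun i hi => by
    simp only [x, Nat.lt_succ_of_le hi, dif_pos]
    exact s.orderEmbOfFin_mem hs _
  obtain ⟨ξ, hξ, h⟩ := exists_jet_eq_zero hD k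
    (fun i z => F i z - (Polynomial.derivative^[i] P).eval z)
    (fun i z hz => by
      rw [Function.iterate_succ_apply']
      exact (hF i z hz).sub ((Polynomial.derivative^[i] P).hasDerivAt z)) x
    (fun i hi => hsD _ (hx i hi))
    (fun i hi => by
      have h1 : i < k + 1 := by lia
      have h2 : i + 1 < k + 1 := by lia
      simp only [x, h1, h2, dif_pos]
      exact (s.orderEmbOfFin hs).strictMono (by simp [Fin.lt_def]))
    (fun i hi => by simp [hPs _ (hx i hi)])
  refine ⟨ξ, hξ, ?_⟩
  have hc : Polynomial.derivative^[k] P = Polynomial.C ((k.factorial : ℝ) * P.coeff k) := by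
    ext m
    rw [Polynomial.coeff_iterate_derivative, Polynomial.coeff_C]
    split_ifs with hm
    · subst hm; simp [Nat.descFactorial_self]
    · rw [Polynomial.coeff_eq_zero_of_natDegree_lt (by lia), smul_zero]
  have h' : F k ξ = k.factorial * P.coeff k := by
    have := sub_eq_zero.mp h
    rw [this, hc, Polynomial.eval_C]
  rw [h', hcoeff]
  congr 1
  exact Finset.sum_congr rfl fun y hy => by rw [id, hPs y hy]; rfl

/-- A set without large `η`-separated subsets is covered by few balls of radius `η`. -/
theorem exists_cover_of_separated_card_le {A : Set ℝ} {η : ℝ} {N : ℕ}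
    (h : ∀ s : Finset ℝ, ↑s ⊆ A → (∀ x ∈ s, ∀ y ∈ s, x ≠ y → η ≤ |x - y|) → s.card ≤ N) :
    ∃ s : Finset ℝ, ↑s ⊆ A ∧ (∀ x ∈ s, ∀ y ∈ s, x ≠ y → η ≤ |x - y|) ∧ s.card ≤ N ∧
      ∀ x ∈ A, ∃ y ∈ s, x = y ∨ |x - y| < η := by
  classical
  let Q : ℕ → Prop := fun m => ∃ s : Finset ℝ, ↑s ⊆ A ∧
    (∀ x ∈ s, ∀ y ∈ s, x ≠ y → η ≤ |x - y|) ∧ s.card = m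
  have hQ0 : Q 0 := ⟨∅, by simp, by simp, rfl⟩
  obtain ⟨s, hsA, hs, hcard⟩ := Nat.findGreatest_spec (P := Q) (Nat.zero_le N) hQ0
  refine ⟨s, hsA, hs, h s hsA hs, fun x hx => ?_⟩
  by_contra! hcon
  have hxs : x ∉ s := fun hxs => (hcon x hxs).1 rfl
  have hsep : ∀ a ∈ insert x s, ∀ b ∈ insert x s, a ≠ b → η ≤ |a - b| := by
    intro a ha b hb hab
    rw [Finset.mem_insert] at ha hb
    rcases ha with rfl | ha
    · rcases hb with rfl | hb
      · exact absurd rfl hab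
      · exact (hcon b hb).2
    · rcases hb with rfl | hb
      · rw [abs_sub_comm]; exact (hcon a ha).2
      · exact hs a ha b hb hab
  have hsub : ↑(insert x s) ⊆ A := by
    intro a ha
    rcases Finset.mem_insert.1 (Finset.mem_coe.1 ha) with rfl | ha
    · exact hx
    · exact hsA ha
  have hle := h _ hsub hsep
  have : (insert x s).card ≤ Nat.findGreatest Q N := Nat.le_findGreatest hle ⟨_, hsub, hsep, rfl⟩
  rw [Finset.card_insert_of_notMem hxs] at this
  lia

/-- A lower bound for a product of distances from a point to the points of a separated set. -/
theorem pow_le_prod_erase_abs_sub {s : Finset ℝ} {η : ℝ} (hη : 0 ≤ η) {k : ℕ}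
    (hs : s.card = k + 1) (hsep : ∀ x ∈ s, ∀ y ∈ s, x ≠ y → η ≤ |x - y|) {y : ℝ} (hy : y ∈ s) :
    η ^ k ≤ |∏ z ∈ s.erase y, (y - z)| := by
  rw [Finset.abs_prod]
  have hc : (s.erase y).card = k := by rw [Finset.card_erase_of_mem hy, hs]; rfl
  calc η ^ k = ∏ _z ∈ s.erase y, η := by rw [Finset.prod_const, hc]
    _ ≤ _ := Finset.prod_le_prod (fun _ _ => hη) fun z hz =>
      hsep y hy z (Finset.mem_of_mem_erase hz) (Finset.ne_of_mem_erase hz).symm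

/-- A bounded function has a point where its `i`-th derivative satisfies a Cauchy-type bound. -/
theorem exists_jet_le {x r : ℝ} (hr : 0 < r) (F : ℕ → ℝ → ℝ)
    (hF : ∀ i, ∀ y ∈ Metric.ball x r, HasDerivAt (F i) (F (i + 1) y) y)
    {M : ℝ} (hM : ∀ y ∈ Metric.ball x r, |F 0 y| ≤ M) {N i : ℕ} (hi : i ≤ N) :
    ∃ ξ ∈ Metric.ball x r, |F i ξ| ≤ (N + 1).factorial * (N + 2) ^ N * M / r ^ i := by
  classical
  have hM0 : 0 ≤ M := (abs_nonneg _).trans (hM x (Metric.mem_ball_self hr))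
  set δ : ℝ := r / (N + 2) with hδ
  have hN : (0 : ℝ) < N + 2 := by positivity
  have hδ0 : 0 < δ := by positivity
  set p : ℕ → ℝ := fun j => x + j * δ with hp
  have hpd : ∀ j l : ℕ, j ≠ l → δ ≤ |p j - p l| := fun j l hjl => by
    have : p j - p l = ((j : ℝ) - l) * δ := by simp only [hp]; ring
    rw [this, abs_mul, abs_of_pos hδ0]
    have h1 : (1 : ℝ) ≤ |(j : ℝ) - l| := by
      have : (1 : ℤ) ≤ |(j : ℤ) - l| := Int.one_le_abs (by lia)
      exact_mod_cast this
    nlinarith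
  have hpinj : Function.Injective p := fun j l h => by
    by_contra hne
    have := hpd j l hne
    rw [h, sub_self, abs_zero] at this
    linarith
  set s := (Finset.range (i + 1)).image p
  have hs : s.card = i + 1 := by
    rw [Finset.card_image_of_injective _ hpinj, Finset.card_range]
  have hsD : ∀ y ∈ s, y ∈ Metric.ball x r := by
    intro y hy
    obtain ⟨j, hj, rfl⟩ := Finset.mem_image.1 hy
    have hj' : (j : ℝ) < N + 2 := by
      have : j < N + 2 := by have := Finset.mem_range.1 hj; lia
      exact_mod_cast this
    rw [Metric.mem_ball, Real.dist_eq]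
    simp only [hp, add_sub_cancel_left]
    rw [abs_of_nonneg (by positivity), hδ, mul_div_assoc', div_lt_iff₀ hN]
    nlinarith
  have hsep : ∀ a ∈ s, ∀ b ∈ s, a ≠ b → δ ≤ |a - b| := by
    intro a ha b hb hab
    obtain ⟨j, _, rfl⟩ := Finset.mem_image.1 ha
    obtain ⟨l, _, rfl⟩ := Finset.mem_image.1 hb
    exact hpd j l fun h => hab (by rw [h])
  obtain ⟨ξ, hξ, h⟩ := exists_jet_eq_dividedDiff
    (by rw [Real.ball_eq_Ioo]; exact ordConnected_Ioo) i F hF s hs hsD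
  refine ⟨ξ, hξ, ?_⟩
  rw [h, abs_mul, Nat.abs_cast]
  have hsum : |∑ y ∈ s, F 0 y / ∏ z ∈ s.erase y, (y - z)| ≤ (i + 1) * (M / δ ^ i) := by
    refine (Finset.abs_sum_le_sum_abs _ _).trans ?_
    have : ∀ y ∈ s, |F 0 y / ∏ z ∈ s.erase y, (y - z)| ≤ M / δ ^ i := fun y hy => by
      rw [abs_div]
      exact div_le_div₀ hM0 (hM y (hsD y hy)) (by positivity)
        (pow_le_prod_erase_abs_sub hδ0.le hs hsep hy)
    refine (Finset.sum_le_sum this).trans ?_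
    rw [Finset.sum_const, hs, nsmul_eq_mul]; push_cast; rfl
  have hfac : (i.factorial : ℝ) * (i + 1) ≤ (N + 1).factorial := by
    have : i.factorial * (i + 1) ≤ (N + 1).factorial := by
      rw [mul_comm, ← Nat.factorial_succ]; exact Nat.factorial_le (by lia)
    exact_mod_cast this
  have hpow : ((N : ℝ) + 2) ^ i ≤ (N + 2) ^ N := pow_le_pow_right₀ (by linarith [Nat.cast_nonneg (α := ℝ) N]) hi
  have hδi : M / δ ^ i = (N + 2) ^ i * M / r ^ i := by
    rw [hδ, div_pow]; field_simp
  calc (i.factorial : ℝ) * |∑ y ∈ s, F 0 y / ∏ z ∈ s.erase y, (y - z)|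
      ≤ i.factorial * ((i + 1) * (M / δ ^ i)) := by gcongr
    _ = (i.factorial * (i + 1)) * (N + 2) ^ i * M / r ^ i := by rw [hδi]; ring
    _ ≤ (N + 1).factorial * (N + 2) ^ N * M / r ^ i := by gcongr

/-- If a function with controlled top derivative is small on a large separated set, it is small. -/
theorem abs_le_of_small_on_separated {x r : ℝ} (hr : 0 < r) (hr1 : r ≤ 1) (F : ℕ → ℝ → ℝ)
    (hF : ∀ i, ∀ y ∈ Metric.ball x r, HasDerivAt (F i) (F (i + 1) y) y)
    (hbdd : BddAbove ((fun y => |F 0 y|) '' Metric.ball x r))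
    {N : ℕ} {K : ℝ} (hK0 : 0 ≤ K)
    (hK : ∀ ξ : ℕ → ℝ, (∀ i ≤ N, ξ i ∈ Metric.ball x r) → ∀ y ∈ Metric.ball x r,
      ∃ i ≤ N, |F (N + 1) y| ≤ K * |F i (ξ i)|)
    (hKr : 2 ^ (N + 1) * K * ((N + 1).factorial * (N + 2) ^ N) * r ≤ 1 / 4)
    {ε η : ℝ} (hη : 0 < η) {s : Finset ℝ} (hs : s.card = N + 1)
    (hsD : ∀ y ∈ s, y ∈ Metric.ball x r) (hsε : ∀ y ∈ s, |F 0 y| < ε)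
    (hsep : ∀ a ∈ s, ∀ b ∈ s, a ≠ b → η ≤ |a - b|) :
    ∀ z ∈ Metric.ball x r, |F 0 z| ≤ 2 * (N + 1) * ε * (2 * r / η) ^ N := by
  classical
  set B := Metric.ball x r
  set M := sSup ((fun y => |F 0 y|) '' B) with hMdef
  have hM : ∀ y ∈ B, |F 0 y| ≤ M := fun y hy => le_csSup hbdd ⟨y, hy, rfl⟩
  have hM0 : 0 ≤ M := (abs_nonneg _).trans (hM x (Metric.mem_ball_self hr))
  set CN : ℝ := (N + 1).factorial * (N + 2) ^ N
  have hCN : 0 ≤ CN := by positivity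
  have hB2 : ∀ a ∈ B, ∀ b ∈ B, |a - b| ≤ 2 * r := fun a ha b hb => by
    rw [Metric.mem_ball, Real.dist_eq, abs_lt] at ha hb
    rw [abs_le]; constructor <;> linarith [ha.1, ha.2, hb.1, hb.2]
  have hε : 0 < ε := by
    obtain ⟨y, hy⟩ : s.Nonempty := by rw [← Finset.card_pos]; lia
    exact (abs_nonneg _).trans_lt (hsε y hy)
  have htop : ∀ y ∈ B, |F (N + 1) y| ≤ K * (CN * M / r ^ N) := by
    choose ξ hξ hξle using fun (i : ℕ) (hi : i ≤ N) => exists_jet_le hr F hF hM hi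
    intro y hy
    obtain ⟨i, hi, h⟩ := hK (fun i => if hi : i ≤ N then ξ i hi else x)
      (fun i hi => by simp only [hi, dif_pos]; exact hξ i hi) y hy
    simp only [hi, dif_pos] at h
    refine h.trans (mul_le_mul_of_nonneg_left ((hξle i hi).trans ?_) hK0)
    exact div_le_div_of_nonneg_left (by positivity) (by positivity)
      (pow_le_pow_of_le_one hr.le hr1 hi)
  have hratio : 1 ≤ (2 * r / η) ^ N := by
    rcases Nat.eq_zero_or_pos N with rfl | hN
    · simp
    · obtain ⟨a, ha, b, hb, hab⟩ := Finset.one_lt_card.1 (show 1 < s.card by lia)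
      refine one_le_pow₀ ((one_le_div hη).2 ((hsep a ha b hb hab).trans ?_))
      exact hB2 a (hsD a ha) b (hsD b hb)
  set E := (N + 1) * ε * (2 * r / η) ^ N with hE
  have hmain : ∀ z ∈ B, |F 0 z| ≤ M / 4 + E := by
    intro z hz
    by_cases hzs : z ∈ s
    · have h1 := hsε z hzs
      have h2 : ε ≤ E := by
        rw [hE]
        have : (1 : ℝ) ≤ N + 1 := by linarith [Nat.cast_nonneg (α := ℝ) N]
        calc ε = 1 * ε * 1 := by ring
          _ ≤ (N + 1) * ε * (2 * r / η) ^ N := by gcongr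
      linarith
    · have hcard : (insert z s).card = (N + 1) + 1 := by rw [Finset.card_insert_of_notMem hzs, hs]
      obtain ⟨ξ, hξ, h⟩ := exists_jet_eq_dividedDiff
        (D := B) (by rw [show B = _ from Real.ball_eq_Ioo x r]; exact ordConnected_Ioo)
        (N + 1) F hF (insert z s) hcard
        (by
          intro y hy
          rcases Finset.mem_insert.1 hy with h | hy
          · rw [h]; exact hz
          · exact hsD y hy)
      rw [Finset.sum_insert hzs, Finset.erase_insert hzs] at h
      set Q₀ := ∏ y ∈ s, (z - y) with hQ₀
      have hzy : ∀ y ∈ s, z - y ≠ 0 := fun y hy h0 => hzs (by rw [sub_eq_zero.1 h0]; exact hy)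
      have hQne : Q₀ ≠ 0 := Finset.prod_ne_zero_iff.2 hzy
      have hfne : ((N + 1).factorial : ℝ) ≠ 0 := by positivity
      have hsolve : F 0 z = Q₀ * (F (N + 1) ξ / (N + 1).factorial) -
          ∑ y ∈ s, Q₀ * (F 0 y / ∏ w ∈ (insert z s).erase y, (y - w)) := by
        rw [h, ← Finset.mul_sum]; field_simp; ring
      have hQle : |Q₀| ≤ (2 * r) ^ (N + 1) := by
        rw [hQ₀, Finset.abs_prod]
        calc ∏ y ∈ s, |z - y| ≤ ∏ _y ∈ s, (2 * r) :=
              Finset.prod_le_prod (fun _ _ => abs_nonneg _) fun y hy => hB2 z hz y (hsD y hy)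
          _ = _ := by rw [Finset.prod_const, hs]
      have hterm : ∀ y ∈ s, |Q₀ * (F 0 y / ∏ w ∈ (insert z s).erase y, (y - w))| ≤
          ε * (2 * r / η) ^ N := by
        intro y hy
        have hne : z ≠ y := fun h => hzs (h ▸ hy)
        rw [Finset.erase_insert_of_ne hne, Finset.prod_insert
          (fun hmem => hzs (Finset.mem_of_mem_erase hmem)), hQ₀, ← Finset.mul_prod_erase s _ hy]
        have h1 := pow_le_prod_erase_abs_sub hη.le hs hsep hy
        have hlow : 0 < η ^ N := by positivity
        have hup : |∏ w ∈ s.erase y, (z - w)| ≤ (2 * r) ^ N := by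
          rw [Finset.abs_prod]
          calc ∏ w ∈ s.erase y, |z - w| ≤ ∏ _w ∈ s.erase y, (2 * r) :=
                Finset.prod_le_prod (fun _ _ => abs_nonneg _) fun w hw =>
                  hB2 z hz w (hsD w (Finset.mem_of_mem_erase hw))
            _ = _ := by rw [Finset.prod_const, Finset.card_erase_of_mem hy, hs]; rfl
        have hd : |z - y| ≠ 0 := abs_ne_zero.2 (hzy y hy)
        rw [abs_mul, abs_mul, abs_div, abs_mul, abs_sub_comm y z]
        set P1 := |∏ w ∈ s.erase y, (z - w)|
        set P2 := |∏ w ∈ s.erase y, (y - w)|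
        have hP2 : 0 < P2 := hlow.trans_le h1
        have : |z - y| * P1 * (|F 0 y| / (|z - y| * P2)) = |F 0 y| * (P1 / P2) := by
          field_simp
        rw [this, div_pow]
        exact mul_le_mul (hsε y hy).le (div_le_div₀ (by positivity) hup hlow h1)
          (by positivity) hε.le
      have hsum := (Finset.abs_sum_le_sum_abs (fun y => Q₀ * (F 0 y /
        ∏ w ∈ (insert z s).erase y, (y - w))) s).trans (Finset.sum_le_sum hterm)
      rw [Finset.sum_const, hs, nsmul_eq_mul] at hsum
      have hfirst : |Q₀ * (F (N + 1) ξ / (N + 1).factorial)| ≤ M / 4 := by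
        rw [abs_mul, abs_div, Nat.abs_cast]
        have hf1 : (1 : ℝ) ≤ (N + 1).factorial := by exact_mod_cast Nat.succ_le_of_lt (Nat.factorial_pos _)
        have hdiv : |F (N + 1) ξ| / (N + 1).factorial ≤ K * (CN * M / r ^ N) :=
          (div_le_self (abs_nonneg _) hf1).trans (htop ξ hξ)
        calc |Q₀| * (|F (N + 1) ξ| / (N + 1).factorial)
            ≤ (2 * r) ^ (N + 1) * (K * (CN * M / r ^ N)) := by gcongr
          _ = (2 ^ (N + 1) * K * CN * r) * M := by rw [mul_pow, pow_succ r N]; field_simp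
          _ ≤ (1 / 4) * M := mul_le_mul_of_nonneg_right hKr hM0
          _ = M / 4 := by ring
      rw [hsolve]
      refine (abs_sub _ _).trans ?_
      refine add_le_add hfirst (hsum.trans (le_of_eq ?_))
      rw [hE]; push_cast; ring
  have hMle : M ≤ M / 4 + E := csSup_le ⟨_, x, Metric.mem_ball_self hr, rfl⟩ (by
    rintro _ ⟨z, hz, rfl⟩; exact hmain z hz)
  intro z hz
  have h1 := hM z hz
  have h2 : 0 ≤ E := by positivity
  have : (2 : ℝ) * (N + 1) * ε * (2 * r / η) ^ N = 2 * E := by rw [hE]; ring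
  rw [this]; linarith

/-- If all derivatives of an analytic function vanish at the centre of a ball, the function and all
its derivatives vanish on the ball. -/
theorem jet_eq_zero_of_center {x₀ R : ℝ} (hR : 0 < R) (F : ℕ → ℝ → ℝ)
    (hF : ∀ i, ∀ y ∈ Metric.ball x₀ R, HasDerivAt (F i) (F (i + 1) y) y)
    (han : AnalyticOnNhd ℝ (F 0) (Metric.ball x₀ R)) (h0 : ∀ i, F i x₀ = 0) :
    ∀ i, ∀ y ∈ Metric.ball x₀ R, F i y = 0 := by
  have hmem : x₀ ∈ Metric.ball x₀ R := Metric.mem_ball_self hR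
  have hiter : ∀ i, ∀ y ∈ Metric.ball x₀ R, iteratedDeriv i (F 0) y = F i y := by
    intro i
    induction i with
    | zero => intro y _; rw [iteratedDeriv_zero]
    | succ i ih =>
      intro y hy
      rw [iteratedDeriv_succ]
      have : iteratedDeriv i (F 0) =ᶠ[nhds y] F i :=
        Filter.eventuallyEq_of_mem (Metric.isOpen_ball.mem_nhds hy) ih
      rw [this.deriv_eq]
      exact (hF i y hy).deriv
  have hord : analyticOrderAt (F 0) x₀ = ⊤ := by
    rw [ENat.eq_top_iff_forall_ge]
    intro m
    rw [natCast_le_analyticOrderAt_iff_iteratedDeriv_eq_zero (han x₀ hmem)]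
    intro i _
    rw [hiter i x₀ hmem, h0]
  have hz : EqOn (F 0) 0 (Metric.ball x₀ R) :=
    han.eqOn_zero_of_preconnected_of_eventuallyEq_zero
      (convex_ball x₀ R).isPreconnected hmem (analyticOrderAt_eq_top.1 hord)
  intro i
  induction i with
  | zero => exact hz
  | succ i ih =>
    intro y hy
    have : F i =ᶠ[nhds y] fun _ => 0 :=
      Filter.eventuallyEq_of_mem (Metric.isOpen_ball.mem_nhds hy) ih
    exact (hF i y hy).unique ((hasDerivAt_const y (0 : ℝ)).congr_of_eventuallyEq this)

/-- Linear combinations of finitely many analytic functions have a high derivative controlled by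
the lower ones, uniformly in the coefficients. -/
theorem exists_uniform_jet_bound {κ : Type*} [Fintype κ] (f : κ → ℝ → ℝ) (x₀ : ℝ)
    (hf : ∀ k, AnalyticAt ℝ (f k) x₀) :
    ∃ R > 0, ∃ (N : ℕ) (K : ℝ) (A : ℝ) (G : κ → ℕ → ℝ → ℝ), 1 ≤ N ∧ 0 ≤ K ∧ (∀ k, G k 0 = f k) ∧
      (∀ k i, ∀ y ∈ Metric.ball x₀ R, HasDerivAt (G k i) (G k (i + 1) y) y) ∧
      (∀ k, ∀ y ∈ Metric.ball x₀ R, |f k y| ≤ A) ∧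
      ∀ (c : κ → ℝ) (ξ : ℕ → ℝ), (∀ i ≤ N, ξ i ∈ Metric.ball x₀ R) →
        ∀ y ∈ Metric.ball x₀ R, ∃ i ≤ N,
          |∑ k, c k * G k (N + 1) y| ≤ K * |∑ k, c k * G k i (ξ i)| := by
  classical
  set G : κ → ℕ → ℝ → ℝ := fun k i => deriv^[i] (f k) with hG
  have hev : ∀ᶠ y in nhds x₀, ∀ k, AnalyticAt ℝ (f k) y :=
    eventually_all.2 fun k => (hf k).eventually_analyticAt
  obtain ⟨R₁, hR₁, han⟩ := Metric.eventually_nhds_iff_ball.1 hev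
  have hder : ∀ k i, ∀ y ∈ Metric.ball x₀ R₁, HasDerivAt (G k i) (G k (i + 1) y) y := by
    intro k i y hy
    have h := ((han y hy k).iterated_deriv i).differentiableAt.hasDerivAt
    simp only [hG, Function.iterate_succ_apply']
    exact h
  have hmem : x₀ ∈ Metric.ball x₀ R₁ := Metric.mem_ball_self hR₁
  have hcont : ∀ k i, ContinuousAt (G k i) x₀ := fun k i => (hder k i x₀ hmem).continuousAt
  let T : ℕ → (κ → ℝ) →ₗ[ℝ] ℝ := fun i =>
    ∑ k, (G k i x₀) • (LinearMap.proj k : (κ → ℝ) →ₗ[ℝ] ℝ)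
  have hT : ∀ i c, T i c = ∑ k, c k * G k i x₀ := fun i c => by
    simp only [T, LinearMap.sum_apply, LinearMap.smul_apply, LinearMap.proj_apply, smul_eq_mul]
    exact Finset.sum_congr rfl fun k _ => mul_comm _ _
  let Kn : ℕ →o (Submodule ℝ (κ → ℝ))ᵒᵈ :=
    ⟨fun n => OrderDual.toDual (⨅ i : {i // i ≤ n}, (T i).ker), fun n m hnm => by
      refine OrderDual.toDual_le_toDual.2 ?_
      exact le_iInf fun i => iInf_le_of_le ⟨i.1, i.2.trans hnm⟩ le_rfl⟩
  obtain ⟨N', hN'⟩ := IsArtinian.monotone_stabilizes Kn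
  obtain ⟨N, hN1, hN⟩ : ∃ N, 1 ≤ N ∧ ∀ m, N ≤ m → Kn N = Kn m :=
    ⟨N' + 1, by lia, fun m hm => by rw [← hN' (N' + 1) (by lia), ← hN' m (by lia)]⟩
  have hKn : ∀ n c, c ∈ OrderDual.ofDual (Kn n) ↔ ∀ i ≤ n, T i c = 0 := fun n c => by
    simp [Kn, Submodule.mem_iInf]
  set V₀ : Submodule ℝ (κ → ℝ) := OrderDual.ofDual (Kn N) with hV₀
  have hker : ∀ c ∈ V₀, ∀ i, T i c = 0 := fun c hc i => by
    have : c ∈ OrderDual.ofDual (Kn (max N i)) := by rw [← hN _ (le_max_left N i)]; exact hc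
    exact (hKn _ c).1 this i (le_max_right _ _)
  have hder' : ∀ (c : κ → ℝ) (i : ℕ), ∀ y ∈ Metric.ball x₀ R₁,
      HasDerivAt (fun y => ∑ k, c k * G k i y) (∑ k, c k * G k (i + 1) y) y := fun c i y hy =>
    HasDerivAt.fun_sum fun k _ => (hder k i y hy).const_mul (c k)
  have hzero : ∀ c ∈ V₀, ∀ i, ∀ y ∈ Metric.ball x₀ R₁, ∑ k, c k * G k i y = 0 := fun c hc =>
    jet_eq_zero_of_center hR₁ (fun i y => ∑ k, c k * G k i y) (hder' c)
      (fun y hy => Finset.univ.analyticAt_fun_sum fun k _ => analyticAt_const.mul (han y hy k))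
      (fun i => by rw [← hT]; exact hker c hc i)
  obtain ⟨V₁, hV⟩ := Submodule.exists_isCompl V₀
  let Lm : V₁ →ₗ[ℝ] (Fin (N + 1) → ℝ) := LinearMap.pi fun i => (T i).comp V₁.subtype
  have hLm : ∀ c i, Lm c i = T i c := fun c i => rfl
  have hinj : Lm.ker = ⊥ := by
    rw [LinearMap.ker_eq_bot']
    intro c hc
    have : (c : κ → ℝ) ∈ V₀ := (hKn N c).2 fun i hi => by
      have := congr_fun hc ⟨i, Nat.lt_succ_of_le hi⟩
      simpa [hLm] using this
    have h0 : (c : κ → ℝ) ∈ V₀ ⊓ V₁ := ⟨this, c.2⟩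
    rw [hV.inf_eq_bot, Submodule.mem_bot] at h0
    exact Subtype.ext h0
  obtain ⟨Ka, hKa, hanti⟩ := Lm.exists_antilipschitzWith hinj
  have hKa' : (0 : ℝ) < Ka := by exact_mod_cast hKa
  have hlow : ∀ c : V₁, ∃ i ≤ N, ‖(c : κ → ℝ)‖ ≤ Ka * |T i c| := by
    intro c
    have h1 := hanti.le_mul_dist c 0
    rw [dist_zero_right, map_zero, dist_zero_right] at h1
    obtain ⟨i, _, hi⟩ := Finset.exists_mem_eq_sup' (Finset.univ_nonempty (α := Fin (N + 1)))
      (fun i => ‖Lm c i‖)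
    refine ⟨i, Nat.lt_succ_iff.1 i.2, ?_⟩
    have h2 : ‖Lm c‖ ≤ ‖Lm c i‖ := by
      rw [pi_norm_le_iff_of_nonneg (norm_nonneg _)]
      intro j
      rw [← hi]
      exact Finset.le_sup' (fun i => ‖Lm c i‖) (Finset.mem_univ j)
    calc ‖(c : κ → ℝ)‖ = ‖c‖ := rfl
      _ ≤ Ka * ‖Lm c‖ := h1
      _ ≤ Ka * ‖Lm c i‖ := by gcongr
      _ = Ka * |T i c| := by rw [hLm, Real.norm_eq_abs]
  set m : ℝ := (Fintype.card κ : ℝ)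
  set δ : ℝ := 1 / (2 * Ka * (m + 1)) with hδ
  have hm : 0 ≤ m := Nat.cast_nonneg _
  have hδ0 : 0 < δ := by positivity
  have hclose : ∀ᶠ y in nhds x₀, ∀ k, ∀ i : Fin (N + 2), |G k i y - G k i x₀| < min δ 1 := by
    refine eventually_all.2 fun k => eventually_all.2 fun i => ?_
    have := (Metric.continuousAt_iff'.1 (hcont k i)) (min δ 1) (lt_min hδ0 one_pos)
    simpa [Real.dist_eq] using this
  obtain ⟨R₂, hR₂, hclose⟩ := Metric.eventually_nhds_iff_ball.1 hclose
  set A : ℝ := 1 + ∑ k, ∑ i : Fin (N + 2), |G k i x₀| with hA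
  have hGA : ∀ k (i : Fin (N + 2)), ∀ y ∈ Metric.ball x₀ R₂, |G k i y| ≤ A := by
    intro k i y hy
    have h1 : |G k i x₀| ≤ ∑ k, ∑ i : Fin (N + 2), |G k i x₀| :=
      (Finset.single_le_sum (f := fun i : Fin (N + 2) => |G k i x₀|)
        (fun _ _ => abs_nonneg _) (Finset.mem_univ i)).trans
      (Finset.single_le_sum (f := fun k => ∑ i : Fin (N + 2), |G k i x₀|)
        (fun _ _ => Finset.sum_nonneg fun _ _ => abs_nonneg _) (Finset.mem_univ k))
    have h2 := (hclose y hy k i).le.trans (min_le_right _ _)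
    have h3 := abs_sub_abs_le_abs_sub (G k i y) (G k i x₀)
    linarith
  have hA0 : 0 ≤ A := by positivity
  refine ⟨min R₁ R₂, lt_min hR₁ hR₂, N, 2 * m * A * Ka, A, G, hN1, by positivity, fun k => rfl,
    fun k i y hy => hder k i y (Metric.ball_subset_ball (min_le_left _ _) hy),
    fun k y hy => hGA k 0 y (Metric.ball_subset_ball (min_le_right _ _) hy), ?_⟩
  intro c ξ hξ y hy
  obtain ⟨c₀, hc₀, c₁, hc₁, rfl⟩ := Submodule.mem_sup.1
    (show c ∈ V₀ ⊔ V₁ by rw [hV.sup_eq_top]; trivial)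
  have hred : ∀ i, ∀ z ∈ Metric.ball x₀ (min R₁ R₂),
      ∑ k, (c₀ + c₁) k * G k i z = ∑ k, c₁ k * G k i z := by
    intro i z hz
    have := hzero c₀ hc₀ i z (Metric.ball_subset_ball (min_le_left _ _) hz)
    simp only [Pi.add_apply, add_mul, Finset.sum_add_distrib, this, zero_add]
  obtain ⟨i, hi, hle⟩ := hlow ⟨c₁, hc₁⟩
  simp only at hle
  refine ⟨i, hi, ?_⟩
  rw [hred _ y hy, hred _ _ (hξ i hi)]
  have hck : ∀ k, |c₁ k| ≤ ‖c₁‖ := fun k => norm_le_pi_norm c₁ k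
  have hdiff : |T i c₁| ≤ |∑ k, c₁ k * G k i (ξ i)| + m * (‖c₁‖ * δ) := by
    have h1 : T i c₁ - ∑ k, c₁ k * G k i (ξ i) = ∑ k, c₁ k * (G k i x₀ - G k i (ξ i)) := by
      rw [hT, ← Finset.sum_sub_distrib]
      exact Finset.sum_congr rfl fun k _ => by ring
    have h2 : |T i c₁ - ∑ k, c₁ k * G k i (ξ i)| ≤ m * (‖c₁‖ * δ) := by
      rw [h1]
      refine (Finset.abs_sum_le_sum_abs _ _).trans ?_
      calc ∑ k, |c₁ k * (G k i x₀ - G k i (ξ i))| ≤ ∑ _k : κ, ‖c₁‖ * δ := by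
            refine Finset.sum_le_sum fun k _ => ?_
            rw [abs_mul, abs_sub_comm]
            have h4 := hclose (ξ i) (Metric.ball_subset_ball (min_le_right _ _) (hξ i hi)) k
              ⟨i, by lia⟩
            exact mul_le_mul (hck k) (h4.le.trans (min_le_left _ _)) (abs_nonneg _) (norm_nonneg _)
        _ = m * (‖c₁‖ * δ) := by rw [Finset.sum_const, nsmul_eq_mul, Finset.card_univ]
    have h3 := abs_sub_abs_le_abs_sub (T i c₁) (∑ k, c₁ k * G k i (ξ i))
    linarith
  set S := |∑ k, c₁ k * G k i (ξ i)|
  have hnorm : ‖c₁‖ ≤ 2 * Ka * S := by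
    have h5 : Ka * (m * (‖c₁‖ * δ)) ≤ ‖c₁‖ / 2 := by
      have : Ka * (m * (‖c₁‖ * δ)) = (m / (m + 1)) * (‖c₁‖ / 2) := by rw [hδ]; field_simp
      rw [this]
      exact mul_le_of_le_one_left (by positivity) ((div_le_one (by positivity)).2 (by linarith))
    have h6 : Ka * |T i c₁| ≤ Ka * (S + m * (‖c₁‖ * δ)) := by gcongr
    linarith
  have htop : |∑ k, c₁ k * G k (N + 1) y| ≤ m * (‖c₁‖ * A) := by
    refine (Finset.abs_sum_le_sum_abs _ _).trans ?_
    calc ∑ k, |c₁ k * G k (N + 1) y| ≤ ∑ _k : κ, ‖c₁‖ * A := by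
          refine Finset.sum_le_sum fun k _ => ?_
          rw [abs_mul]
          have h4 := hGA k ⟨N + 1, by lia⟩ y (Metric.ball_subset_ball (min_le_right _ _) hy)
          exact mul_le_mul (hck k) h4 (abs_nonneg _) (norm_nonneg _)
      _ = m * (‖c₁‖ * A) := by rw [Finset.sum_const, nsmul_eq_mul, Finset.card_univ]
  calc _ ≤ m * (‖c₁‖ * A) := htop
    _ ≤ m * (2 * Ka * S * A) := by gcongr
    _ = 2 * m * A * Ka * S := by ring

/-- Sublevel sets of linear combinations of finitely many analytic functions are covered by a
bounded number of small balls. -/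
theorem exists_uniform_sublevel_cover {κ : Type*} [Fintype κ] (f : κ → ℝ → ℝ) (x₀ : ℝ)
    (hf : ∀ k, AnalyticAt ℝ (f k) x₀) :
    ∃ R > 0, ∃ (N : ℕ) (C : ℝ), 1 ≤ N ∧ 0 < C ∧ ∀ (c : κ → ℝ) (x r : ℝ), 0 < r →
      Metric.ball x r ⊆ Metric.ball x₀ R → ∀ ε τ : ℝ, 0 < ε → 0 < τ →
      (∃ z ∈ Metric.ball x r, τ ≤ |∑ k, c k * f k z|) →
      ∀ A ⊆ {y ∈ Metric.ball x r | |∑ k, c k * f k y| < ε},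
      ∃ s : Finset ℝ, ↑s ⊆ A ∧ s.card ≤ N ∧
        A ⊆ ⋃ y ∈ s, Metric.ball y (C * (ε / τ) ^ (1 / (N : ℝ)) * r) := by
  obtain ⟨R₀, hR₀, N, K, B, G, hN1, hK0, hG0, hder, hB, hK⟩ := exists_uniform_jet_bound f x₀ hf
  set D : ℝ := 2 ^ (N + 1) * K * ((N + 1).factorial * (N + 2) ^ N) with hD
  have hD0 : 0 ≤ D := by positivity
  set R₁ : ℝ := 1 / (4 * (D + 1)) with hR₁
  have hR₁0 : 0 < R₁ := by positivity
  set R := min R₀ (min R₁ 1)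
  have hR : 0 < R := lt_min hR₀ (lt_min hR₁0 one_pos)
  have hN0 : (0 : ℝ) < N := by exact_mod_cast hN1
  refine ⟨R, hR, N, 8 * (N + 1), hN1, by positivity, ?_⟩
  intro c x r hr hsub ε τ hε hτ hz A hA
  have hsub₀ : Metric.ball x r ⊆ Metric.ball x₀ R₀ :=
    hsub.trans (Metric.ball_subset_ball (min_le_left _ _))
  have hrR : r ≤ R := by
    by_contra! hlt
    have h1 : ∀ u ∈ Metric.ball x r, |u - x₀| < R := fun u hu => by
      simpa [Real.dist_eq] using hsub hu
    have h2 : ∀ t, |t| < r → |x + t - x₀| < R := fun t ht => h1 _ (by simpa [Real.dist_eq] using ht)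
    have h3 := h2 R (by rwa [abs_of_pos hR])
    have h4 := h2 (-R) (by rwa [abs_neg, abs_of_pos hR])
    rw [abs_lt] at h3 h4
    linarith [h3.2, h4.1]
  have hr1 : r ≤ 1 := hrR.trans ((min_le_right _ _).trans (min_le_right _ _))
  have hrR₁ : r ≤ R₁ := hrR.trans ((min_le_right _ _).trans (min_le_left _ _))
  set u := ε / τ with hu
  have hu0 : 0 < u := div_pos hε hτ
  set w := u ^ (1 / (N : ℝ)) with hw
  have hw0 : 0 < w := Real.rpow_pos_of_pos hu0 _
  have hwN : w ^ N = u := by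
    rw [hw, ← Real.rpow_natCast, ← Real.rpow_mul hu0.le, one_div_mul_cancel hN0.ne', Real.rpow_one]
  set η := 8 * (N + 1) * w * r with hη
  have hη0 : 0 < η := by positivity
  have hcard : ∀ s : Finset ℝ, ↑s ⊆ A → (∀ x ∈ s, ∀ y ∈ s, x ≠ y → η ≤ |x - y|) →
      s.card ≤ N := by
    intro s hsA hsep
    by_contra! hlt
    obtain ⟨s', hs's, hs'⟩ := Finset.exists_subset_card_eq (show N + 1 ≤ s.card from hlt)
    obtain ⟨z, hz, hτz⟩ := hz
    have hF0 : ∀ y, ∑ k, c k * G k 0 y = ∑ k, c k * f k y := fun y => by simp only [hG0]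
    have := abs_le_of_small_on_separated hr hr1 (fun i y => ∑ k, c k * G k i y)
      (fun i y hy => HasDerivAt.fun_sum fun k _ => (hder k i y (hsub₀ hy)).const_mul (c k))
      ⟨∑ k, |c k| * B, by
        rintro _ ⟨y, hy, rfl⟩
        simp only [hG0]
        refine (Finset.abs_sum_le_sum_abs _ _).trans (Finset.sum_le_sum fun k _ => ?_)
        rw [abs_mul]
        exact mul_le_mul_of_nonneg_left (hB k y (hsub₀ hy)) (abs_nonneg _)⟩
      hK0 (fun ξ hξ y hy => hK c ξ (fun i hi => hsub₀ (hξ i hi)) y (hsub₀ hy))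
      (by
        calc D * r ≤ D * R₁ := by gcongr
          _ = (D / (D + 1)) * (1 / 4) := by rw [hR₁]; field_simp
          _ ≤ 1 * (1 / 4) := by
            gcongr; exact (div_le_one (by positivity)).2 (by linarith)
          _ = 1 / 4 := one_mul _)
      hη0 hs' (fun y hy => (hA (hsA (hs's hy))).1)
      (fun y hy => by rw [hF0]; exact (hA (hsA (hs's hy))).2)
      (fun a ha b hb hab => hsep a (hs's ha) b (hs's hb) hab) z hz
    rw [hF0] at this
    have h1 : 2 * r / η = 1 / (4 * (N + 1)) * (1 / w) := by rw [hη]; field_simp; norm_num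
    rw [h1, mul_pow, one_div_pow, one_div_pow w, hwN] at this
    have h2 : (1 : ℝ) / (4 * (N + 1)) ^ N ≤ 1 / (4 * (N + 1)) := by
      refine one_div_le_one_div_of_le (by positivity) ?_
      exact le_self_pow₀ (by linarith) (by lia)
    have h3 : 2 * ((N : ℝ) + 1) * ε * (1 / (4 * (N + 1)) ^ N * (1 / u)) ≤
        2 * ((N : ℝ) + 1) * ε * (1 / (4 * (N + 1)) * (1 / u)) := by gcongr
    have h4 : 2 * ((N : ℝ) + 1) * ε * (1 / (4 * (N + 1)) * (1 / u)) = τ / 2 := by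
      rw [hu]; field_simp; norm_num
    linarith
  obtain ⟨s, hsA, _, hsN, hcov⟩ := exists_cover_of_separated_card_le hcard
  refine ⟨s, hsA, hsN, fun y hy => ?_⟩
  obtain ⟨a, ha, h⟩ := hcov y hy
  refine mem_iUnion₂.2 ⟨a, ha, ?_⟩
  rw [Metric.mem_ball, Real.dist_eq]
  rcases h with rfl | h
  · simpa using hη0
  · exact h

/-- Linear combinations of finitely many analytic functions are uniformly good with respect to a
measure with polynomial ball growth. -/
theorem exists_uniform_good {κ : Type*} [Fintype κ] (f : κ → ℝ → ℝ) (x₀ : ℝ)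
    (hf : ∀ k, AnalyticAt ℝ (f k) x₀) {μ : Measure ℝ} {X : Set ℝ} {α b ρm : ℝ} (hα : 0 < α)
    (hb : 0 ≤ b)
    (hup : ∀ x ∈ X, ∀ ρ, 0 < ρ → ρ ≤ ρm → μ (Metric.ball x ρ) ≤ ENNReal.ofReal (b * ρ ^ α)) :
    ∃ R > 0, ∃ G γ : ℝ, 0 ≤ G ∧ 0 < γ ∧ ∀ (c : κ → ℝ), ∀ x ∈ X, ∀ r, 0 < r → r ≤ ρm →
      Metric.ball x r ⊆ Metric.ball x₀ R → ∀ ε τ : ℝ, 0 < ε → 0 < τ →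
      (∃ z ∈ Metric.ball x r, τ ≤ |∑ k, c k * f k z|) →
      μ {y ∈ Metric.ball x r ∩ X | |∑ k, c k * f k y| < ε} ≤
        ENNReal.ofReal (G * (ε / τ) ^ γ * r ^ α) := by
  obtain ⟨R, hR, N, C, hN1, hC, hcov⟩ := exists_uniform_sublevel_cover f x₀ hf
  have hN0 : (0 : ℝ) < N := by exact_mod_cast hN1
  refine ⟨R, hR, N * b * C ^ α, α / N, by positivity, by positivity, ?_⟩
  intro c x hx r hr hrm hsub ε τ hε hτ hz
  set A := {y ∈ Metric.ball x r ∩ X | |∑ k, c k * f k y| < ε}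
  set w := (ε / τ) ^ (1 / (N : ℝ)) with hw
  have hu0 : 0 < ε / τ := div_pos hε hτ
  have hw0 : 0 < w := Real.rpow_pos_of_pos hu0 _
  have hwα : w ^ α = (ε / τ) ^ (α / N) := by
    rw [hw, ← Real.rpow_mul hu0.le]; congr 1; ring
  have hrhs : N * b * C ^ α * (ε / τ) ^ (α / N) * r ^ α = N * (b * (C * w * r) ^ α) := by
    rw [Real.mul_rpow (by positivity) hr.le, Real.mul_rpow hC.le hw0.le, hwα]; ring
  rw [hrhs]
  by_cases hle : C * w * r ≤ r
  · obtain ⟨s, hsA, hsN, hAs⟩ := hcov c x r hr hsub ε τ hε hτ hz A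
      (fun y hy => ⟨hy.1.1, hy.2⟩)
    calc μ A ≤ μ (⋃ y ∈ s, Metric.ball y (C * w * r)) := measure_mono hAs
      _ ≤ ∑ y ∈ s, μ (Metric.ball y (C * w * r)) := measure_biUnion_finset_le _ _
      _ ≤ ∑ _y ∈ s, ENNReal.ofReal (b * (C * w * r) ^ α) :=
        Finset.sum_le_sum fun y hy => hup y (hsA hy).1.2 _ (by positivity) (hle.trans hrm)
      _ = s.card * ENNReal.ofReal (b * (C * w * r) ^ α) := by
        rw [Finset.sum_const, nsmul_eq_mul]
      _ ≤ N * ENNReal.ofReal (b * (C * w * r) ^ α) := by gcongr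
      _ = _ := by rw [ENNReal.ofReal_mul hN0.le, ENNReal.ofReal_natCast]
  · calc μ A ≤ μ (Metric.ball x r) := measure_mono fun y hy => hy.1.1
      _ ≤ ENNReal.ofReal (b * r ^ α) := hup x hx r hr hrm
      _ ≤ _ := ENNReal.ofReal_le_ofReal (by
        have h1 : r ^ α ≤ (C * w * r) ^ α :=
          Real.rpow_le_rpow hr.le (le_of_not_ge hle) hα.le
        have h2 : (1 : ℝ) ≤ N := by exact_mod_cast hN1
        have h3 : 0 ≤ b * (C * w * r) ^ α := by positivity
        nlinarith [mul_le_mul_of_nonneg_left h1 hb])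

/-- A point `y` is marked for a poset `P` of functions if some chain in `P` has values in `[ε, ρ]`
at `y` while all other elements comparable to the chain have values at least `ρ`. -/
def Marked {S : Type*} [Preorder S] (ψ : S → ℝ → ℝ) (ε ρ : ℝ) (P : Set S) (y : ℝ) : Prop :=
  ∃ T ⊆ P, IsChain (· ≤ ·) T ∧ (∀ s ∈ T, ε ≤ ψ s y ∧ ψ s y ≤ ρ) ∧
    ∀ s ∈ P, s ∉ T → (∀ t ∈ T, s ≤ t ∨ t ≤ s) → ρ ≤ ψ s y

/-- Uniform goodness of a family of functions on a region. -/
def UniformlyGood {S : Type*} (μ : Measure ℝ) (X Reg : Set ℝ) (α ρm G γ : ℝ) (ψ : S → ℝ → ℝ) :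
    Prop :=
  ∀ s, ∀ x ∈ X, ∀ r, 0 < r → r ≤ ρm → Metric.ball x r ⊆ Reg → ∀ ε τ : ℝ, 0 < ε → 0 < τ →
    (∃ z ∈ Metric.ball x r, τ ≤ ψ s z) →
    μ {y ∈ Metric.ball x r ∩ X | ψ s y < ε} ≤ ENNReal.ofReal (G * (ε / τ) ^ γ * r ^ α)

/-- Every unmarked point has a radius at which one function of the poset is small and at whose
double all functions are large somewhere. -/
theorem exists_radius_of_not_marked {S : Type*} [Preorder S] {ψ : S → ℝ → ℝ} {ε ρ : ℝ} {P : Set S}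
    {x₀ r y : ℝ} (hy : y ∈ Metric.ball x₀ r)
    (hc : ∀ s, ContinuousAt (ψ s) y)
    (hP : ∀ s ∈ P, ∃ z ∈ Metric.ball x₀ r, ρ ≤ ψ s z) (hm : ¬ Marked ψ ε ρ P y) :
    ∃ t, 0 < t ∧ t ≤ 2 * r ∧ (∃ s ∈ P, ∀ z ∈ Metric.ball y t, ψ s z < ρ) ∧
      ∀ s ∈ P, ∃ z ∈ Metric.ball y (2 * t), ρ ≤ ψ s z := by
  set Rad : Set ℝ := {t | 0 < t ∧ ∃ s ∈ P, ∀ z ∈ Metric.ball y t, ψ s z < ρ}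
  have hne : Rad.Nonempty := by
    have : ∃ s ∈ P, ψ s y < ρ := by
      by_contra! hcon
      exact hm ⟨∅, empty_subset _, by simp, by simp, fun s hs _ _ => hcon s hs⟩
    obtain ⟨s, hs, hlt⟩ := this
    obtain ⟨t, ht, h⟩ := Metric.eventually_nhds_iff_ball.1 ((hc s).eventually_lt_const hlt)
    exact ⟨t, ht, s, hs, h⟩
  have hub : ∀ t ∈ Rad, t ≤ 2 * r := by
    rintro t ⟨_, s, hs, h⟩
    by_contra! hlt
    obtain ⟨z, hz, hρ⟩ := hP s hs
    refine absurd (h z ?_) (not_lt.2 hρ)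
    rw [Metric.mem_ball] at hy hz ⊢
    linarith [dist_triangle_right z y x₀]
  have hbdd : BddAbove Rad := ⟨2 * r, hub⟩
  have hpos : 0 < sSup Rad := by
    obtain ⟨t, ht⟩ := hne
    exact ht.1.trans_le (le_csSup hbdd ht)
  obtain ⟨t, ht, hlt⟩ := exists_lt_of_lt_csSup hne (half_lt_self hpos)
  refine ⟨t, ht.1, hub t ht, ht.2, fun s hs => ?_⟩
  by_contra! hcon
  have : 2 * t ≤ sSup Rad := le_csSup hbdd ⟨by linarith [ht.1], s, hs, hcon⟩
  linarith

/-- Quantitative nondivergence: the set of unmarked points is small. -/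
theorem measure_not_marked_le {S : Type*} [PartialOrder S] {μ : Measure ℝ} {X Reg : Set ℝ}
    {α a b ρm G γ : ℝ} (ha : 0 < a) (hb : 0 ≤ b) (hG : 0 ≤ G)
    (hlow : ∀ x ∈ X, ∀ ρ, 0 < ρ → ρ ≤ ρm → ENNReal.ofReal (a * ρ ^ α) ≤ μ (Metric.ball x ρ))
    (hup : ∀ x ∈ X, ∀ ρ, 0 < ρ → ρ ≤ ρm → μ (Metric.ball x ρ) ≤ ENNReal.ofReal (b * ρ ^ α))
    (m : ℕ) :
    ∃ C : ℝ, 0 ≤ C ∧ ∀ (ψ : S → ℝ → ℝ), UniformlyGood μ X Reg α ρm G γ ψ →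
      (∀ s, ∀ y ∈ Reg, ContinuousAt (ψ s) y) → ∀ (P : Set S),
      (∀ T : Finset S, ↑T ⊆ P → IsChain (· ≤ ·) (T : Set S) → T.card ≤ m) →
      ∀ x₀ ∈ X, ∀ r, 0 < r → 5 ^ m * r ≤ ρm → Metric.ball x₀ (5 ^ m * r) ⊆ Reg →
      ∀ ε ρ : ℝ, 0 < ε → 0 < ρ → (∀ s ∈ P, ∃ z ∈ Metric.ball x₀ r, ρ ≤ ψ s z) →
      μ {y ∈ Metric.ball x₀ r ∩ X | ¬ Marked ψ ε ρ P y} ≤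
        ENNReal.ofReal (C * (ε / ρ) ^ γ * r ^ α) := by
  classical
  induction m with
  | zero =>
    refine ⟨0, le_rfl, ?_⟩
    intro ψ _ _ P hchain x₀ _ r _ _ _ ε ρ _ _ _
    have hPe : P = ∅ := by
      rw [Set.eq_empty_iff_forall_notMem]
      intro s hs
      have := hchain {s} (by simpa using hs) (by simp)
      simp at this
    have : {y ∈ Metric.ball x₀ r ∩ X | ¬ Marked ψ ε ρ P y} = ∅ := by
      rw [Set.eq_empty_iff_forall_notMem]
      rintro y ⟨_, hy⟩
      exact hy ⟨∅, empty_subset _, by simp, by simp, by simp [hPe]⟩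
    rw [this]; simp
  | succ m ih =>
    obtain ⟨C', hC', ih⟩ := ih
    refine ⟨(G + C') * 2 ^ α * (6 ^ α / a) * (b * 2 ^ α), by positivity, ?_⟩
    intro ψ hgood hcont P hchain x₀ hx₀ r hr hrm hReg ε ρ hε hρ hP
    set A := {y ∈ Metric.ball x₀ r ∩ X | ¬ Marked ψ ε ρ P y}
    have h5 : (1 : ℝ) ≤ 5 ^ m := one_le_pow₀ (by norm_num)
    have h5r : 5 * (5 ^ m * r) = 5 ^ (m + 1) * r := by ring
    have h5r' : r ≤ 5 ^ m * r := by nlinarith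
    have hrad : ∀ y, ∃ t, y ∈ A → 0 < t ∧ t ≤ 2 * r ∧
        (∃ s ∈ P, ∀ z ∈ Metric.ball y t, ψ s z < ρ) ∧
        ∀ s ∈ P, ∃ z ∈ Metric.ball y (2 * t), ρ ≤ ψ s z := by
      intro y
      by_cases hy : y ∈ A
      · obtain ⟨t, ht⟩ := exists_radius_of_not_marked hy.1.1
          (fun s => hcont s y (hReg (Metric.ball_subset_ball (by linarith) hy.1.1))) hP hy.2
        exact ⟨t, fun _ => ht⟩
      · exact ⟨0, fun h => absurd h hy⟩
    choose t ht using hrad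
    obtain ⟨u, huA, hdisj, hcov⟩ := Vitali.exists_disjoint_subfamily_covering_enlargement_closedBall
      A (fun y => y) (fun y => t y / 6) (2 * r / 6) (fun y hy => by linarith [(ht y hy).2.1]) 5
      (by norm_num)
    have hcount : u.Countable := by
      refine hdisj.countable_of_nonempty_interior fun y hy => ?_
      have h0 := (ht y (huA hy)).1
      exact ⟨y, mem_interior_iff_mem_nhds.2 (Metric.closedBall_mem_nhds y (by linarith))⟩
    have hlocal : ∀ y ∈ u, μ (A ∩ Metric.ball y (t y)) ≤
        ENNReal.ofReal ((G + C') * (ε / ρ) ^ γ * (2 * t y) ^ α) := by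
      intro y hy
      obtain ⟨h0, h2r, ⟨s, hs, hsmall⟩, hlarge⟩ := ht y (huA hy)
      have hyX : y ∈ X := (huA hy).1.2
      have hsubm : Metric.ball y (5 ^ m * (2 * t y)) ⊆ Reg := by
        refine Subset.trans (Metric.ball_subset_ball' ?_) hReg
        have : dist y x₀ < r := (huA hy).1.1
        have h3 : 5 ^ m * (2 * t y) ≤ 5 ^ m * (4 * r) :=
          mul_le_mul_of_nonneg_left (by linarith) (by positivity)
        linarith
      have hrm2 : 5 ^ m * (2 * t y) ≤ ρm := by
        have h3 : 5 ^ m * (2 * t y) ≤ 5 ^ m * (4 * r) :=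
          mul_le_mul_of_nonneg_left (by linarith) (by positivity)
        linarith
      have h2t : 2 * t y ≤ 5 ^ m * (2 * t y) := le_mul_of_one_le_left (by linarith) h5
      set P' : Set S := {s' ∈ P | s' ≠ s ∧ (s' ≤ s ∨ s ≤ s')}
      have hA1 := hgood s y hyX (2 * t y) (by linarith) (h2t.trans hrm2)
        ((Metric.ball_subset_ball h2t).trans hsubm) ε ρ hε hρ (hlarge s hs)
      have hA2 := ih ψ hgood hcont P' (fun T hT hTc => by
          have hsT : s ∉ T := fun h => (hT h).2.1 rfl
          have h1 := hchain (insert s T) (by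
            intro z hz
            rcases Finset.mem_insert.1 (Finset.mem_coe.1 hz) with rfl | hz
            · exact hs
            · exact (hT hz).1) (by
            rw [Finset.coe_insert]
            exact hTc.insert fun z hz _ => (hT hz).2.2.symm)
          rw [Finset.card_insert_of_notMem hsT] at h1
          lia) y hyX (2 * t y) (by linarith) hrm2 hsubm ε ρ hε hρ
        (fun s' hs' => hlarge s' hs'.1)
      have hsub : A ∩ Metric.ball y (t y) ⊆ {z ∈ Metric.ball y (2 * t y) ∩ X | ψ s z < ε} ∪
          {z ∈ Metric.ball y (2 * t y) ∩ X | ¬ Marked ψ ε ρ P' z} := by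
        rintro z ⟨hzA, hzy⟩
        have hz2 : z ∈ Metric.ball y (2 * t y) ∩ X :=
          ⟨Metric.ball_subset_ball (by linarith) hzy, hzA.1.2⟩
        by_cases hεz : ψ s z < ε
        · exact Or.inl ⟨hz2, hεz⟩
        · refine Or.inr ⟨hz2, fun hmark => hzA.2 ?_⟩
          obtain ⟨T, hTP, hTc, hTv, hTo⟩ := hmark
          refine ⟨insert s T, ?_, hTc.insert fun w hw _ => (hTP hw).2.2.symm, ?_, ?_⟩
          · rintro w (rfl | hw)
            · exact hs
            · exact (hTP hw).1
          · rintro w (rfl | hw)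
            · exact ⟨not_lt.1 hεz, (hsmall z hzy).le⟩
            · exact hTv w hw
          · intro w hw hwT hcomp
            refine hTo w ⟨hw, fun h => hwT (h ▸ mem_insert _ _), hcomp s (mem_insert _ _)⟩
              (fun h => hwT (mem_insert_of_mem _ h)) fun v hv => hcomp v (mem_insert_of_mem _ hv)
      calc μ (A ∩ Metric.ball y (t y)) ≤ _ := (measure_mono hsub).trans (measure_union_le _ _)
        _ ≤ _ := add_le_add hA1 hA2
        _ = _ := by
          rw [← ENNReal.ofReal_add (by positivity) (by positivity)]; congr 1; ring
    have hvol : ∀ y ∈ u, ENNReal.ofReal ((G + C') * (ε / ρ) ^ γ * (2 * t y) ^ α) ≤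
        ENNReal.ofReal ((G + C') * 2 ^ α * (6 ^ α / a) * (ε / ρ) ^ γ) *
          μ (Metric.closedBall y (t y / 6)) := by
      intro y hy
      obtain ⟨h0, h2r, _⟩ := ht y (huA hy)
      have h1 := (hlow y (huA hy).1.2 (t y / 6) (by linarith) (by linarith)).trans
        (measure_mono Metric.ball_subset_closedBall)
      refine le_trans (le_of_eq ?_) (mul_le_mul_right h1 _)
      rw [← ENNReal.ofReal_mul (by positivity)]
      congr 1
      rw [Real.div_rpow h0.le (by norm_num), Real.mul_rpow (by norm_num) h0.le]
      field_simp
    have hcovA : A ⊆ ⋃ y ∈ u, A ∩ Metric.ball y (t y) := by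
      intro z hz
      obtain ⟨y, hy, hzy⟩ := hcov z hz
      have hy0 := (ht y (huA hy)).1
      have := hzy (Metric.mem_closedBall_self (by linarith [(ht z hz).1]))
      refine mem_iUnion₂.2 ⟨y, hy, hz, ?_⟩
      rw [Metric.mem_closedBall] at this
      rw [Metric.mem_ball]
      linarith
    calc μ A ≤ μ (⋃ y ∈ u, A ∩ Metric.ball y (t y)) := measure_mono hcovA
      _ ≤ ∑' y : u, μ (A ∩ Metric.ball (y : ℝ) (t y)) := measure_biUnion_le _ hcount _
      _ ≤ ∑' y : u, ENNReal.ofReal ((G + C') * 2 ^ α * (6 ^ α / a) * (ε / ρ) ^ γ) *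
          μ (Metric.closedBall (y : ℝ) (t y / 6)) :=
        ENNReal.tsum_le_tsum fun y => (hlocal y y.2).trans (hvol y y.2)
      _ = ENNReal.ofReal ((G + C') * 2 ^ α * (6 ^ α / a) * (ε / ρ) ^ γ) *
          μ (⋃ y ∈ u, Metric.closedBall (y : ℝ) (t y / 6)) := by
        rw [ENNReal.tsum_mul_left,
          measure_biUnion hcount hdisj fun y _ => Metric.isClosed_closedBall.measurableSet]
      _ ≤ ENNReal.ofReal ((G + C') * 2 ^ α * (6 ^ α / a) * (ε / ρ) ^ γ) *
          μ (Metric.ball x₀ (2 * r)) := by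
        gcongr
        refine iUnion₂_subset fun y hy => ?_
        intro z hz
        have h1 : dist y x₀ < r := (huA hy).1.1
        have h2 := (ht y (huA hy)).2.1
        rw [Metric.mem_closedBall] at hz
        rw [Metric.mem_ball]
        linarith [dist_triangle z y x₀]
      _ ≤ ENNReal.ofReal ((G + C') * 2 ^ α * (6 ^ α / a) * (ε / ρ) ^ γ) *
          ENNReal.ofReal (b * (2 * r) ^ α) := by
        gcongr; exact hup x₀ hx₀ _ (by linarith) (by linarith)
      _ = _ := by
        rw [← ENNReal.ofReal_mul (by positivity)]
        congr 1
        rw [Real.mul_rpow (by norm_num) hr.le]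
        ring

/-- Cramer's rule in the form of a Plücker relation. -/
theorem dotProduct_mul_det_eq_sum {m R : Type*} [Fintype m] [DecidableEq m] [CommRing R]
    (A : Matrix m m R) (row c : m → R) :
    (row ⬝ᵥ c) * A.det = ∑ a, (A.mulVec c) a * (A.updateRow a row).det := by
  have h : ∀ a, (A.updateRow a row).det = A.transpose.cramer row a := fun a => by
    rw [Matrix.cramer_transpose_apply]
  simp_rw [h]
  change _ = (A.mulVec c) ⬝ᵥ (A.transpose.cramer row)
  rw [← Matrix.vecMul_transpose, ← Matrix.dotProduct_mulVec, Matrix.mulVec_cramer,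
    Matrix.det_transpose, dotProduct_smul, smul_eq_mul, dotProduct_comm, mul_comm]

/-- Minkowski's theorem for a square system of linear forms. -/
theorem exists_int_abs_mulVec_lt {d : ℕ} (A : Matrix (Fin d) (Fin d) ℝ) (hA : A.det ≠ 0) {r : ℝ}
    (hr : 0 < r) (h : |A.det| < r ^ d) :
    ∃ c : Fin d → ℤ, c ≠ 0 ∧ ∀ i, |A.mulVec (fun k => (c k : ℝ)) i| < r := by
  classical
  set b := Pi.basisFun ℝ (Fin d)
  set s : Set (Fin d → ℝ) := Matrix.toLin' A ⁻¹' Metric.ball 0 r with hs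
  have hfund := ZSpan.isAddFundamentalDomain b volume
  have hvol : volume s = ENNReal.ofReal (|A.det|⁻¹ * (2 * r) ^ d) := by
    rw [hs, Measure.addHaar_preimage_linearMap _ (by rwa [LinearMap.det_toLin']),
      LinearMap.det_toLin', Real.volume_pi_ball _ hr, ← ENNReal.ofReal_mul (abs_nonneg _)]
    simp [abs_inv]
  have hF : volume (ZSpan.fundamentalDomain b) = 1 := by
    rw [ZSpan.volume_fundamentalDomain]
    have : (Matrix.of ⇑b) = (1 : Matrix (Fin d) (Fin d) ℝ) := by
      ext i j; simp [b, Matrix.one_apply, Pi.single_apply, eq_comm]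
    simp [this]
  have hdet : 0 < |A.det| := abs_pos.2 hA
  have hlt : volume (ZSpan.fundamentalDomain b) * 2 ^ (Module.finrank ℝ (Fin d → ℝ)) < volume s := by
    rw [hF, hvol, one_mul, Module.finrank_fin_fun]
    have : (2 : ℝ≥0∞) ^ d = ENNReal.ofReal (2 ^ d) := by
      rw [ENNReal.ofReal_pow (by norm_num)]; simp
    rw [this, ENNReal.ofReal_lt_ofReal_iff (by positivity), mul_pow, inv_mul_eq_div, lt_div_iff₀ hdet]
    exact mul_lt_mul_of_pos_left h (by positivity)
  have : Countable (Submodule.span ℤ (range b)).toAddSubgroup :=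
    inferInstanceAs (Countable (Submodule.span ℤ (range b)))
  obtain ⟨x, hx, hxs⟩ := exists_ne_zero_mem_lattice_of_measure_mul_two_pow_lt_measure
    (L := (Submodule.span ℤ (range b)).toAddSubgroup) hfund (s := s)
    (fun x hx => by simpa [hs, Matrix.mulVec_neg] using hx)
    ((convex_ball (0 : Fin d → ℝ) r).linear_preimage (Matrix.toLin' A)) hlt
  obtain ⟨x, hxm⟩ := x
  have hm := (Module.Basis.mem_span_iff_repr_mem ℤ b x).1 hxm
  choose c hc using hm
  have hxc : (fun k => (c k : ℝ)) = x := by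
    ext k; simpa [b] using hc k
  refine ⟨c, ?_, fun i => ?_⟩
  · rintro rfl
    apply hx
    ext k
    simp [← hxc]
  · have h2 : Matrix.toLin' A x ∈ Metric.ball (0 : Fin d → ℝ) r := hxs
    rw [mem_ball_zero_iff, pi_norm_lt_iff hr] at h2
    rw [hxc]
    simpa using h2 i

theorem exists_large_minor_of_ne_zero {J : Type*} [Finite J] {d : ℕ}
    (A : Matrix J (Fin d) ℝ) (hd : d ≠ 0) (hne : ∃ S : Fin d → J, (A.submatrix S id).det ≠ 0)
    (H : ∀ c : Fin d → ℤ, c ≠ 0 → ∃ j, 1 ≤ |A.mulVec (fun k => (c k : ℝ)) j|) :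
    ∃ S : Fin d → J, ((d : ℝ)⁻¹) ^ d ≤ |(A.submatrix S id).det| := by
  obtain ⟨S₀, hS₀⟩ := hne
  have : Nonempty (Fin d → J) := ⟨S₀⟩
  obtain ⟨S, hS⟩ := Finite.exists_max (fun S : Fin d → J => |(A.submatrix S id).det|)
  refine ⟨S, ?_⟩
  by_contra! hlt
  have hpos : 0 < |(A.submatrix S id).det| := (abs_pos.2 hS₀).trans_le (hS S₀)
  have hd' : (0 : ℝ) < d := by positivity
  obtain ⟨c, hc0, hc⟩ := exists_int_abs_mulVec_lt (A.submatrix S id) (abs_pos.1 hpos)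
    (inv_pos.2 hd') hlt
  obtain ⟨j, hj⟩ := H c hc0
  have hpl := dotProduct_mul_det_eq_sum (A.submatrix S id) (A j) (fun k => (c k : ℝ))
  have hrow : ∀ a, ((A.submatrix S id).updateRow a (A j)) =
      A.submatrix (Function.update S a j) id := by
    intro a; ext i k
    by_cases h : i = a
    · subst h; simp
    · simp [h]
  have : |(A j ⬝ᵥ fun k => (c k : ℝ))| * |(A.submatrix S id).det| <
      1 * |(A.submatrix S id).det| := by
    rw [← abs_mul, hpl]
    have : Nonempty (Fin d) := ⟨⟨0, Nat.pos_of_ne_zero hd⟩⟩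
    calc _ ≤ ∑ a, |(A.submatrix S id).mulVec (fun k => (c k : ℝ)) a *
          ((A.submatrix S id).updateRow a (A j)).det| := Finset.abs_sum_le_sum_abs _ _
      _ < ∑ a : Fin d, (d : ℝ)⁻¹ * |(A.submatrix S id).det| := by
        refine Finset.sum_lt_sum_of_nonempty Finset.univ_nonempty fun a _ => ?_
        rw [abs_mul, hrow]
        refine (mul_le_mul_of_nonneg_left (hS (Function.update S a j)) (abs_nonneg _)).trans_lt ?_
        exact mul_lt_mul_of_pos_right (hc a) hpos
      _ = 1 * |(A.submatrix S id).det| := by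
        rw [Finset.sum_const, Finset.card_univ, Fintype.card_fin, nsmul_eq_mul]; field_simp
  have h2 := lt_of_mul_lt_mul_right this hpos.le
  exact absurd hj (not_le.2 h2)

/-- A family of linear forms without small nonzero integer values has a large minor. -/
theorem exists_large_minor {J : Type*} [Finite J] {d : ℕ} (A : Matrix J (Fin d) ℝ)
    (H : ∀ c : Fin d → ℤ, c ≠ 0 → ∃ j, 1 ≤ |A.mulVec (fun k => (c k : ℝ)) j|) :
    ∃ S : Fin d → J, ((d : ℝ)⁻¹) ^ d ≤ |(A.submatrix S id).det| := by
  rcases eq_or_ne d 0 with rfl | hd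
  · exact ⟨Fin.elim0, by simp⟩
  set Aτ : ℝ → Matrix (J ⊕ Fin d) (Fin d) ℝ := fun τ =>
    Matrix.of (Sum.elim (fun j => A j) (fun i => (τ • (1 : Matrix (Fin d) (Fin d) ℝ)) i)) with hAτ
  have hpos : (0 : ℝ) < ((d : ℝ)⁻¹) ^ d := by positivity
  by_contra! hcon
  have h0 : ∀ S : Fin d → J ⊕ Fin d, |((Aτ 0).submatrix S id).det| < ((d : ℝ)⁻¹) ^ d := by
    intro S
    by_cases hS : ∃ a i, S a = Sum.inr i
    · obtain ⟨a, i, ha⟩ := hS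
      rw [Matrix.det_eq_zero_of_row_eq_zero a (fun k => by simp [hAτ, ha])]
      simpa using hpos
    · push Not at hS
      have : ∀ a, ∃ j, S a = Sum.inl j := fun a => by
        rcases h : S a with j | i
        · exact ⟨j, rfl⟩
        · exact absurd h (hS a i)
      choose S' hS' using this
      have : (Aτ 0).submatrix S id = A.submatrix S' id := by
        ext a k; simp [hAτ, hS']
      rw [this]; exact hcon S'
  have hcont : ∀ S : Fin d → J ⊕ Fin d, Continuous fun τ => |((Aτ τ).submatrix S id).det| := by
    intro S
    refine (Continuous.matrix_det ?_).abs
    refine continuous_matrix fun a k => ?_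
    rcases h : S a with j | i
    · simp [hAτ, h, continuous_const]
    · simpa [hAτ, h] using continuous_mul_const ((1 : Matrix (Fin d) (Fin d) ℝ) i k)
  have hev : ∀ᶠ τ in nhdsWithin (0 : ℝ) (Ioi 0), ∀ S : Fin d → J ⊕ Fin d,
      |((Aτ τ).submatrix S id).det| < ((d : ℝ)⁻¹) ^ d :=
    eventually_all.2 fun S => nhdsWithin_le_nhds
      ((hcont S).continuousAt.eventually_lt_const (h0 S))
  obtain ⟨τ, hτ, hτ0⟩ := (hev.and self_mem_nhdsWithin).exists
  obtain ⟨S, hS⟩ := exists_large_minor_of_ne_zero (Aτ τ) hd ⟨Sum.inr, by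
      have : (Aτ τ).submatrix Sum.inr id = τ • (1 : Matrix (Fin d) (Fin d) ℝ) := by
        ext a k; simp [hAτ]
      rw [this, Matrix.det_smul]
      have : τ ≠ 0 := ne_of_gt hτ0
      simp [this]⟩ (fun c hc => by
        obtain ⟨j, hj⟩ := H c hc
        exact ⟨Sum.inl j, hj⟩)
  exact absurd hS (not_le.2 (hτ S))

/-- The rational vector with the given integer coordinates. -/
def ratCast {J : Type*} (v : J → ℤ) : J → ℚ := fun j => v j

/-- A basis of a rational subspace that generates all its integer points. -/
structure IsIntBasis {J : Type*} {d : ℕ} (W : Submodule ℚ (J → ℚ)) (B : Fin d → J → ℤ) : Prop where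
  linearIndependent : LinearIndependent ℚ fun k => ratCast (B k)
  span_eq : Submodule.span ℚ (range fun k => ratCast (B k)) = W
  exists_int : ∀ v : J → ℤ, ratCast v ∈ W → ∃ c : Fin d → ℤ, v = ∑ k, c k • B k

theorem IsIntBasis.finrank_eq {J : Type*} {d : ℕ} {W : Submodule ℚ (J → ℚ)} {B : Fin d → J → ℤ}
    (h : IsIntBasis W B) : Module.finrank ℚ W = d := by
  rw [← h.span_eq, finrank_span_eq_card h.linearIndependent, Fintype.card_fin]

theorem exists_isIntBasis {J : Type*} [Fintype J] (W : Submodule ℚ (J → ℚ)) :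
    ∃ (d : ℕ) (B : Fin d → J → ℤ), IsIntBasis W B := by
  classical
  let f : (J → ℤ) →ₗ[ℤ] (J → ℚ) := LinearMap.pi fun j =>
    (Algebra.linearMap ℤ ℚ).comp (LinearMap.proj j)
  have hf : ∀ v, f v = ratCast v := fun v => by ext j; simp [f, ratCast]
  have hfinj : Function.Injective f := fun v w hvw => by
    ext j
    have := congrFun hvw j
    simpa [f] using this
  let N : Submodule ℤ (J → ℤ) := (W.restrictScalars ℤ).comap f
  obtain ⟨d, ⟨b⟩⟩ := N.nonempty_basis_of_pid (Pi.basisFun ℤ J)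
  refine ⟨d, fun k => (b k : J → ℤ), ?_, ?_, ?_⟩
  · rw [← LinearIndependent.iff_fractionRing ℤ ℚ]
    have h1 := (b.linearIndependent.map' N.subtype N.ker_subtype).map' f
      (LinearMap.ker_eq_bot.2 hfinj)
    have h2 : (fun k => ratCast (b k : J → ℤ)) = f ∘ N.subtype ∘ b := by
      ext k j
      simp [f, ratCast]
    rw [h2]
    exact h1
  · refine le_antisymm (Submodule.span_le.2 ?_) fun w hw => ?_
    · rintro _ ⟨k, rfl⟩
      have := (b k).2
      change f (b k : J → ℤ) ∈ W at this
      rwa [hf] at this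
    · obtain ⟨q, hq⟩ := IsLocalization.exist_integer_multiples_of_finite (nonZeroDivisors ℤ) w
      choose v hv using hq
      have hq0 : ((q : ℤ) : ℚ) ≠ 0 := by
        exact_mod_cast nonZeroDivisors.coe_ne_zero q
      have hvw : ratCast v = ((q : ℤ) : ℚ) • w := by
        ext j
        simpa [ratCast, Algebra.smul_def] using hv j
      have hvN : v ∈ N := by
        change f v ∈ W
        rw [hf, hvw]
        exact W.smul_mem _ hw
      have hsum : v = ∑ k, b.repr ⟨v, hvN⟩ k • (b k : J → ℤ) := by
        have := congrArg N.subtype (b.sum_repr ⟨v, hvN⟩)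
        rw [map_sum] at this
        exact this.symm
      have : w = ((q : ℤ) : ℚ)⁻¹ • ratCast v := by
        rw [hvw, smul_smul, inv_mul_cancel₀ hq0, one_smul]
      rw [this]
      refine Submodule.smul_mem _ _ ?_
      rw [← hf, hsum, map_sum]
      refine Submodule.sum_mem _ fun k _ => ?_
      rw [map_smul, hf, ← Int.cast_smul_eq_zsmul ℚ]
      exact Submodule.smul_mem _ _ (Submodule.subset_span ⟨k, rfl⟩)
  · intro v hv
    have hvN : v ∈ N := by
      change f v ∈ W
      rwa [hf]
    refine ⟨fun k => b.repr ⟨v, hvN⟩ k, ?_⟩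
    have := congrArg N.subtype (b.sum_repr ⟨v, hvN⟩)
    rw [map_sum] at this
    exact this.symm

/-- The largest absolute value of a maximal minor. -/
noncomputable def maxMinor {J : Type*} {d : ℕ} (A : Matrix J (Fin d) ℝ) : ℝ :=
  ⨆ S : Fin d → J, |(A.submatrix S id).det|

theorem abs_det_le_maxMinor {J : Type*} [Finite J] {d : ℕ} (A : Matrix J (Fin d) ℝ)
    (S : Fin d → J) : |(A.submatrix S id).det| ≤ maxMinor A :=
  le_ciSup (f := fun S : Fin d → J => |(A.submatrix S id).det|) (Set.finite_range _).bddAbove S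

theorem exists_maxMinor_eq {J : Type*} [Finite J] [Nonempty J] {d : ℕ} (A : Matrix J (Fin d) ℝ) :
    ∃ S : Fin d → J, |(A.submatrix S id).det| = maxMinor A :=
  exists_eq_ciSup_of_finite (f := fun S : Fin d → J => |(A.submatrix S id).det|)

/-- The integer matrix with the given columns, acted on by a real matrix. -/
noncomputable def imageMatrix {J : Type*} [Fintype J] {d : ℕ} (h : Matrix J J ℝ)
    (B : Fin d → J → ℤ) : Matrix J (Fin d) ℝ :=
  Matrix.of fun j k => h.mulVec (fun i => (B k i : ℝ)) j

theorem maxMinor_cons_le {J : Type*} [Fintype J] [Nonempty J] {d : ℕ} (h : Matrix J J ℝ)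
    (B : Fin d → J → ℤ) (v : J → ℤ) {t : ℝ}
    (hv : ∀ j, |h.mulVec (fun i => (v i : ℝ)) j| ≤ t) :
    maxMinor (imageMatrix h (Fin.cons v B : Fin (d + 1) → J → ℤ)) ≤
      (d + 1) * t * maxMinor (imageMatrix h B) := by
  obtain ⟨S, hS⟩ := exists_maxMinor_eq (imageMatrix h (Fin.cons v B : Fin (d + 1) → J → ℤ))
  rw [← hS, Matrix.det_succ_column_zero]
  have ht : 0 ≤ t := by
    obtain ⟨j⟩ := ‹Nonempty J›
    exact (abs_nonneg _).trans (hv j)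
  calc _ ≤ ∑ i : Fin (d + 1), t * maxMinor (imageMatrix h B) := by
        refine (Finset.abs_sum_le_sum_abs _ _).trans (Finset.sum_le_sum fun i _ => ?_)
        rw [abs_mul, abs_mul, abs_pow, abs_neg, abs_one, one_pow, one_mul]
        refine mul_le_mul ?_ ?_ (abs_nonneg _) ht
        · simpa [imageMatrix] using hv (S i)
        · exact abs_det_le_maxMinor (imageMatrix h B) (fun k => S (i.succAbove k))
    _ = _ := by
        rw [Finset.sum_const, Finset.card_univ, Fintype.card_fin, nsmul_eq_mul]
        push_cast; ring

/-- Adding an integer vector to a lattice multiplies its covolume by at most the vector's size. -/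
theorem IsIntBasis.maxMinor_sup_le {J : Type*} [Fintype J] [Nonempty J] {d d' : ℕ}
    {W : Submodule ℚ (J → ℚ)} {B : Fin d → J → ℤ} {B' : Fin d' → J → ℤ} (hB : IsIntBasis W B)
    {v : J → ℤ} (hv : ratCast v ∉ W)
    (hB' : IsIntBasis (W ⊔ Submodule.span ℚ {ratCast v}) B') (h : Matrix J J ℝ) {t : ℝ}
    (hvt : ∀ j, |h.mulVec (fun i => (v i : ℝ)) j| ≤ t) :
    d + 1 ≤ Fintype.card J ∧
    maxMinor (imageMatrix h B') ≤ Fintype.card J * t * maxMinor (imageMatrix h B) := by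
  have hcons : (fun k => ratCast ((Fin.cons v B : Fin (d + 1) → J → ℤ) k)) =
      Fin.cons (ratCast v) (fun k => ratCast (B k)) := by
    ext k
    refine Fin.cases ?_ (fun k => ?_) k <;> simp
  have hli : LinearIndependent ℚ
      (fun k => ratCast ((Fin.cons v B : Fin (d + 1) → J → ℤ) k)) := by
    rw [hcons]
    exact linearIndependent_finCons.2 ⟨hB.linearIndependent, by rwa [hB.span_eq]⟩
  have hspan : Submodule.span ℚ (range fun k => ratCast ((Fin.cons v B : Fin (d + 1) → J → ℤ) k)) =
      W ⊔ Submodule.span ℚ {ratCast v} := by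
    rw [hcons, Fin.range_cons, Submodule.span_insert, hB.span_eq, sup_comm]
  have hd : d' = d + 1 := by
    rw [← hB'.finrank_eq, ← hspan, finrank_span_eq_card hli, Fintype.card_fin]
  subst hd
  have hcard : d + 1 ≤ Fintype.card J := by
    have := hli.fintype_card_le_finrank
    simpa using this
  refine ⟨hcard, ?_⟩
  have hmem : ∀ k, ratCast ((Fin.cons v B : Fin (d + 1) → J → ℤ) k) ∈
      W ⊔ Submodule.span ℚ {ratCast v} := fun k => by
    rw [← hspan]; exact Submodule.subset_span ⟨k, rfl⟩
  choose M hM using fun k => hB'.exists_int _ (hmem k)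
  set Mm : Matrix (Fin (d + 1)) (Fin (d + 1)) ℤ := Matrix.of fun l k => M k l with hMm
  have hdet : Mm.det ≠ 0 := by
    intro h0
    obtain ⟨c, hc0, hc⟩ := Matrix.exists_mulVec_eq_zero_iff.2 h0
    apply hc0
    have h1 : ∑ k, ((c k : ℤ) : ℚ) • ratCast ((Fin.cons v B : Fin (d + 1) → J → ℤ) k) = 0 := by
      ext j
      have h2 : ∑ k, c k * (Fin.cons v B : Fin (d + 1) → J → ℤ) k j = 0 := by
        simp_rw [hM, Finset.sum_apply, Pi.smul_apply, smul_eq_mul, Finset.mul_sum]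
        rw [Finset.sum_comm]
        refine Finset.sum_eq_zero fun l _ => ?_
        have := congrFun hc l
        simp only [hMm, Matrix.mulVec, dotProduct, Matrix.of_apply, Pi.zero_apply] at this
        calc _ = (∑ k, M k l * c k) * B' l j := by
              rw [Finset.sum_mul]; exact Finset.sum_congr rfl fun k _ => by ring
          _ = 0 := by rw [this, zero_mul]
      simp only [Finset.sum_apply, Pi.smul_apply, smul_eq_mul, ratCast, Pi.zero_apply]
      exact_mod_cast h2
    ext k
    have := Fintype.linearIndependent_iff.1 hli (fun k => (c k : ℚ)) h1 k
    exact_mod_cast this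
  have himg : imageMatrix h (Fin.cons v B : Fin (d + 1) → J → ℤ) =
      imageMatrix h B' * (Mm.map (fun z : ℤ => (z : ℝ))) := by
    ext j k
    simp only [imageMatrix, Matrix.of_apply, Matrix.mul_apply, Matrix.mulVec, dotProduct,
      Matrix.map_apply, hMm]
    simp_rw [hM, Finset.sum_apply, Pi.smul_apply, smul_eq_mul, Int.cast_sum, Int.cast_mul,
      Finset.mul_sum, Finset.sum_mul]
    rw [Finset.sum_comm]
    exact Finset.sum_congr rfl fun _ _ => Finset.sum_congr rfl fun _ _ => by ring
  have h1 : maxMinor (imageMatrix h B') ≤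
      maxMinor (imageMatrix h (Fin.cons v B : Fin (d + 1) → J → ℤ)) := by
    obtain ⟨S, hS⟩ := exists_maxMinor_eq (imageMatrix h B')
    have h2 := abs_det_le_maxMinor (imageMatrix h (Fin.cons v B : Fin (d + 1) → J → ℤ)) S
    have h3 : (imageMatrix h (Fin.cons v B : Fin (d + 1) → J → ℤ)).submatrix S id =
        (imageMatrix h B').submatrix S id * (Mm.map (fun z : ℤ => (z : ℝ))) := by
      rw [himg]; rfl
    have h4 : (Mm.map (fun z : ℤ => (z : ℝ))).det = ((Mm.det : ℤ) : ℝ) := by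
      have := (Int.castRingHom ℝ).map_det Mm
      simpa using this.symm
    have h5 : (1 : ℝ) ≤ |((Mm.det : ℤ) : ℝ)| := by
      exact_mod_cast Int.one_le_abs hdet
    rw [h3, Matrix.det_mul, abs_mul, h4, hS] at h2
    refine le_trans ?_ h2
    have h6 : 0 ≤ maxMinor (imageMatrix h B') := hS ▸ abs_nonneg _
    nlinarith
  refine h1.trans ((maxMinor_cons_le h B v hvt).trans ?_)
  have ht : 0 ≤ t := by
    obtain ⟨j⟩ := ‹Nonempty J›
    exact (abs_nonneg _).trans (hvt j)
  have h6 : 0 ≤ maxMinor (imageMatrix h B) := by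
    obtain ⟨S, hS⟩ := exists_maxMinor_eq (imageMatrix h B)
    exact hS ▸ abs_nonneg _
  have : (d : ℝ) + 1 ≤ Fintype.card J := by exact_mod_cast hcard
  gcongr

/-- The number of elements of a chosen integer basis of a rational subspace. -/
noncomputable def intRank {J : Type*} [Fintype J] (W : Submodule ℚ (J → ℚ)) : ℕ :=
  (exists_isIntBasis W).choose

/-- A chosen integer basis of a rational subspace. -/
noncomputable def intBasis {J : Type*} [Fintype J] (W : Submodule ℚ (J → ℚ)) :
    Fin (intRank W) → J → ℤ :=
  (exists_isIntBasis W).choose_spec.choose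

theorem isIntBasis_intBasis {J : Type*} [Fintype J] (W : Submodule ℚ (J → ℚ)) :
    IsIntBasis W (intBasis W) :=
  (exists_isIntBasis W).choose_spec.choose_spec

theorem intRank_le {J : Type*} [Fintype J] (W : Submodule ℚ (J → ℚ)) :
    intRank W ≤ Fintype.card J := by
  rw [← (isIntBasis_intBasis W).finrank_eq]
  simpa using Submodule.finrank_le W

/-- The size of the lattice of integer points of a rational subspace under a matrix. -/
noncomputable def covol {J : Type*} [Fintype J] (h : Matrix J J ℝ) (W : Submodule ℚ (J → ℚ)) : ℝ :=
  maxMinor (imageMatrix h (intBasis W))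

theorem covol_bot {J : Type*} [Fintype J] (h : Matrix J J ℝ) :
    covol h (⊥ : Submodule ℚ (J → ℚ)) = 1 := by
  have h0 : intRank (⊥ : Submodule ℚ (J → ℚ)) = 0 := by
    rw [← (isIntBasis_intBasis (⊥ : Submodule ℚ (J → ℚ))).finrank_eq, finrank_bot]
  unfold covol maxMinor
  have hemp : IsEmpty (Fin (intRank (⊥ : Submodule ℚ (J → ℚ)))) := by
    rw [h0]; infer_instance
  simp [Matrix.det_isEmpty]

/-- At a marked point no vector of the given family is mapped to a short vector. -/
theorem Marked.le_of_abs_mulVec_le {J : Type*} [Fintype J] [Nonempty J] {h : ℝ → Matrix J J ℝ}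
    {ε ρ : ℝ} (hε : ε ≤ ρ) (hρ : ρ ≤ 1) {V : Set (J → ℤ)} {y : ℝ}
    (hm : Marked (fun W y => covol (h y) W) ε ρ
      {W : Submodule ℚ (J → ℚ) | ∃ v ∈ V, ratCast v ∈ W} y)
    {v : J → ℤ} (hv : v ∈ V) (hv0 : v ≠ 0) {t : ℝ}
    (hvt : ∀ j, |(h y).mulVec (fun i => (v i : ℝ)) j| ≤ t) :
    ε ≤ Fintype.card J * t := by
  obtain ⟨T, hTP, hT, hTε, hTρ⟩ := hm
  have hr0 : ratCast v ∉ (⊥ : Submodule ℚ (J → ℚ)) := by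
    rw [Submodule.mem_bot]
    intro h0
    apply hv0
    ext j
    have := congrFun h0 j
    simpa [ratCast] using this
  set T' : Set (Submodule ℚ (J → ℚ)) := {W | W ∈ T ∧ ratCast v ∉ W} ∪ {⊥} with hT'
  obtain ⟨W₀, hW₀, hmin⟩ := (wellFounded_gt (α := Submodule ℚ (J → ℚ))).has_min T'
    ⟨⊥, Or.inr rfl⟩
  have hle : ∀ W ∈ T, ratCast v ∉ W → W ≤ W₀ := by
    intro W hW hvW
    rcases hW₀ with hW₀ | hW₀
    · rcases hT.total hW hW₀.1 with h1 | h1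
      · exact h1
      · have h2 := hmin W (Or.inl ⟨hW, hvW⟩)
        by_contra h3
        exact h2 (lt_of_le_not_ge h1 h3)
    · have h2 := hmin W (Or.inl ⟨hW, hvW⟩)
      rw [mem_singleton_iff] at hW₀
      subst hW₀
      by_contra h3
      exact h2 (lt_of_le_not_ge bot_le h3)
  have hvW₀ : ratCast v ∉ W₀ := by
    rcases hW₀ with hW₀ | hW₀
    · exact hW₀.2
    · rw [mem_singleton_iff] at hW₀
      rwa [hW₀]
  have h1 : covol (h y) W₀ ≤ 1 := by
    rcases hW₀ with hW₀ | hW₀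
    · exact (hTε _ hW₀.1).2.trans hρ
    · rw [mem_singleton_iff] at hW₀
      rw [hW₀, covol_bot]
  set W := W₀ ⊔ Submodule.span ℚ {ratCast v} with hW
  have hvW : ratCast v ∈ W :=
    (le_sup_right : Submodule.span ℚ {ratCast v} ≤ W) (Submodule.mem_span_singleton_self _)
  have h2 : ε ≤ covol (h y) W := by
    by_cases hWT : W ∈ T
    · exact (hTε _ hWT).1
    · refine hε.trans (hTρ W ⟨v, hv, hvW⟩ hWT fun W₁ hW₁ => ?_)
      by_cases hv1 : ratCast v ∈ W₁
      · left
        have h3 : W₀ ≤ W₁ := by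
          rcases hW₀ with hW₀ | hW₀
          · rcases hT.total hW₀.1 hW₁ with h4 | h4
            · exact h4
            · exact absurd (h4 hv1) hvW₀
          · rw [mem_singleton_iff] at hW₀
            rw [hW₀]; exact bot_le
        exact sup_le h3 ((Submodule.span_singleton_le_iff_mem _ _).2 hv1)
      · exact Or.inr ((hle W₁ hW₁ hv1).trans le_sup_left)
  have h3 := ((isIntBasis_intBasis W₀).maxMinor_sup_le hvW₀ (isIntBasis_intBasis W) (h y) hvt).2
  have ht : 0 ≤ t := by
    obtain ⟨j⟩ := ‹Nonempty J›
    exact (abs_nonneg _).trans (hvt j)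
  calc ε ≤ covol (h y) W := h2
    _ ≤ Fintype.card J * t * covol (h y) W₀ := h3
    _ ≤ Fintype.card J * t * 1 := by gcongr
    _ = _ := mul_one _

theorem card_chain_submodule_le {J : Type*} [Fintype J] (T : Finset (Submodule ℚ (J → ℚ)))
    (hT : IsChain (· ≤ ·) (T : Set (Submodule ℚ (J → ℚ)))) : T.card ≤ Fintype.card J + 1 := by
  have h1 : Set.InjOn (fun W : Submodule ℚ (J → ℚ) => Module.finrank ℚ W) T := by
    intro W hW W' hW' h
    rcases hT.total hW hW' with h1 | h1
    · exact Submodule.eq_of_le_of_finrank_eq h1 h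
    · exact (Submodule.eq_of_le_of_finrank_eq h1 h.symm).symm
  have h2 := Finset.card_le_card_of_injOn (t := Finset.range (Fintype.card J + 1))
    (fun W : Submodule ℚ (J → ℚ) => Module.finrank ℚ W) (fun W _ => by
      simp only [Finset.coe_range, mem_Iio]
      have := Submodule.finrank_le W
      rw [Module.finrank_fintype_fun_eq_card] at this
      omega) h1
  simpa using h2

/-- Minors of a product, as combinations of products of entries of the left factor. -/
theorem det_submatrix_imageMatrix {J : Type*} [Fintype J] {d : ℕ} (D : J → ℝ)
    (u : Matrix J J ℝ) (B : Fin d → J → ℤ) (S : Fin d → J) [DecidableEq J] :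
    ((imageMatrix (Matrix.diagonal D * u) B).submatrix S id).det =
      (∏ a, D (S a)) * ∑ σ : Fin d → J,
        (Matrix.of fun a k => (B k (σ a) : ℝ)).det * ∏ a, u (S a) (σ a) := by
  have h1 : (imageMatrix (Matrix.diagonal D * u) B).submatrix S id =
      Matrix.of fun a k => D (S a) * (imageMatrix u B).submatrix S id a k := by
    ext a k
    simp only [imageMatrix, Matrix.submatrix_apply, Matrix.of_apply, id, Matrix.mulVec, dotProduct,
      Matrix.diagonal_mul, Finset.mul_sum, mul_assoc]
  rw [h1, Matrix.det_mul_column]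
  congr 1
  have h2 : (imageMatrix u B).submatrix S id =
      Matrix.of fun a => ∑ i : J, u (S a) i • fun k => (B k i : ℝ) := by
    ext a k
    simp [imageMatrix, Matrix.mulVec, dotProduct]
  rw [h2]
  have h3 := MultilinearMap.map_sum (Matrix.detRowAlternating (R := ℝ) (n := Fin d)).toMultilinearMap
    (fun a i => u (S a) i • fun k => (B k i : ℝ))
  refine h3.trans (Finset.sum_congr rfl fun σ _ => ?_)
  rw [MultilinearMap.map_smul_univ, smul_eq_mul, mul_comm]
  rfl

theorem continuousAt_covol {J : Type*} [Fintype J] [Nonempty J] {h : ℝ → Matrix J J ℝ} {y : ℝ}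
    (hh : ∀ i j, ContinuousAt (fun y => h y i j) y) (W : Submodule ℚ (J → ℚ)) :
    ContinuousAt (fun y => covol (h y) W) y := by
  classical
  have h1 : ∀ y, covol (h y) W = Finset.univ.sup' Finset.univ_nonempty
      (fun S : Fin (intRank W) → J => |((imageMatrix (h y) (intBasis W)).submatrix S id).det|) :=
    fun y => (Finset.sup'_univ_eq_ciSup _).symm
  simp_rw [h1]
  refine ContinuousAt.finset_sup'_apply _ fun S _ => ContinuousAt.abs ?_
  have hdet : Continuous fun M : Matrix (Fin (intRank W)) (Fin (intRank W)) ℝ => M.det :=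
    continuous_id.matrix_det
  refine hdet.continuousAt.comp (f := fun y => (imageMatrix (h y) (intBasis W)).submatrix S id) ?_
  refine continuousAt_pi.2 fun a => continuousAt_pi.2 fun k => ?_
  simp only [imageMatrix, Matrix.submatrix_apply, Matrix.of_apply, Matrix.mulVec, dotProduct]
  exact tendsto_finsetSum _ fun i _ => (hh _ _).mul continuousAt_const

theorem exists_uniformlyGood_covol {J : Type*} [Fintype J] [Nonempty J] [DecidableEq J]
    (u : ℝ → Matrix J J ℝ) (x₀ : ℝ)
    (hu : ∀ i j, AnalyticAt ℝ (fun y => u y i j) x₀) {μ : Measure ℝ} {X : Set ℝ} {α b ρm : ℝ}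
    (hα : 0 < α) (hb : 0 ≤ b) (hup : ∀ x ∈ X, ∀ ρ, 0 < ρ → ρ ≤ ρm →
      μ (Metric.ball x ρ) ≤ ENNReal.ofReal (b * ρ ^ α)) :
    ∃ R > 0, ∃ G γ : ℝ, 0 ≤ G ∧ 0 < γ ∧ ∀ D : J → ℝ,
      UniformlyGood μ X (Metric.ball x₀ R) α ρm G γ
        (fun W y => covol (Matrix.diagonal D * u y) W) := by
  let κ := Σ d : Fin (Fintype.card J + 1), (Fin d → J) × (Fin d → J)
  obtain ⟨R, hR, G, γ, hG, hγ, hgood⟩ := exists_uniform_good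
    (fun (k : κ) y => ∏ a, u y (k.2.1 a) (k.2.2 a)) x₀
    (fun k => Finset.analyticAt_fun_prod _ fun a _ => hu _ _) hα hb hup
  refine ⟨R, hR, G, γ, hG, hγ, fun D W x hx r hr hrm hball ε τ hε hτ => ?_⟩
  rintro ⟨z, hz, hτz⟩
  obtain ⟨S, hS⟩ := exists_maxMinor_eq (imageMatrix (Matrix.diagonal D * u z) (intBasis W))
  let d₀ : Fin (Fintype.card J + 1) := ⟨intRank W, Nat.lt_succ_of_le (intRank_le W)⟩
  let c : κ → ℝ := fun k => if h : k.1 = d₀ then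
    (if (fun a => k.2.1 (Fin.cast (by rw [h]) a)) = S then
      (∏ a, D (S a)) * (Matrix.of fun a l =>
        (intBasis W l (k.2.2 (Fin.cast (by rw [h]) a)) : ℝ)).det else 0) else 0
  have hc : ∀ y, ∑ k, c k * ∏ a, u y (k.2.1 a) (k.2.2 a) =
      ((imageMatrix (Matrix.diagonal D * u y) (intBasis W)).submatrix S id).det := by
    intro y
    rw [det_submatrix_imageMatrix, Fintype.sum_sigma, Finset.sum_eq_single d₀, Fintype.sum_prod_type,
      Finset.sum_eq_single S, Finset.mul_sum]
    · refine Finset.sum_congr rfl fun σ _ => ?_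
      simp only [c, dif_pos]
      rw [if_pos (by rfl)]
      exact mul_assoc _ _ _
    · intro S' _ hS'
      refine Finset.sum_eq_zero fun σ _ => ?_
      simp only [c, dif_pos]
      rw [if_neg, zero_mul]
      exact hS'
    · simp
    · intro d _ hd
      refine Finset.sum_eq_zero fun σ _ => ?_
      simp only [c]
      rw [dif_neg hd, zero_mul]
    · simp
  have := hgood c x hx r hr hrm hball ε τ hε hτ ⟨z, hz, by
    rw [hc z, hS]; exact hτz⟩
  refine (measure_mono ?_).trans this
  rintro y ⟨hy, hlt⟩
  refine ⟨hy, ?_⟩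
  rw [hc y]
  exact (abs_det_le_maxMinor _ S).trans_lt hlt

/-- A Landau type inequality: a bound for the derivative in terms of the function and its second
derivative. -/
theorem abs_deriv_le_of_abs_le {f f₁ f₂ : ℝ → ℝ} {y r M₀ M₂ : ℝ} (hr : 0 < r)
    (h₁ : ∀ x ∈ Metric.ball y r, HasDerivAt f (f₁ x) x)
    (h₂ : ∀ x ∈ Metric.ball y r, HasDerivAt f₁ (f₂ x) x)
    (hM₀ : ∀ x ∈ Metric.ball y r, |f x| ≤ M₀) (hM₂ : ∀ x ∈ Metric.ball y r, |f₂ x| ≤ M₂)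
    {x : ℝ} (hx : x ∈ Metric.ball y r) : |f₁ x| ≤ 4 * M₀ / r + 2 * r * M₂ := by
  have hy : y ∈ Metric.ball y r := Metric.mem_ball_self hr
  have hz : y + r / 2 ∈ Metric.ball y r := by
    rw [Metric.mem_ball, Real.dist_eq, add_sub_cancel_left, abs_of_pos (by positivity)]
    linarith
  have hsub : Icc y (y + r / 2) ⊆ Metric.ball y r := by
    intro u hu
    rw [Metric.mem_ball, Real.dist_eq, abs_of_nonneg (by linarith [hu.1])]
    linarith [hu.2]
  obtain ⟨ξ, hξ, hξe⟩ := exists_hasDerivAt_eq_slope f f₁ (by linarith : y < y + r / 2)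
    (fun u hu => (h₁ u (hsub hu)).continuousAt.continuousWithinAt)
    (fun u hu => h₁ u (hsub (Ioo_subset_Icc_self hu)))
  have hξb : ξ ∈ Metric.ball y r := hsub (Ioo_subset_Icc_self hξ)
  have h3 : |f₁ ξ| ≤ 4 * M₀ / r := by
    rw [hξe, abs_div, add_sub_cancel_left, abs_of_pos (by positivity : (0 : ℝ) < r / 2),
      div_le_div_iff₀ (by positivity) hr]
    have : |f (y + r / 2) - f y| ≤ 2 * M₀ := by
      linarith [abs_sub (f (y + r / 2)) (f y), hM₀ _ hz, hM₀ _ hy]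
    nlinarith
  have h4 : |f₁ x - f₁ ξ| ≤ M₂ * |x - ξ| := by
    have := (convex_ball y r).norm_image_sub_le_of_norm_hasDerivWithin_le (f := f₁) (f' := f₂)
      (C := M₂) (fun u hu => (h₂ u hu).hasDerivWithinAt) (fun u hu => by
        rw [Real.norm_eq_abs]; exact hM₂ u hu) hξb hx
    simpa [Real.norm_eq_abs] using this
  have h5 : |x - ξ| ≤ 2 * r := by
    rw [Metric.mem_ball, Real.dist_eq] at hx hξb
    have := abs_sub_le x y ξ
    rw [abs_sub_comm y ξ] at this
    linarith
  have h6 : 0 ≤ M₂ := (abs_nonneg _).trans (hM₂ y hy)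
  have h7 : |f₁ x| ≤ |f₁ ξ| + |f₁ x - f₁ ξ| := by
    have := abs_sub_abs_le_abs_sub (f₁ x) (f₁ ξ); linarith
  have h8 := mul_le_mul_of_nonneg_left h5 h6
  linarith

/-- A curve near a point at which the coordinate of largest weight has nonvanishing derivative. -/
structure WeightedCurve (ι : Type*) [Fintype ι] where
  /-- coordinates -/
  val : ι → ℝ → ℝ
  /-- first derivatives -/
  vel : ι → ℝ → ℝ
  /-- second derivatives -/
  acc : ι → ℝ → ℝ
  /-- weights -/
  wt : ι → ℝ
  /-- index of the largest weight -/
  top : ι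
  /-- base point -/
  center : ℝ
  /-- radius of the region on which the estimates hold -/
  rad : ℝ
  /-- upper bound for the derivatives -/
  K : ℝ
  /-- lower bound for the top derivative -/
  κ : ℝ
  wt_pos : ∀ i, 0 < wt i
  wt_sum : ∑ i, wt i = 1
  wt_le_top : ∀ i, wt i ≤ wt top
  one_le_K : 1 ≤ K
  κ_pos : 0 < κ
  κ_le_one : κ ≤ 1
  hasDerivAt_val : ∀ i, ∀ x ∈ Metric.ball center rad, HasDerivAt (val i) (vel i x) x
  hasDerivAt_vel : ∀ i, ∀ x ∈ Metric.ball center rad, HasDerivAt (vel i) (acc i x) x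
  abs_vel_le : ∀ i, ∀ x ∈ Metric.ball center rad, |vel i x| ≤ K
  abs_acc_le : ∀ i, ∀ x ∈ Metric.ball center rad, |acc i x| ≤ K
  κ_le_vel : ∀ x ∈ Metric.ball center rad, κ ≤ |vel top x|

namespace WeightedCurve

variable {ι : Type*} [Fintype ι] (c : WeightedCurve ι)

/-- The affine function of the curve with coefficient vector `b`. -/
noncomputable def F₀ (b : Option ι → ℝ) (x : ℝ) : ℝ := b none + ∑ i, c.val i x * b (some i)

/-- The derivative of `F₀`. -/
noncomputable def F₁ (b : Option ι → ℝ) (x : ℝ) : ℝ := ∑ i, c.vel i x * b (some i)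

/-- The second derivative of `F₀`. -/
noncomputable def F₂ (b : Option ι → ℝ) (x : ℝ) : ℝ := ∑ i, c.acc i x * b (some i)

theorem hasDerivAt_F₀ (b : Option ι → ℝ) {x : ℝ} (hx : x ∈ Metric.ball c.center c.rad) :
    HasDerivAt (c.F₀ b) (c.F₁ b x) x := by
  have := (HasDerivAt.fun_sum (u := Finset.univ) fun i _ =>
    (c.hasDerivAt_val i x hx).mul_const (b (some i))).const_add (b none)
  exact this

theorem hasDerivAt_F₁ (b : Option ι → ℝ) {x : ℝ} (hx : x ∈ Metric.ball c.center c.rad) :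
    HasDerivAt (c.F₁ b) (c.F₂ b x) x :=
  HasDerivAt.fun_sum (u := Finset.univ) fun i _ =>
    (c.hasDerivAt_vel i x hx).mul_const (b (some i))

theorem K_nonneg : 0 ≤ c.K := zero_le_one.trans c.one_le_K

theorem abs_F₁_le {b : Option ι → ℝ} {M : ℝ} (hb : ∀ i, |b (some i)| ≤ M) {x : ℝ}
    (hx : x ∈ Metric.ball c.center c.rad) : |c.F₁ b x| ≤ Fintype.card ι * c.K * M := by
  refine (Finset.abs_sum_le_sum_abs _ _).trans ?_
  calc _ ≤ ∑ _i : ι, c.K * M := Finset.sum_le_sum fun i _ => by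
        rw [abs_mul]
        exact mul_le_mul (c.abs_vel_le i x hx) (hb i) (abs_nonneg _) c.K_nonneg
    _ = _ := by simp [mul_assoc]

theorem abs_F₂_le {b : Option ι → ℝ} {M : ℝ} (hb : ∀ i, |b (some i)| ≤ M) {x : ℝ}
    (hx : x ∈ Metric.ball c.center c.rad) : |c.F₂ b x| ≤ Fintype.card ι * c.K * M := by
  refine (Finset.abs_sum_le_sum_abs _ _).trans ?_
  calc _ ≤ ∑ _i : ι, c.K * M := Finset.sum_le_sum fun i _ => by
        rw [abs_mul]
        exact mul_le_mul (c.abs_acc_le i x hx) (hb i) (abs_nonneg _) c.K_nonneg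
    _ = _ := by simp [mul_assoc]

/-- The top coefficient is controlled by the derivative and the other coefficients. -/
theorem κ_mul_abs_top_le {b : Option ι → ℝ} {M : ℝ} (hb : ∀ i, i ≠ c.top → |b (some i)| ≤ M)
    {x : ℝ} (hx : x ∈ Metric.ball c.center c.rad) (hF : |c.F₁ b x| ≤ M) :
    c.κ * |b (some c.top)| ≤ (1 + Fintype.card ι * c.K) * M := by
  classical
  have hM : 0 ≤ M := (abs_nonneg _).trans hF
  have h1 : c.vel c.top x * b (some c.top) =
      c.F₁ b x - ∑ i ∈ Finset.univ.erase c.top, c.vel i x * b (some i) := by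
    rw [F₁, ← Finset.add_sum_erase _ _ (Finset.mem_univ c.top)]; ring
  have h2 : |∑ i ∈ Finset.univ.erase c.top, c.vel i x * b (some i)| ≤
      Fintype.card ι * c.K * M := by
    refine (Finset.abs_sum_le_sum_abs _ _).trans ?_
    calc _ ≤ ∑ i ∈ Finset.univ.erase c.top, c.K * M := Finset.sum_le_sum fun i hi => by
          rw [abs_mul]
          exact mul_le_mul (c.abs_vel_le i x hx) (hb i (Finset.ne_of_mem_erase hi))
            (abs_nonneg _) c.K_nonneg
      _ ≤ ∑ _i : ι, c.K * M := Finset.sum_le_sum_of_subset_of_nonneg (Finset.erase_subset _ _)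
          fun _ _ _ => mul_nonneg c.K_nonneg hM
      _ = _ := by simp [mul_assoc]
  calc c.κ * |b (some c.top)| ≤ |c.vel c.top x| * |b (some c.top)| :=
        mul_le_mul_of_nonneg_right (c.κ_le_vel x hx) (abs_nonneg _)
    _ = |c.vel c.top x * b (some c.top)| := (abs_mul _ _).symm
    _ ≤ |c.F₁ b x| + |∑ i ∈ Finset.univ.erase c.top, c.vel i x * b (some i)| := by
        rw [h1]; exact abs_sub _ _
    _ ≤ _ := by linarith

theorem wt_le_one (i : ι) : c.wt i ≤ 1 := by
  rw [← c.wt_sum]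
  exact Finset.single_le_sum (fun j _ => (c.wt_pos j).le) (Finset.mem_univ i)

variable [DecidableEq ι]

/-- The matrix whose rows are the curve, its derivative, and the coordinate vectors other than the
top one. -/
noncomputable def frame (x : ℝ) : Matrix (Option ι) (Option ι) ℝ
  | none, none => 1
  | none, some i => c.val i x
  | some i, j => if i = c.top then j.elim 0 (fun i' => c.vel i' x) else if j = some i then 1 else 0

theorem frame_mulVec_none (x : ℝ) (b : Option ι → ℝ) : (c.frame x).mulVec b none = c.F₀ b x := by
  simp [Matrix.mulVec, dotProduct, Fintype.sum_option, frame, F₀]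

theorem frame_mulVec_top (x : ℝ) (b : Option ι → ℝ) :
    (c.frame x).mulVec b (some c.top) = c.F₁ b x := by
  simp [Matrix.mulVec, dotProduct, Fintype.sum_option, frame, F₁]

theorem frame_mulVec_some (x : ℝ) (b : Option ι → ℝ) {i : ι} (hi : i ≠ c.top) :
    (c.frame x).mulVec b (some i) = b (some i) := by
  simp [Matrix.mulVec, dotProduct, frame, hi]

/-- A minor of the image of a family of integer vectors under the frame. -/
noncomputable def minor {d : ℕ} (B : Fin d → Option ι → ℤ) (S : Fin d → Option ι) (x : ℝ) : ℝ :=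
  ((imageMatrix (c.frame x) B).submatrix S id).det

end WeightedCurve

/-- The minors of an integer matrix obtained by varying one row. -/
noncomputable def rowMinors {J : Type*} {d : ℕ} (B : Fin d → J → ℤ) (S : Fin d → J)
    (a : Fin d) (j : J) : ℝ :=
  (Matrix.of fun a' k => (B k (Function.update S a j a') : ℝ)).det

theorem imageMatrix_diagonal_mul {J : Type*} [Fintype J] [DecidableEq J] {d : ℕ} (D : J → ℝ)
    (u : Matrix J J ℝ) (B : Fin d → J → ℤ) (j : J) (k : Fin d) :
    imageMatrix (Matrix.diagonal D * u) B j k = D j * imageMatrix u B j k := by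
  simp only [imageMatrix, Matrix.of_apply, Matrix.mulVec, dotProduct,
      Matrix.diagonal_mul, Finset.mul_sum, mul_assoc]

theorem det_imageMatrix_diagonal_mul {J : Type*} [Fintype J] [DecidableEq J] {d : ℕ} (D : J → ℝ)
    (u : Matrix J J ℝ) (B : Fin d → J → ℤ) (S : Fin d → J) :
    ((imageMatrix (Matrix.diagonal D * u) B).submatrix S id).det =
      (∏ a, D (S a)) * ((imageMatrix u B).submatrix S id).det := by
  rw [← Matrix.det_mul_column]
  congr 1
  ext a k
  exact imageMatrix_diagonal_mul D u B (S a) k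

namespace WeightedCurve

variable {ι : Type*} [Fintype ι] [DecidableEq ι] (c : WeightedCurve ι)

theorem minor_update {d : ℕ} (B : Fin d → Option ι → ℤ) (S : Fin d → Option ι) (a : Fin d)
    (hS : ∀ a', a' ≠ a → ∃ i, i ≠ c.top ∧ S a' = some i) (j : Option ι) (x : ℝ) :
    c.minor B (Function.update S a j) x = (c.frame x).mulVec (rowMinors B S a) j := by
  set N : Matrix (Fin d) (Fin d) ℝ := Matrix.of fun a' k => (B k (S a') : ℝ) with hN
  have h1 : (imageMatrix (c.frame x) B).submatrix (Function.update S a j) id =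
      N.updateRow a (∑ j', c.frame x j j' • fun k => (B k j' : ℝ)) := by
    ext a' k
    by_cases h : a' = a
    · subst h
      simp [imageMatrix, Matrix.mulVec, dotProduct]
    · obtain ⟨i, hi, hSi⟩ := hS a' h
      simp only [Matrix.submatrix_apply, Function.update_of_ne h, id, imageMatrix, Matrix.of_apply,
        Matrix.updateRow_ne h, hSi, hN]
      rw [frame_mulVec_some _ _ _ hi]
  have h2 : ∀ j', (N.updateRow a fun k => (B k j' : ℝ)).det = rowMinors B S a j' := by
    intro j'
    rw [rowMinors]
    congr 1
    ext a' k
    by_cases h : a' = a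
    · subst h; simp
    · simp [h, hN]
  rw [minor, h1, ← Matrix.cramer_transpose_apply, map_sum, Finset.sum_apply, Matrix.mulVec,
    dotProduct]
  refine Finset.sum_congr rfl fun j' _ => ?_
  rw [map_smul, Pi.smul_apply, Matrix.cramer_transpose_apply, h2, smul_eq_mul]

/-- If all nonzero integer minors involve the first and the top row, then so do all minors of the
image under the frame. -/
theorem minor_eq_vel_mul {d : ℕ} (B : Fin d → Option ι → ℤ) (S : Fin d → Option ι)
    (hSi : Function.Injective S) {a a' : Fin d} (ha : S a = none) (ha' : S a' = some c.top)
    (H : ∀ σ : Fin d → Option ι, (Matrix.of fun a k => (B k (σ a) : ℝ)).det ≠ 0 →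
      (∃ a, σ a = none) ∧ ∃ a, σ a = some c.top) (x : ℝ) :
    c.minor B S x = c.vel c.top x * (Matrix.of fun a k => (B k (S a) : ℝ)).det := by
  have h := det_submatrix_imageMatrix (fun _ => (1 : ℝ)) (c.frame x) B S
  rw [det_imageMatrix_diagonal_mul] at h
  simp only [Finset.prod_const_one, one_mul] at h
  rw [minor, h, Finset.sum_eq_single S]
  · rw [mul_comm]
    congr 1
    rw [← Finset.mul_prod_erase _ _ (Finset.mem_univ a'), Finset.prod_eq_one, mul_one, ha']
    · simp [frame]
    · intro a'' ha''
      rcases hs : S a'' with _ | i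
      · simp [frame]
      · have : i ≠ c.top := by
          rintro rfl
          exact Finset.ne_of_mem_erase ha'' (hSi (hs.trans ha'.symm))
        simp [frame, this]
  · intro σ _ hσ
    by_contra hne
    obtain ⟨h1, h2⟩ := mul_ne_zero_iff.1 hne
    obtain ⟨⟨b, hb⟩, b', hb'⟩ := H σ h1
    have h3 : ∀ a'', c.frame x (S a'') (σ a'') ≠ 0 := fun a'' =>
      Finset.prod_ne_zero_iff.1 h2 a'' (Finset.mem_univ _)
    have h4 : ∀ a'', a'' ≠ a → a'' ≠ a' → σ a'' = S a'' := by
      intro a'' h5 h6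
      rcases hs : S a'' with _ | i
      · exact absurd (hSi (hs.trans ha.symm)) h5
      · have h7 : i ≠ c.top := by
          rintro rfl
          exact h6 (hSi (hs.trans ha'.symm))
        have := h3 a''
        simpa [hs, frame, h7] using this
    have h5 : σ a' ≠ none := by
      intro h6
      have := h3 a'
      simp [ha', h6, frame] at this
    have h6 : b = a := by
      by_contra h7
      by_cases h8 : b = a'
      · exact h5 (h8 ▸ hb)
      · exact h7 (hSi (((h4 b h7 h8).symm.trans hb).trans ha.symm))
    have h7 : b' = a' := by
      by_contra h7
      by_cases h8 : b' = a
      · rw [h6] at hb; rw [h8, hb] at hb'; exact absurd hb' (by simp)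
      · exact h7 (hSi (((h4 b' h8 h7).symm.trans hb').trans ha'.symm))
    apply hσ
    ext1 a''
    by_cases h8 : a'' = a
    · rw [h8, ← h6, hb, h6, ha]
    · by_cases h9 : a'' = a'
      · rw [h9, ← h7, hb', h7, ha']
      · exact h4 a'' h8 h9
  · simp

end WeightedCurve

theorem imageMatrix_mulVec {J : Type*} [Fintype J] {d : ℕ} (h : Matrix J J ℝ)
    (B : Fin d → J → ℤ) (c : Fin d → ℤ) :
    (imageMatrix h B).mulVec (fun k => (c k : ℝ)) =
      h.mulVec (fun i => ((∑ k, c k • B k) i : ℤ)) := by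
  ext j
  simp only [imageMatrix, Matrix.mulVec, dotProduct, Matrix.of_apply, Finset.sum_apply,
    Pi.smul_apply, smul_eq_mul, Int.cast_sum, Int.cast_mul, Finset.sum_mul, Finset.mul_sum]
  rw [Finset.sum_comm]
  exact Finset.sum_congr rfl fun _ _ => Finset.sum_congr rfl fun _ _ => by ring

theorem sum_smul_ne_zero {J : Type*} {d : ℕ} {B : Fin d → J → ℤ}
    (hB : LinearIndependent ℚ fun k => ratCast (B k)) {c : Fin d → ℤ} (hc : c ≠ 0) :
    ∑ k, c k • B k ≠ 0 := by
  intro h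
  apply hc
  ext k
  have h1 : ∑ k, ((c k : ℤ) : ℚ) • ratCast (B k) = 0 := by
    ext j
    have := congrFun h j
    simp only [Finset.sum_apply, Pi.smul_apply, smul_eq_mul, ratCast, Pi.zero_apply] at this ⊢
    exact_mod_cast this
  have := Fintype.linearIndependent_iff.1 hB _ h1 k
  exact_mod_cast this

namespace WeightedCurve

variable {ι : Type*} [Fintype ι] (c : WeightedCurve ι)

/-- The exponents of the rows of the frame. -/
def w (j : Option ι) : ℝ := j.elim (-1) c.wt

@[simp] theorem w_none : c.w none = -1 := rfl

@[simp] theorem w_some (i : ι) : c.w (some i) = c.wt i := rfl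

theorem sum_w : ∑ j, c.w j = 0 := by
  simp [Fintype.sum_option, c.wt_sum]

/-- There is no nonzero integer vector of size less than `δ` at time `t`. -/
def NoShort (δ t y : ℝ) : Prop :=
  ∀ v : Option ι → ℤ, v ≠ 0 → ¬ (|c.F₀ (fun j => v j) y| < δ * Real.exp (-t) ∧
    ∀ i, |(v (some i) : ℝ)| < δ * Real.exp (c.wt i * t))

/-- A constant in the lower bound for the minors. -/
noncomputable def minorConst : ℝ :=
  (c.κ / (2 * (1 + Fintype.card ι * c.K)) / (Fintype.card ι + 1)) ^ (Fintype.card ι + 1)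

theorem minorConst_pos : 0 < c.minorConst := by
  have := c.κ_pos
  have := c.K_nonneg
  unfold minorConst
  positivity

variable [DecidableEq ι]

theorem injective_of_minor_ne_zero {d : ℕ} {B : Fin d → Option ι → ℤ} {S : Fin d → Option ι}
    {x : ℝ} (h : c.minor B S x ≠ 0) : Function.Injective S := by
  intro a a' haa
  by_contra hne
  exact h (Matrix.det_zero_of_row_eq hne (by ext k; simp [haa]))

theorem exists_minor_ge {d : ℕ} {B : Fin d → Option ι → ℤ}
    (hB : LinearIndependent ℚ fun k => ratCast (B k)) {δ s y : ℝ} (hδ : 0 < δ) (hδ1 : δ ≤ 1)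
    (hs : 0 ≤ s) (hy : y ∈ Metric.ball c.center c.rad) (hE : c.NoShort δ s y) :
    ∃ S : Fin d → Option ι, Function.Injective S ∧
      c.minorConst * δ ^ (Fintype.card ι + 1) * Real.exp ((∑ a, c.w (S a)) * s) ≤
        |c.minor B S y| := by
  have hκ := c.κ_pos
  have hK := c.K_nonneg
  set n := Fintype.card ι with hn
  set c₀ : ℝ := c.κ / (2 * (1 + n * c.K)) with hc₀
  have hnK : (0 : ℝ) ≤ n * c.K := by positivity
  have hc₀pos : 0 < c₀ := by positivity
  have hc₀1 : c₀ ≤ 1 := by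
    rw [hc₀, div_le_one (by positivity)]; linarith [c.κ_le_one]
  have hc₀δ : 0 < c₀ * δ := by positivity
  have hc₀δ1 : c₀ * δ ≤ 1 := mul_le_one₀ hc₀1 hδ.le hδ1
  obtain ⟨S, hS⟩ := exists_large_minor
    (imageMatrix (Matrix.diagonal (fun j => Real.exp (-(c.w j * s)) / (c₀ * δ)) * c.frame y) B)
    (fun m hm => by
      by_contra! hcon
      set v := ∑ k, m k • B k with hv
      have hv0 : v ≠ 0 := sum_smul_ne_zero hB hm
      have h1 : ∀ j, |(c.frame y).mulVec (fun i => (v i : ℝ)) j| <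
          c₀ * δ * Real.exp (c.w j * s) := by
        intro j
        have h2 := hcon j
        rw [imageMatrix_mulVec, ← Matrix.mulVec_mulVec, Matrix.mulVec_diagonal, abs_mul,
          abs_of_pos (by positivity), Real.exp_neg, inv_eq_one_div, div_div, one_div_mul_eq_div,
          div_lt_one (by positivity)] at h2
        linarith
      refine hE v hv0 ⟨?_, fun i => ?_⟩
      · have h2 := h1 none
        rw [frame_mulVec_none, w_none, neg_one_mul] at h2
        refine h2.trans_le ?_
        have := mul_le_mul_of_nonneg_right hc₀1 hδ.le
        gcongr
        linarith
      · have hi : ∀ i, i ≠ c.top → |(v (some i) : ℝ)| < c₀ * δ * Real.exp (c.wt i * s) := by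
          intro i hi
          have h2 := h1 (some i)
          rwa [frame_mulVec_some _ _ _ hi] at h2
        by_cases hit : i = c.top
        · subst hit
          have h2 := h1 (some c.top)
          rw [frame_mulVec_top, w_some] at h2
          have h3 := c.κ_mul_abs_top_le (b := fun j => (v j : ℝ)) (fun i hi' => (hi i hi').le.trans
            (mul_le_mul_of_nonneg_left (Real.exp_le_exp.2
              (mul_le_mul_of_nonneg_right (c.wt_le_top i) hs)) hc₀δ.le)) hy h2.le
          have h4 : (1 + n * c.K) * (c₀ * δ * Real.exp (c.wt c.top * s)) =
              c.κ * (δ * Real.exp (c.wt c.top * s) / 2) := by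
            rw [hc₀]; field_simp
          rw [h4] at h3
          have h5 := le_of_mul_le_mul_left h3 hκ
          have : 0 < δ * Real.exp (c.wt c.top * s) := by positivity
          linarith
        · refine (hi i hit).trans_le ?_
          have := mul_le_mul_of_nonneg_right hc₀1 hδ.le
          gcongr
          linarith)
  rw [det_imageMatrix_diagonal_mul, abs_mul, Finset.prod_div_distrib, Finset.prod_const,
    Finset.card_univ, Fintype.card_fin, ← Real.exp_sum, abs_of_pos (by positivity),
    Finset.sum_neg_distrib, ← Finset.sum_mul, Real.exp_neg] at hS
  change _ ≤ _ * |c.minor B S y| at hS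
  have hdpos : 0 < ((d : ℝ)⁻¹) ^ d := by
    rcases Nat.eq_zero_or_pos d with rfl | h
    · simp
    · positivity
  have hne : c.minor B S y ≠ 0 := by
    intro h0
    rw [h0, abs_zero, mul_zero] at hS
    linarith
  have hinj := c.injective_of_minor_ne_zero hne
  refine ⟨S, hinj, ?_⟩
  have hd : d ≤ n + 1 := by
    have := Fintype.card_le_of_injective S hinj
    simpa using this
  have h3 : c.minorConst * δ ^ (n + 1) ≤ ((d : ℝ)⁻¹) ^ d * (c₀ * δ) ^ d := by
    rcases Nat.eq_zero_or_pos d with rfl | h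
    · rw [pow_zero, pow_zero, mul_one, minorConst, ← mul_pow]
      refine pow_le_one₀ (by positivity) ?_
      rw [← hn, ← hc₀, div_mul_eq_mul_div, div_le_one (by positivity)]
      have : (0 : ℝ) ≤ n := Nat.cast_nonneg n
      linarith
    · have hd0 : (0 : ℝ) < d := by positivity
      have hdn : (d : ℝ) ≤ n + 1 := by exact_mod_cast hd
      rw [minorConst, ← mul_pow, ← mul_pow, ← hn, ← hc₀]
      calc (c₀ / (n + 1) * δ) ^ (n + 1) ≤ (c₀ / (n + 1) * δ) ^ d := by
            refine pow_le_pow_of_le_one (by positivity) ?_ hd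
            rw [div_mul_eq_mul_div, div_le_one (by positivity)]
            have : (0 : ℝ) ≤ n := Nat.cast_nonneg n
            linarith
        _ ≤ _ := by
            refine pow_le_pow_left₀ (by positivity) ?_ d
            rw [div_mul_eq_mul_div, inv_mul_eq_div]
            gcongr
  have h4 : ((d : ℝ)⁻¹) ^ d * (c₀ * δ) ^ d * Real.exp ((∑ a, c.w (S a)) * s) ≤
      |c.minor B S y| := by
    have h5 : (Real.exp ((∑ a, c.w (S a)) * s))⁻¹ / (c₀ * δ) ^ d * |c.minor B S y| =
        |c.minor B S y| / ((c₀ * δ) ^ d * Real.exp ((∑ a, c.w (S a)) * s)) := by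
      field_simp
    rw [h5, le_div_iff₀ (by positivity)] at hS
    linarith
  exact (mul_le_mul_of_nonneg_right h3 (Real.exp_pos _).le).trans h4

end WeightedCurve

theorem sum_comp_update {J : Type*} {d : ℕ} (w : J → ℝ) (S : Fin d → J) (a : Fin d) (j : J) :
    ∑ a', w (Function.update S a j a') = ∑ a', w (S a') - w (S a) + w j := by
  rw [← Finset.add_sum_erase _ _ (Finset.mem_univ a),
    ← Finset.add_sum_erase (a := a) _ (fun a' => w (S a')) (Finset.mem_univ a),
    Function.update_self]
  have : ∑ a' ∈ Finset.univ.erase a, w (Function.update S a j a') =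
      ∑ a' ∈ Finset.univ.erase a, w (S a') :=
    Finset.sum_congr rfl fun a' ha' => by rw [Function.update_of_ne (Finset.ne_of_mem_erase ha')]
  rw [this]; ring

namespace WeightedCurve

variable {ι : Type*} [Fintype ι] [DecidableEq ι] (c : WeightedCurve ι)

theorem abs_minor_le_of_top_mem {d : ℕ} {B : Fin d → Option ι → ℤ} {S : Fin d → Option ι}
    {a : Fin d} (ha : S a = some c.top)
    (hS : ∀ a', a' ≠ a → ∃ i, i ≠ c.top ∧ S a' = some i) {ρ₀ s t q y : ℝ} (hρ₀ : 0 < ρ₀)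
    (hI : Metric.ball y (ρ₀ * Real.exp (-((1 + c.wt c.top) * s))) ⊆ Metric.ball c.center c.rad)
    (hst : s ≤ t) (hL : t - s ≤ s)
    (hU : ∀ z ∈ Metric.ball y (ρ₀ * Real.exp (-((1 + c.wt c.top) * s))), ∀ S' : Fin d → Option ι,
      |c.minor B S' z| ≤ Real.exp ((∑ a, c.w (S' a)) * t + q)) :
    |c.minor B S y| ≤ (4 / ρ₀ + 2 * ρ₀ * (Fintype.card ι * c.K *
      ((1 + Fintype.card ι * c.K) / c.κ))) *
      Real.exp ((∑ a, c.w (S a)) * t + q - (1 + c.wt c.top) * (t - s)) := by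
  set r₁ := c.wt c.top with hr₁
  have hr₁pos : 0 < r₁ := c.wt_pos _
  set r := ρ₀ * Real.exp (-((1 + r₁) * s)) with hr
  have hrpos : 0 < r := by positivity
  have hκ := c.κ_pos
  have hK := c.K_nonneg
  have hs : 0 ≤ s := by linarith
  have ht : 0 ≤ t := by linarith
  set n := Fintype.card ι
  set b := rowMinors B S a with hb
  set wS := ∑ a, c.w (S a) with hwS
  have hy : y ∈ Metric.ball y r := Metric.mem_ball_self hrpos
  have hSt : Function.update S a (some c.top) = S := by rw [← ha, Function.update_eq_self]
  have hF₀ : ∀ z ∈ Metric.ball y r, |c.F₀ b z| ≤ Real.exp ((wS - r₁ - 1) * t + q) := by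
    intro z hz
    have h := hU z hz (Function.update S a none)
    rw [c.minor_update B S a hS, frame_mulVec_none, sum_comp_update, ha, w_none, w_some] at h
    exact h
  have hF₁ : ∀ z ∈ Metric.ball y r, |c.F₁ b z| ≤ Real.exp (wS * t + q) := by
    intro z hz
    have h := hU z hz S
    rw [← hSt, c.minor_update B S a hS, frame_mulVec_top, hSt] at h
    exact h
  have hbi : ∀ i, i ≠ c.top → |b (some i)| ≤ Real.exp (wS * t + q) := by
    intro i hi
    have h := hU y hy (Function.update S a (some i))
    rw [c.minor_update B S a hS, frame_mulVec_some _ _ _ hi, sum_comp_update, ha, w_some,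
      w_some] at h
    refine h.trans (Real.exp_le_exp.2 ?_)
    have := c.wt_le_top i
    nlinarith
  have htop := c.κ_mul_abs_top_le hbi (hI hy) (hF₁ y hy)
  set M := (1 + n * c.K) / c.κ * Real.exp (wS * t + q) with hM
  have hnK : (0 : ℝ) ≤ n * c.K := by positivity
  have hball : ∀ i, |b (some i)| ≤ M := by
    intro i
    by_cases hi : i = c.top
    · subst hi
      rw [hM, div_mul_eq_mul_div, le_div_iff₀ hκ]
      linarith
    · refine (hbi i hi).trans ?_
      refine le_mul_of_one_le_left (Real.exp_pos _).le ?_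
      rw [one_le_div hκ]
      linarith [c.κ_le_one]
  have h := abs_deriv_le_of_abs_le hrpos (fun x hx => c.hasDerivAt_F₀ b (hI hx))
    (fun x hx => c.hasDerivAt_F₁ b (hI hx)) hF₀ (fun x hx => c.abs_F₂_le hball (hI hx)) hy
  have h1 : c.minor B S y = c.F₁ b y := by
    rw [← hSt, c.minor_update B S a hS, frame_mulVec_top]
  rw [h1]
  refine h.trans ?_
  rw [add_mul]
  refine add_le_add (le_of_eq ?_) ?_
  · have e1 : Real.exp ((wS - r₁ - 1) * t + q) =
        Real.exp (wS * t + q - (1 + r₁) * (t - s)) * Real.exp (-((1 + r₁) * s)) := by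
      rw [← Real.exp_add]; congr 1; ring
    rw [e1, hr]
    field_simp
  · have e2 : Real.exp (-((1 + r₁) * s)) ≤ Real.exp (-((1 + r₁) * (t - s))) := by
      apply Real.exp_le_exp.2; nlinarith
    calc 2 * r * (n * c.K * M) = 2 * ρ₀ * (n * c.K * ((1 + n * c.K) / c.κ)) *
          (Real.exp (wS * t + q) * Real.exp (-((1 + r₁) * s))) := by rw [hr, hM]; ring
      _ ≤ 2 * ρ₀ * (n * c.K * ((1 + n * c.K) / c.κ)) *
          (Real.exp (wS * t + q) * Real.exp (-((1 + r₁) * (t - s)))) := by gcongr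
      _ = _ := by rw [← Real.exp_add]; congr 2

theorem abs_F₁_le_of_plain {d : ℕ} {B : Fin d → Option ι → ℤ} {S : Fin d → Option ι}
    (hd : d ≤ Fintype.card ι + 1)
    (hS : ∀ a', ∃ i, i ≠ c.top ∧ S a' = some i) {ρ₀ s t q y δ g : ℝ} (hρ₀ : 0 < ρ₀)
    (hδ : 0 < δ)
    (hI : Metric.ball y (ρ₀ * Real.exp (-((1 + c.wt c.top) * s))) ⊆ Metric.ball c.center c.rad)
    (hst : s ≤ t) (hs : 0 ≤ s)
    (hU : ∀ z ∈ Metric.ball y (ρ₀ * Real.exp (-((1 + c.wt c.top) * s))), ∀ S' : Fin d → Option ι,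
      |c.minor B S' z| ≤ Real.exp ((∑ a, c.w (S' a)) * t + q)) (hg : 0 < g)
    (hlow : g * Real.exp ((∑ a, c.w (S a)) * s) ≤ |c.minor B S y|) (m : Fin d → ℤ)
    (hv : ∀ i, |((∑ k, m k • B k) (some i) : ℝ)| ≤ δ * Real.exp (c.wt i * t))
    {x : ℝ} (hx : x ∈ Metric.ball y (ρ₀ * Real.exp (-((1 + c.wt c.top) * s)))) :
    |c.F₁ (fun j => ((∑ k, m k • B k) j : ℤ)) x| ≤
      δ * (4 * (Fintype.card ι + 1) / (g * ρ₀) * Real.exp (c.wt c.top * t +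
        (∑ a, c.w (S a) - 1 - c.wt c.top) * (t - s) + q) +
      2 * ρ₀ * (Fintype.card ι * c.K) * Real.exp (c.wt c.top * t - (1 + c.wt c.top) * s)) := by
  set r₁ := c.wt c.top with hr₁
  have hr₁pos : 0 < r₁ := c.wt_pos _
  set r := ρ₀ * Real.exp (-((1 + r₁) * s)) with hr
  have hrpos : 0 < r := by positivity
  have hK := c.K_nonneg
  have ht : 0 ≤ t := by linarith
  set n := Fintype.card ι
  set v : Option ι → ℤ := ∑ k, m k • B k with hvdef
  set wS := ∑ a, c.w (S a) with hwS
  have hy : y ∈ Metric.ball y r := Metric.mem_ball_self hrpos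
  have hplain : ∀ z, (imageMatrix (c.frame z) B).submatrix S id =
      Matrix.of fun a k => (B k (S a) : ℝ) := by
    intro z
    ext a k
    obtain ⟨i, hi, hSa⟩ := hS a
    simp only [Matrix.submatrix_apply, imageMatrix, Matrix.of_apply, hSa, id]
    rw [frame_mulVec_some _ _ _ hi]
  have hconst : ∀ z, c.minor B S z = c.minor B S y := fun z => by
    rw [minor, minor, hplain, hplain]
  set M₀ := (n + 1) / g * δ * Real.exp (-t + wS * (t - s) + q) with hM₀
  have hF₀ : ∀ z ∈ Metric.ball y r, |c.F₀ (fun j => (v j : ℝ)) z| ≤ M₀ := by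
    intro z hz
    have hpl := dotProduct_mul_det_eq_sum ((imageMatrix (c.frame z) B).submatrix S id)
      (imageMatrix (c.frame z) B none) (fun k => (m k : ℝ))
    have h1 : (imageMatrix (c.frame z) B none ⬝ᵥ fun k => (m k : ℝ)) =
        c.F₀ (fun j => (v j : ℝ)) z := by
      rw [← frame_mulVec_none]
      exact congrFun (imageMatrix_mulVec (c.frame z) B m) none
    have h2 : ∀ a, ((imageMatrix (c.frame z) B).submatrix S id).updateRow a
        (imageMatrix (c.frame z) B none) =
        (imageMatrix (c.frame z) B).submatrix (Function.update S a none) id := by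
      intro a; ext a' k
      by_cases h : a' = a
      · subst h; simp
      · simp [h]
    have h3 : ∀ a, ((imageMatrix (c.frame z) B).submatrix S id).mulVec (fun k => (m k : ℝ)) a =
        (v (S a) : ℝ) := by
      intro a
      have h4 := congrFun (imageMatrix_mulVec (c.frame z) B m) (S a)
      obtain ⟨i, hi, hSa⟩ := hS a
      rw [hSa, frame_mulVec_some _ _ _ hi, ← hSa] at h4
      exact h4
    rw [h1] at hpl
    have h5 : |c.F₀ (fun j => (v j : ℝ)) z| * |c.minor B S z| ≤
        (n + 1) * (δ * Real.exp ((wS - 1) * t + q)) := by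
      rw [minor, ← abs_mul, hpl]
      refine (Finset.abs_sum_le_sum_abs _ _).trans ?_
      calc _ ≤ ∑ _a : Fin d, δ * Real.exp ((wS - 1) * t + q) := by
            refine Finset.sum_le_sum fun a _ => ?_
            rw [abs_mul, h3, h2]
            obtain ⟨i, hi, hSa⟩ := hS a
            have h6 := hU z hz (Function.update S a none)
            rw [sum_comp_update, hSa, w_none, w_some] at h6
            calc _ ≤ δ * Real.exp (c.wt i * t) * Real.exp ((wS - c.wt i + -1) * t + q) := by
                  rw [hSa]
                  exact mul_le_mul (hv i) h6 (abs_nonneg _) (by positivity)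
              _ = _ := by rw [mul_assoc, ← Real.exp_add]; congr 2; ring
        _ = d * (δ * Real.exp ((wS - 1) * t + q)) := by simp
        _ ≤ _ := by
            have : (d : ℝ) ≤ n + 1 := by exact_mod_cast hd
            gcongr
    rw [hconst z] at h5
    have hgpos : 0 < g * Real.exp (wS * s) := by positivity
    have h6 := (mul_le_mul_of_nonneg_left hlow (abs_nonneg (c.F₀ (fun j => (v j : ℝ)) z))).trans h5
    rw [← le_div_iff₀ hgpos] at h6
    refine h6.trans (le_of_eq ?_)
    have e1 : Real.exp ((wS - 1) * t + q) =
        Real.exp (-t + wS * (t - s) + q) * Real.exp (wS * s) := by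
      rw [← Real.exp_add]; congr 1; ring
    rw [hM₀, e1]
    field_simp
  have hvM : ∀ i, |(v (some i) : ℝ)| ≤ δ * Real.exp (r₁ * t) := fun i =>
    (hv i).trans (mul_le_mul_of_nonneg_left (Real.exp_le_exp.2
      (mul_le_mul_of_nonneg_right (c.wt_le_top i) ht)) hδ.le)
  have h := abs_deriv_le_of_abs_le hrpos (fun x hx => c.hasDerivAt_F₀ (fun j => (v j : ℝ)) (hI hx))
    (fun x hx => c.hasDerivAt_F₁ _ (hI hx)) hF₀ (fun x hx => c.abs_F₂_le hvM (hI hx)) hx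
  refine h.trans (le_of_eq ?_)
  rw [mul_add]
  congr 1
  · have e1 : Real.exp (r₁ * t + (wS - 1 - r₁) * (t - s) + q) * Real.exp (-((1 + r₁) * s)) =
        Real.exp (-t + wS * (t - s) + q) := by
      rw [← Real.exp_add]; congr 1; ring
    rw [hM₀, hr, ← e1]
    field_simp
  · have e1 : Real.exp (r₁ * t - (1 + r₁) * s) =
        Real.exp (r₁ * t) * Real.exp (-((1 + r₁) * s)) := by
      rw [← Real.exp_add]; congr 1
    rw [hr, e1]; ring

end WeightedCurve

theorem abs_det_intCast_ge_one {m : Type*} [Fintype m] [DecidableEq m] {A : Matrix m m ℤ}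
    (h : (Matrix.of fun a k => (A a k : ℝ)).det ≠ 0) :
    1 ≤ |(Matrix.of fun a k => (A a k : ℝ)).det| := by
  have h1 : (Matrix.of fun a k => (A a k : ℝ)).det = ((A.det : ℤ) : ℝ) :=
    ((Int.castRingHom ℝ).map_det A).symm
  rw [h1] at h ⊢
  have h2 : A.det ≠ 0 := by exact_mod_cast h
  exact_mod_cast Int.one_le_abs h2

theorem injective_of_det_ne_zero {J R : Type*} [CommRing R] {d : ℕ} {B : Fin d → J → R}
    {σ : Fin d → J} (h : (Matrix.of fun a k => B k (σ a)).det ≠ 0) : Function.Injective σ := by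
  intro a a' haa
  by_contra hne
  exact h (Matrix.det_zero_of_row_eq hne (by ext k; simp [haa]))

namespace WeightedCurve

variable {ι : Type*} [Fintype ι] [DecidableEq ι] (c : WeightedCurve ι)

theorem sum_w_comp {d : ℕ} {S : Fin d → Option ι} (hS : Function.Injective S) :
    ∑ a, c.w (S a) = -∑ j ∈ (Finset.univ.image S)ᶜ, c.w j := by
  have h1 : ∑ a, c.w (S a) = ∑ j ∈ Finset.univ.image S, c.w j :=
    (Finset.sum_image fun a _ a' _ h => hS h).symm
  rw [h1, eq_neg_iff_add_eq_zero, Finset.sum_add_sum_compl, c.sum_w]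

theorem sum_w_comp_le_one {d : ℕ} {S : Fin d → Option ι} (hS : Function.Injective S)
    (hn : ∀ a, S a ≠ none) : ∑ a, c.w (S a) ≤ 1 := by
  rw [c.sum_w_comp hS, ← Finset.add_sum_erase _ _ (a := none) (by simpa using hn), w_none]
  have : 0 ≤ ∑ j ∈ (Finset.univ.image S)ᶜ.erase none, c.w j := by
    refine Finset.sum_nonneg fun j hj => ?_
    obtain ⟨i, rfl⟩ := Option.ne_none_iff_exists'.1 (Finset.ne_of_mem_erase hj)
    exact (c.wt_pos i).le
  linarith

theorem sum_w_comp_le_neg {d : ℕ} {S : Fin d → Option ι} (hS : Function.Injective S) {a : Fin d}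
    (hn : S a = none) {i : ι} (hi : ∀ a, S a ≠ some i) : ∑ a, c.w (S a) ≤ -c.wt i := by
  rw [c.sum_w_comp hS, neg_le_neg_iff]
  refine Finset.single_le_sum (f := c.w) (a := some i) (fun j hj => ?_) (by simpa using hi)
  rcases j with _ | i'
  · simp only [Finset.mem_compl, Finset.mem_image, Finset.mem_univ, true_and, not_exists] at hj
    exact absurd hn (hj a)
  · exact (c.wt_pos i').le

/-- The diagonal scaling applied to the frame. -/
noncomputable def scale (t l l' : ℝ) (j : Option ι) : ℝ :=
  Real.exp (-(c.w j * t) + (if j = some c.top then l else 0) - l')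

theorem scale_pos (t l l' : ℝ) (j : Option ι) : 0 < c.scale t l l' j := Real.exp_pos _

theorem prod_scale {d : ℕ} (S : Fin d → Option ι) (t l l' : ℝ) :
    ∏ a, c.scale t l l' (S a) = Real.exp (-((∑ a, c.w (S a)) * t) +
      (∑ a, if S a = some c.top then l else 0) - d * l') := by
  unfold scale
  rw [← Real.exp_sum, Finset.sum_sub_distrib, Finset.sum_add_distrib, Finset.sum_neg_distrib,
    Finset.sum_mul]
  simp

theorem abs_minor_le_of_covol_lt {W : Submodule ℚ (Option ι → ℚ)} {t l l' z : ℝ} (hl : 0 ≤ l)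
    (hl' : 0 ≤ l')
    (h : covol (Matrix.diagonal (c.scale t l l') * c.frame z) W < 1)
    (S : Fin (intRank W) → Option ι) :
    |c.minor (intBasis W) S z| ≤
      Real.exp ((∑ a, c.w (S a)) * t + (Fintype.card ι + 1) * l') := by
  have h1 := (abs_det_le_maxMinor _ S).trans_lt h
  rw [det_imageMatrix_diagonal_mul, prod_scale, abs_mul, abs_of_pos (Real.exp_pos _)] at h1
  have h2 : (0 : ℝ) ≤ ∑ a, if S a = some c.top then l else 0 :=
    Finset.sum_nonneg fun a _ => by split_ifs <;> simp [hl]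
  have h3 : (intRank W : ℝ) ≤ Fintype.card ι + 1 := by
    have := intRank_le W
    rw [Fintype.card_option] at this
    exact_mod_cast this
  have h4 : Real.exp (-((∑ a, c.w (S a)) * t + (Fintype.card ι + 1) * l')) *
      |c.minor (intBasis W) S z| ≤ 1 := by
    refine le_trans ?_ h1.le
    refine mul_le_mul_of_nonneg_right (Real.exp_le_exp.2 ?_) (abs_nonneg _)
    have := mul_le_mul_of_nonneg_right h3 hl'
    linarith
  rw [Real.exp_neg, inv_mul_le_iff₀ (Real.exp_pos _), mul_one] at h4
  exact h4

/-- If every integer minor of full rank involves the first and top rows, the covolume is bounded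
below. -/
theorem κ_le_covol {W : Submodule ℚ (Option ι → ℚ)} {t l l' z : ℝ}
    (hz : z ∈ Metric.ball c.center c.rad) {S : Fin (intRank W) → Option ι}
    (hS : (Matrix.of fun a k => (intBasis W k (S a) : ℝ)).det ≠ 0)
    (H : ∀ σ : Fin (intRank W) → Option ι,
      (Matrix.of fun a k => (intBasis W k (σ a) : ℝ)).det ≠ 0 →
      (∃ a, σ a = none) ∧ ∃ a, σ a = some c.top)
    (hD : 1 ≤ ∏ a, c.scale t l l' (S a)) :
    c.κ ≤ covol (Matrix.diagonal (c.scale t l l') * c.frame z) W := by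
  obtain ⟨⟨a, ha⟩, a', ha'⟩ := H S hS
  have hinj : Function.Injective S :=
    injective_of_det_ne_zero (B := fun k j => (intBasis W k j : ℝ)) hS
  have h1 := c.minor_eq_vel_mul (intBasis W) S hinj ha ha' H z
  refine le_trans ?_ (abs_det_le_maxMinor _ S)
  rw [det_imageMatrix_diagonal_mul, abs_mul, abs_of_nonneg (zero_le_one.trans hD)]
  change _ ≤ _ * |c.minor (intBasis W) S z|
  rw [h1, abs_mul]
  have h2 := abs_det_intCast_ge_one (A := Matrix.of fun a k => intBasis W k (S a)) hS
  have h3 := c.κ_le_vel z hz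
  have h4 := c.κ_pos
  have h5 : c.κ * 1 ≤ |c.vel c.top z| *
      |(Matrix.of fun a k => (intBasis W k (S a) : ℝ)).det| :=
    mul_le_mul h3 h2 zero_le_one (abs_nonneg _)
  nlinarith

theorem prod_scale_eq_one {d : ℕ} {S : Fin d → Option ι} (hS : Function.Bijective S) {t l l' : ℝ}
    (hl : l = (Fintype.card ι + 1) * l') : ∏ a, c.scale t l l' (S a) = 1 := by
  have hd : d = Fintype.card ι + 1 := by
    have := Fintype.card_of_bijective hS
    simpa using this
  have h1 : ∑ a, c.w (S a) = ∑ j, c.w j := hS.sum_comp c.w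
  have h2 : (∑ a, if S a = some c.top then l else 0) = ∑ j, if j = some c.top then l else 0 :=
    hS.sum_comp (fun j => if j = some c.top then l else 0)
  rw [prod_scale, h1, h2, c.sum_w, hd]
  simp [hl]

set_option maxHeartbeats 1000000 in
/-- Lower bound for the covolumes in the local situation. -/
theorem exists_le_covol_of_noShort {ρ₀ rmin : ℝ} (hρ₀ : 0 < ρ₀) (hrmin : ∀ i, rmin ≤ c.wt i) :
    ∃ Q : ℝ, 0 < Q ∧ ∀ (δ η s t l' y : ℝ), 0 < δ → δ ≤ 1 → 0 ≤ η → s ≤ t → t - s ≤ s → 0 ≤ l' →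
      (Fintype.card ι + 1) * l' ≤ η * (t - s) →
      Q * Real.exp (-((rmin - 2 * η) * (t - s))) ≤ δ ^ (Fintype.card ι + 1) →
      Metric.ball y (ρ₀ * Real.exp (-((1 + c.wt c.top) * s))) ⊆ Metric.ball c.center c.rad →
      c.NoShort δ s y → ∀ ρ, ρ ≤ c.κ → ∀ v : Option ι → ℤ,
      (∀ i, |(v (some i) : ℝ)| ≤ δ * Real.exp (c.wt i * t)) →
      (∃ x ∈ Metric.ball y (ρ₀ * Real.exp (-((1 + c.wt c.top) * s))),
        δ * Real.exp (c.wt c.top * t - η * (t - s)) ≤ |c.F₁ (fun j => v j) x|) →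
      ∀ W : Submodule ℚ (Option ι → ℚ), ratCast v ∈ W →
      ∃ z ∈ Metric.ball y (ρ₀ * Real.exp (-((1 + c.wt c.top) * s))),
        ρ ≤ covol (Matrix.diagonal (c.scale t ((Fintype.card ι + 1) * l') l') * c.frame z) W := by
  set n := Fintype.card ι with hn
  set c₁ := c.minorConst with hc₁
  have hc₁pos : 0 < c₁ := c.minorConst_pos
  have hκ := c.κ_pos
  have hK := c.K_nonneg
  set C₁ : ℝ := 4 / ρ₀ + 2 * ρ₀ * (n * c.K * ((1 + n * c.K) / c.κ)) with hC₁
  set C₂ : ℝ := 4 * (n + 1) / (c₁ * ρ₀) with hC₂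
  set C₃ : ℝ := 2 * ρ₀ * (n * c.K) with hC₃
  have hC₁pos : 0 ≤ C₁ := by positivity
  have hC₂pos : 0 ≤ C₂ := by positivity
  have hC₃pos : 0 ≤ C₃ := by positivity
  refine ⟨4 * (1 / c₁ + C₁ / c₁ + C₂ + C₃), by positivity, ?_⟩
  intro δ η s t l' y hδ hδ1 hη hst hL hl' hlη hQ hI hE ρ hρκ v hv hx W hvW
  obtain ⟨x, hx, hFx⟩ := hx
  by_contra! hcon
  set r₁ := c.wt c.top with hr₁
  set E := Real.exp (-((rmin - 2 * η) * (t - s))) with hEdef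
  have hEpos : 0 < E := Real.exp_pos _
  have hδn : 0 < δ ^ (n + 1) := by positivity
  have hδn1 : δ ^ (n + 1) ≤ 1 := pow_le_one₀ hδ.le hδ1
  have hL0 : 0 ≤ t - s := by linarith
  have hs : 0 ≤ s := by linarith
  have hy : y ∈ Metric.ball y (ρ₀ * Real.exp (-((1 + r₁) * s))) :=
    Metric.mem_ball_self (by positivity)
  have hr₁min : rmin ≤ r₁ := hrmin _
  have q0 : 0 ≤ 1 / c₁ * E := by positivity
  have p2 : 0 ≤ C₁ / c₁ * E := by positivity
  have p3 : 0 ≤ C₂ * E := by positivity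
  have p4 : 0 ≤ C₃ * E := by positivity
  have hQ' : 4 * (1 / c₁ * E) + 4 * (C₁ / c₁ * E) + 4 * (C₂ * E) + 4 * (C₃ * E) ≤
      δ ^ (n + 1) := le_trans (le_of_eq (by ring)) hQ
  have q1 : 1 / c₁ * E ≤ δ ^ (n + 1) / 4 := by linarith
  have q2 : C₁ / c₁ * E ≤ δ ^ (n + 1) / 4 := by linarith
  have q3 : C₂ * E ≤ δ ^ (n + 1) / 4 := by linarith
  have q4 : C₃ * E ≤ 1 / 4 := by linarith
  have hl0 : 0 ≤ (n + 1) * l' := by positivity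
  have hU : ∀ z ∈ Metric.ball y (ρ₀ * Real.exp (-((1 + r₁) * s))),
      ∀ S : Fin (intRank W) → Option ι,
      |c.minor (intBasis W) S z| ≤ Real.exp ((∑ a, c.w (S a)) * t + (n + 1) * l') :=
    fun z hz S => c.abs_minor_le_of_covol_lt hl0 hl'
      ((hcon z hz).trans_le (hρκ.trans c.κ_le_one)) S
  have hB := isIntBasis_intBasis W
  obtain ⟨S, hSinj, hlow⟩ := c.exists_minor_ge hB.linearIndependent hδ hδ1 hs (hI hy) hE
  set wS := ∑ a, c.w (S a) with hwS
  have hg : 0 < c₁ * δ ^ (n + 1) := by positivity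
  by_cases hnone : ∃ a, S a = none
  · obtain ⟨a, ha⟩ := hnone
    by_cases hsurj : Function.Surjective S
    · have hcard : Fintype.card (Fin (intRank W)) = Fintype.card (Option ι) :=
        Fintype.card_of_bijective ⟨hSinj, hsurj⟩
      have H : ∀ σ : Fin (intRank W) → Option ι,
          (Matrix.of fun a k => (intBasis W k (σ a) : ℝ)).det ≠ 0 →
          (∃ a, σ a = none) ∧ ∃ a, σ a = some c.top := by
        intro σ hσ
        have hinj : Function.Injective σ :=
          injective_of_det_ne_zero (B := fun k j => (intBasis W k j : ℝ)) hσ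
        have hs := ((Fintype.bijective_iff_injective_and_card σ).2 ⟨hinj, hcard⟩).2
        exact ⟨hs _, hs _⟩
      obtain ⟨a', ha'⟩ := hsurj (some c.top)
      have h1 := c.minor_eq_vel_mul (intBasis W) S hSinj ha ha' H y
      have h2 : (Matrix.of fun a k => (intBasis W k (S a) : ℝ)).det ≠ 0 := by
        intro h0
        rw [h1, h0, mul_zero, abs_zero] at hlow
        exact absurd hlow (not_le.2 (by positivity))
      have h3 := c.κ_le_covol (t := t) (l := (n + 1) * l') (l' := l') (hI hy) h2 H
        (c.prod_scale_eq_one ⟨hSinj, hsurj⟩ rfl).ge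
      exact absurd (hcon y hy) (not_lt.2 (hρκ.trans h3))
    · obtain ⟨j, hj⟩ := not_forall.1 hsurj
      push Not at hj
      obtain ⟨i, rfl⟩ : ∃ i, j = some i := by
        rcases j with _ | i
        · exact absurd ha (hj a)
        · exact ⟨i, rfl⟩
      have h1 := c.sum_w_comp_le_neg hSinj ha hj
      have h2 := hlow.trans (hU y hy S)
      have h3 : Real.exp (wS * t + (n + 1) * l') =
          Real.exp (wS * (t - s) + (n + 1) * l') * Real.exp (wS * s) := by
        rw [← Real.exp_add]; congr 1; ring
      rw [h3] at h2
      have h4 := le_of_mul_le_mul_right h2 (Real.exp_pos _)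
      have h5 : Real.exp (wS * (t - s) + (n + 1) * l') ≤ E := by
        refine Real.exp_le_exp.2 ?_
        have h6 := hrmin i
        have h7 : wS * (t - s) ≤ -rmin * (t - s) := mul_le_mul_of_nonneg_right (by linarith) hL0
        have h9 := mul_nonneg hη hL0
        clear_value wS
        linarith
      have h6 : 1 / c₁ * (c₁ * δ ^ (n + 1)) ≤ 1 / c₁ * E :=
        mul_le_mul_of_nonneg_left (h4.trans h5) (by positivity)
      rw [← mul_assoc, one_div_mul_cancel hc₁pos.ne', one_mul] at h6
      linarith
  · push Not at hnone
    have hw1 : wS ≤ 1 := c.sum_w_comp_le_one hSinj hnone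
    have hsome : ∀ a, ∃ i, S a = some i := fun a => Option.ne_none_iff_exists'.1 (hnone a)
    by_cases htop : ∃ a, S a = some c.top
    · obtain ⟨a, ha⟩ := htop
      have hS : ∀ a', a' ≠ a → ∃ i, i ≠ c.top ∧ S a' = some i := by
        intro a' ha'
        obtain ⟨i, hi⟩ := hsome a'
        refine ⟨i, ?_, hi⟩
        rintro rfl
        exact ha' (hSinj (hi.trans ha.symm))
      have h1 := c.abs_minor_le_of_top_mem ha hS hρ₀ hI hst hL hU
      have h2 := hlow.trans h1
      have h3 : Real.exp (wS * t + (n + 1) * l' - (1 + r₁) * (t - s)) =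
          Real.exp (wS * (t - s) + (n + 1) * l' - (1 + r₁) * (t - s)) * Real.exp (wS * s) := by
        rw [← Real.exp_add]; congr 1; ring
      rw [h3, ← mul_assoc] at h2
      have h4 := le_of_mul_le_mul_right h2 (Real.exp_pos _)
      have h5 : Real.exp (wS * (t - s) + (n + 1) * l' - (1 + r₁) * (t - s)) ≤ E := by
        refine Real.exp_le_exp.2 ?_
        have h7 : wS * (t - s) ≤ 1 * (t - s) := mul_le_mul_of_nonneg_right hw1 hL0
        have h8 := mul_le_mul_of_nonneg_right hr₁min hL0
        have h9 := mul_nonneg hη hL0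
        clear_value wS
        linarith
      have h6 : c₁ * δ ^ (n + 1) ≤ C₁ * E :=
        h4.trans (mul_le_mul_of_nonneg_left h5 hC₁pos)
      rw [div_mul_eq_mul_div, div_le_iff₀ hc₁pos] at q2
      linarith
    · push Not at htop
      have hS : ∀ a', ∃ i, i ≠ c.top ∧ S a' = some i := by
        intro a'
        obtain ⟨i, hi⟩ := hsome a'
        refine ⟨i, ?_, hi⟩
        rintro rfl
        exact htop a' hi
      obtain ⟨m, hm⟩ := hB.exists_int v hvW
      have hd : intRank W ≤ n + 1 := by
        have := intRank_le W
        rwa [Fintype.card_option] at this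
      have h1 := c.abs_F₁_le_of_plain hd hS hρ₀ hδ hI hst hs hU hg hlow m
        (fun i => by rw [← hm]; exact hv i) hx
      rw [← hm] at h1
      have h2 := hFx.trans h1
      have h3 := le_of_mul_le_mul_left h2 hδ
      have e1 : Real.exp (r₁ * t + (wS - 1 - r₁) * (t - s) + (n + 1) * l') ≤
          Real.exp (r₁ * t - η * (t - s)) * E := by
        rw [hEdef, ← Real.exp_add]
        refine Real.exp_le_exp.2 ?_
        have h7 : wS * (t - s) ≤ 1 * (t - s) := mul_le_mul_of_nonneg_right hw1 hL0
        have h8 := mul_le_mul_of_nonneg_right hr₁min hL0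
        have h9 := mul_nonneg hη hL0
        clear_value wS
        linarith
      have e2 : Real.exp (r₁ * t - (1 + r₁) * s) ≤ Real.exp (r₁ * t - η * (t - s)) * E := by
        rw [hEdef, ← Real.exp_add]
        refine Real.exp_le_exp.2 ?_
        have h8 := mul_le_mul_of_nonneg_right hr₁min hL0
        have h9 : (1 + r₁) * (t - s) ≤ (1 + r₁) * s :=
          mul_le_mul_of_nonneg_left hL (by linarith [c.wt_pos c.top])
        have h10 := mul_nonneg hη hL0
        linarith
      have h4 : Real.exp (r₁ * t - η * (t - s)) * 1 ≤
          Real.exp (r₁ * t - η * (t - s)) * (C₂ / δ ^ (n + 1) * E + C₃ * E) := by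
        rw [mul_one]
        refine h3.trans ?_
        have e3 : 4 * ((n : ℝ) + 1) / (c₁ * δ ^ (n + 1) * ρ₀) = C₂ / δ ^ (n + 1) := by
          rw [hC₂]; field_simp
        rw [e3]
        calc _ ≤ C₂ / δ ^ (n + 1) * (Real.exp (r₁ * t - η * (t - s)) * E) +
              C₃ * (Real.exp (r₁ * t - η * (t - s)) * E) := by gcongr
          _ = _ := by ring
      have h5 := le_of_mul_le_mul_left h4 (Real.exp_pos _)
      have h6 : C₂ / δ ^ (n + 1) * E ≤ 1 / 4 := by
        rw [div_mul_eq_mul_div, div_le_iff₀ hδn]; linarith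
      linarith

end WeightedCurve

theorem exists_det_ne_zero {J : Type*} [Fintype J] {d : ℕ} {B : Fin d → J → ℤ}
    (hB : LinearIndependent ℚ fun k => ratCast (B k)) :
    ∃ S : Fin d → J, (Matrix.of fun a k => (B k (S a) : ℝ)).det ≠ 0 := by
  obtain ⟨S, hS⟩ := exists_large_minor (Matrix.of fun j k => (B k j : ℝ)) (fun m hm => by
    obtain ⟨j, hj⟩ := Function.ne_iff.1 (sum_smul_ne_zero hB hm)
    refine ⟨j, ?_⟩
    have h1 : (Matrix.of fun j k => (B k j : ℝ)).mulVec (fun k => (m k : ℝ)) j =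
        (((∑ k, m k • B k) j : ℤ) : ℝ) := by
      simp [Matrix.mulVec, dotProduct, mul_comm]
    rw [h1]
    exact_mod_cast Int.one_le_abs hj)
  refine ⟨S, fun h0 => ?_⟩
  have hdpos : 0 < ((d : ℝ)⁻¹) ^ d := by
    rcases Nat.eq_zero_or_pos d with rfl | h
    · simp
    · positivity
  have h1 : (Matrix.of fun j k => (B k j : ℝ)).submatrix S id =
      Matrix.of fun a k => (B k (S a) : ℝ) := rfl
  rw [h1, h0, abs_zero] at hS
  linarith

namespace WeightedCurve

variable {ι : Type*} [Fintype ι] [DecidableEq ι] (c : WeightedCurve ι)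

theorem one_le_prod_scale {d : ℕ} {S : Fin d → Option ι} {rmin t l l' : ℝ} (hl : 0 ≤ l)
    (hl' : 0 ≤ l') (ht : 0 ≤ t) (hlt : (Fintype.card ι + 1) * l' ≤ rmin * t)
    (hd : d ≤ Fintype.card ι + 1) (hw : ∑ a, c.w (S a) ≤ -rmin) :
    1 ≤ ∏ a, c.scale t l l' (S a) := by
  rw [prod_scale]
  refine Real.one_le_exp ?_
  have h2 : (0 : ℝ) ≤ ∑ a, if S a = some c.top then l else 0 :=
    Finset.sum_nonneg fun a _ => by split_ifs <;> simp [hl]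
  have h3 : (d : ℝ) * l' ≤ (Fintype.card ι + 1) * l' :=
    mul_le_mul_of_nonneg_right (by exact_mod_cast hd) hl'
  have h4 := mul_le_mul_of_nonneg_right hw ht
  linarith

/-- Lower bound for the covolumes at the top scale. -/
theorem exists_le_covol_of_top {ρ₀ rmin c₀ t l' ρ : ℝ} (hρ₀ : 0 < ρ₀) (hρ₀r : ρ₀ ≤ c.rad)
    (hrmin : ∀ i, rmin ≤ c.wt i)
    (hc₀ : ∀ b : Option ι → ℝ, (∃ j, 1 ≤ |b j|) →
      ∃ z ∈ Metric.ball c.center ρ₀, c₀ ≤ |c.F₀ b z|) (hc₀pos : 0 < c₀)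
    (ht : 0 ≤ t) (hl' : 0 ≤ l') (hlt : (Fintype.card ι + 1) * l' ≤ rmin * t)
    (hρκ : ρ ≤ c.κ) (hρc : ρ ≤ c₀) {v : Option ι → ℤ} (hv0 : v ≠ 0)
    {W : Submodule ℚ (Option ι → ℚ)} (hvW : ratCast v ∈ W) :
    ∃ z ∈ Metric.ball c.center ρ₀,
      ρ ≤ covol (Matrix.diagonal (c.scale t ((Fintype.card ι + 1) * l') l') * c.frame z) W := by
  have hB := isIntBasis_intBasis W
  have hd : intRank W ≤ Fintype.card ι + 1 := by
    have := intRank_le W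
    rwa [Fintype.card_option] at this
  have hl : 0 ≤ (Fintype.card ι + 1) * l' := by positivity
  by_cases H : ∀ σ : Fin (intRank W) → Option ι,
      (Matrix.of fun a k => (intBasis W k (σ a) : ℝ)).det ≠ 0 →
      (∃ a, σ a = none) ∧ ∃ a, σ a = some c.top
  · obtain ⟨S, hS⟩ := exists_det_ne_zero hB.linearIndependent
    have hinj : Function.Injective S :=
      injective_of_det_ne_zero (B := fun k j => (intBasis W k j : ℝ)) hS
    obtain ⟨⟨a, ha⟩, -⟩ := H S hS
    refine ⟨c.center, Metric.mem_ball_self hρ₀, hρκ.trans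
      (c.κ_le_covol (Metric.mem_ball_self (hρ₀.trans_le hρ₀r)) hS H ?_)⟩
    by_cases hsurj : Function.Surjective S
    · exact (c.prod_scale_eq_one ⟨hinj, hsurj⟩ rfl).ge
    · obtain ⟨j, hj⟩ := not_forall.1 hsurj
      push Not at hj
      obtain ⟨i, rfl⟩ : ∃ i, j = some i := by
        rcases j with _ | i
        · exact absurd ha (hj a)
        · exact ⟨i, rfl⟩
      exact c.one_le_prod_scale hl hl' ht hlt hd
        ((c.sum_w_comp_le_neg hinj ha hj).trans (neg_le_neg (hrmin i)))
  · push Not at H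
    obtain ⟨S, hS, hno⟩ := H
    have hinj : Function.Injective S :=
      injective_of_det_ne_zero (B := fun k j => (intBasis W k j : ℝ)) hS
    have hpos : 0 < intRank W := by
      obtain ⟨m, hm⟩ := hB.exists_int v hvW
      rcases Nat.eq_zero_or_pos (intRank W) with h | h
      · exfalso
        apply hv0
        have : IsEmpty (Fin (intRank W)) := by rw [h]; infer_instance
        rw [hm]; simp
      · exact h
    obtain ⟨a, ha⟩ : ∃ a, ∀ a', a' ≠ a → ∃ i, i ≠ c.top ∧ S a' = some i := by
      by_cases h1 : ∃ a, S a = none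
      · obtain ⟨a, ha⟩ := h1
        refine ⟨a, fun a' ha' => ?_⟩
        rcases hs : S a' with _ | i
        · exact absurd (hinj (hs.trans ha.symm)) ha'
        · refine ⟨i, ?_, rfl⟩
          rintro rfl
          exact hno ⟨a, ha⟩ a' hs
      · push Not at h1
        have hsome : ∀ a, ∃ i, S a = some i := fun a => Option.ne_none_iff_exists'.1 (h1 a)
        by_cases h2 : ∃ a, S a = some c.top
        · obtain ⟨a, ha⟩ := h2
          refine ⟨a, fun a' ha' => ?_⟩
          obtain ⟨i, hi⟩ := hsome a'
          refine ⟨i, ?_, hi⟩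
          rintro rfl
          exact ha' (hinj (hi.trans ha.symm))
        · push Not at h2
          refine ⟨⟨0, hpos⟩, fun a' _ => ?_⟩
          obtain ⟨i, hi⟩ := hsome a'
          refine ⟨i, ?_, hi⟩
          rintro rfl
          exact h2 a' hi
    obtain ⟨z, hz, hFz⟩ := hc₀ (rowMinors (intBasis W) S a) ⟨S a, by
      have h1 : rowMinors (intBasis W) S a (S a) =
          (Matrix.of fun a k => (intBasis W k (S a) : ℝ)).det := by
        rw [rowMinors, Function.update_eq_self]
      rw [h1]
      exact abs_det_intCast_ge_one (A := Matrix.of fun a k => intBasis W k (S a)) hS⟩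
    refine ⟨z, hz, ?_⟩
    refine le_trans ?_ (abs_det_le_maxMinor _ (Function.update S a none))
    rw [det_imageMatrix_diagonal_mul]
    change _ ≤ |_ * c.minor (intBasis W) (Function.update S a none) z|
    rw [c.minor_update _ _ _ ha, frame_mulVec_none, abs_mul]
    have hinj' : Function.Injective (Function.update S a none) := by
      intro b b' hbb
      by_cases hb : b = a <;> by_cases hb' : b' = a
      · rw [hb, hb']
      · obtain ⟨i, -, hi⟩ := ha b' hb'
        rw [hb, Function.update_self, Function.update_of_ne hb', hi] at hbb
        exact absurd hbb (by simp)
      · obtain ⟨i, -, hi⟩ := ha b hb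
        rw [hb', Function.update_self, Function.update_of_ne hb, hi] at hbb
        exact absurd hbb (by simp)
      · rw [Function.update_of_ne hb, Function.update_of_ne hb'] at hbb
        exact hinj hbb
    have h1 := c.sum_w_comp_le_neg hinj' (Function.update_self a none S) (i := c.top) (by
      intro b hb
      by_cases hba : b = a
      · rw [hba, Function.update_self] at hb
        exact absurd hb (by simp)
      · obtain ⟨i, hi, hSi⟩ := ha b hba
        rw [Function.update_of_ne hba, hSi] at hb
        exact hi (Option.some.inj hb))
    have h2 := c.one_le_prod_scale hl hl' ht hlt hd (h1.trans (neg_le_neg (hrmin c.top)))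
    rw [abs_of_nonneg (zero_le_one.trans h2)]
    have : 0 ≤ |c.F₀ (rowMinors (intBasis W) S a) z| := abs_nonneg _
    nlinarith

end WeightedCurve

theorem card_mul_le_of_balls_subset {μ : Measure ℝ} {X : Set ℝ} (hX0 : μ Xᶜ = 0) {q M : ℝ}
    (hM : 0 ≤ M) {τ : ℝ} {s : Finset ℝ}
    (hlow : ∀ x ∈ s, ENNReal.ofReal q ≤ μ (Metric.ball x τ))
    (hsep : ∀ x ∈ s, ∀ y ∈ s, x ≠ y → 2 * τ ≤ |x - y|) {Z : Set ℝ}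
    (hZ : ∀ x ∈ s, Metric.ball x τ ∩ X ⊆ Z) (hZM : μ Z ≤ ENNReal.ofReal M) :
    s.card * q ≤ M := by
  have h1 : μ (⋃ x ∈ s, Metric.ball x τ) = ∑ x ∈ s, μ (Metric.ball x τ) := by
    refine measure_biUnion_finset (fun x hx y hy hxy => ?_) fun x _ => measurableSet_ball
    refine Metric.ball_disjoint_ball ?_
    rw [Real.dist_eq]
    linarith [hsep x hx y hy hxy]
  have h2 : μ (⋃ x ∈ s, Metric.ball x τ) ≤ ENNReal.ofReal M := by
    have h3 : (⋃ x ∈ s, Metric.ball x τ) ⊆ Z ∪ Xᶜ := by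
      refine iUnion₂_subset fun x hx y hy => ?_
      by_cases hyX : y ∈ X
      · exact Or.inl (hZ x hx ⟨hy, hyX⟩)
      · exact Or.inr hyX
    refine (measure_mono h3).trans ((measure_union_le _ _).trans ?_)
    rw [hX0, add_zero]
    exact hZM
  rw [h1] at h2
  have h4 : s.card • ENNReal.ofReal q ≤ ENNReal.ofReal M := (Finset.card_nsmul_le_sum _ _ _
    hlow).trans h2
  rw [nsmul_eq_mul, ← ENNReal.ofReal_natCast, ← ENNReal.ofReal_mul (by positivity)] at h4
  exact (ENNReal.ofReal_le_ofReal_iff hM).1 h4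

namespace WeightedCurve

variable {ι : Type*} [Fintype ι] (c : WeightedCurve ι)

theorem abs_F₀_sub_le {b : Option ι → ℝ} {M : ℝ} (hb : ∀ i, |b (some i)| ≤ M) {x y : ℝ}
    (hx : x ∈ Metric.ball c.center c.rad) (hy : y ∈ Metric.ball c.center c.rad) :
    |c.F₀ b y - c.F₀ b x| ≤ Fintype.card ι * c.K * M * |y - x| :=
  (convex_ball c.center c.rad).norm_image_sub_le_of_norm_hasDerivWithin_le
    (fun _ h => (c.hasDerivAt_F₀ b h).hasDerivWithinAt) (fun _ h => c.abs_F₁_le hb h) hx hy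

theorem abs_F₁_sub_le {b : Option ι → ℝ} {M : ℝ} (hb : ∀ i, |b (some i)| ≤ M) {x y : ℝ}
    (hx : x ∈ Metric.ball c.center c.rad) (hy : y ∈ Metric.ball c.center c.rad) :
    |c.F₁ b y - c.F₁ b x| ≤ Fintype.card ι * c.K * M * |y - x| :=
  (convex_ball c.center c.rad).norm_image_sub_le_of_norm_hasDerivWithin_le
    (fun _ h => (c.hasDerivAt_F₁ b h).hasDerivWithinAt) (fun _ h => c.abs_F₂_le hb h) hx hy

variable [DecidableEq ι]

/-- A vector that is short at one point is mapped to a short vector at all nearby points. -/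
theorem abs_scaled_frame_mulVec_le {t l l' δ ρ₀ z w : ℝ} (hlt : l ≤ t)
    (ht : 0 ≤ t) (hδ : 0 < δ) (hρ₀1 : ρ₀ ≤ 1)
    (hz : z ∈ Metric.ball c.center c.rad) (hw : w ∈ Metric.ball c.center c.rad)
    (hwz : |w - z| ≤ 2 * (ρ₀ * Real.exp (-((1 + c.wt c.top) * t)))) {v : Option ι → ℤ}
    (hv0 : |c.F₀ (fun j => v j) z| ≤ δ * Real.exp (-t))
    (hv : ∀ i, |(v (some i) : ℝ)| ≤ δ * Real.exp (c.wt i * t))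
    (hv1 : |c.F₁ (fun j => v j) z| ≤
      Fintype.card ι * c.K * δ * Real.exp (c.wt c.top * t - l)) (j : Option ι) :
    |(Matrix.diagonal (c.scale t l l') * c.frame w).mulVec (fun j => (v j : ℝ)) j| ≤
      (1 + 3 * (Fintype.card ι * c.K)) * δ * Real.exp (-l') := by
  have hK := c.K_nonneg
  set N : ℝ := Fintype.card ι * c.K with hN
  have hN0 : 0 ≤ N := by positivity
  set r₁ := c.wt c.top with hr₁
  have hr₁pos : 0 < r₁ := c.wt_pos _
  have hM : ∀ i, |(fun j => (v j : ℝ)) (some i)| ≤ δ * Real.exp (r₁ * t) := fun i =>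
    (hv i).trans (mul_le_mul_of_nonneg_left (Real.exp_le_exp.2
      (mul_le_mul_of_nonneg_right (c.wt_le_top i) ht)) hδ.le)
  have hwz' : |w - z| ≤ 2 * Real.exp (-((1 + r₁) * t)) := by
    refine hwz.trans (mul_le_mul_of_nonneg_left ?_ zero_le_two)
    exact mul_le_of_le_one_left (Real.exp_pos _).le hρ₀1
  have hprod : N * (δ * Real.exp (r₁ * t)) * |w - z| ≤ 2 * N * δ * Real.exp (-t) := by
    have e : Real.exp (-t) = Real.exp (r₁ * t) * Real.exp (-((1 + r₁) * t)) := by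
      rw [← Real.exp_add]; congr 1; ring
    rw [e]
    calc _ ≤ N * (δ * Real.exp (r₁ * t)) * (2 * Real.exp (-((1 + r₁) * t))) := by gcongr
      _ = _ := by ring
  rw [← Matrix.mulVec_mulVec, Matrix.mulVec_diagonal, abs_mul, abs_of_pos (c.scale_pos _ _ _ _)]
  rcases j with _ | i
  · rw [frame_mulVec_none]
    have h1 := c.abs_F₀_sub_le (b := fun j => (v j : ℝ)) hM hz hw
    have h2 : |c.F₀ (fun j => (v j : ℝ)) w| ≤ (1 + 2 * N) * δ * Real.exp (-t) := by
      have := abs_sub_abs_le_abs_sub (c.F₀ (fun j => (v j : ℝ)) w) (c.F₀ (fun j => (v j : ℝ)) z)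
      linarith
    have h3 : c.scale t l l' none = Real.exp t * Real.exp (-l') := by
      rw [← Real.exp_add]; simp [scale, sub_eq_add_neg]
    calc c.scale t l l' none * |c.F₀ (fun j => (v j : ℝ)) w|
        ≤ c.scale t l l' none * ((1 + 2 * N) * δ * Real.exp (-t)) :=
          mul_le_mul_of_nonneg_left h2 (c.scale_pos _ _ _ _).le
      _ = (1 + 2 * N) * δ * Real.exp (-l') * (Real.exp t * Real.exp (-t)) := by rw [h3]; ring
      _ = (1 + 2 * N) * δ * Real.exp (-l') := by rw [← Real.exp_add]; simp
      _ ≤ _ := by gcongr; linarith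
  · by_cases hi : i = c.top
    · subst hi
      rw [frame_mulVec_top]
      have h1 := c.abs_F₁_sub_le (b := fun j => (v j : ℝ)) hM hz hw
      have h4 : N * δ * Real.exp (r₁ * t - l) + 2 * N * δ * Real.exp (-t) ≤
          (3 * N) * δ * Real.exp (r₁ * t - l) := by
        have : Real.exp (-t) ≤ Real.exp (r₁ * t - l) := by
          refine Real.exp_le_exp.2 ?_
          have := mul_nonneg hr₁pos.le ht
          linarith
        have h5 : 2 * N * δ * Real.exp (-t) ≤ 2 * N * δ * Real.exp (r₁ * t - l) := by gcongr
        linarith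
      have h2 : |c.F₁ (fun j => (v j : ℝ)) w| ≤ (3 * N) * δ * Real.exp (r₁ * t - l) := by
        have := abs_sub_abs_le_abs_sub (c.F₁ (fun j => (v j : ℝ)) w)
          (c.F₁ (fun j => (v j : ℝ)) z)
        linarith
      calc c.scale t l l' (some c.top) * |c.F₁ (fun j => (v j : ℝ)) w|
          ≤ c.scale t l l' (some c.top) * ((3 * N) * δ * Real.exp (r₁ * t - l)) :=
            mul_le_mul_of_nonneg_left h2 (c.scale_pos _ _ _ _).le
        _ = (3 * N) * δ * (c.scale t l l' (some c.top) * Real.exp (r₁ * t - l)) := by ring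
        _ = (3 * N) * δ * Real.exp (-l') := by
            congr 1
            rw [scale, ← Real.exp_add]
            congr 1
            simp only [w_some, hr₁, if_true]
            ring
        _ ≤ _ := by gcongr; linarith
    · rw [frame_mulVec_some _ _ _ hi]
      have h3 : c.scale t l l' (some i) = Real.exp (-(c.wt i * t)) * Real.exp (-l') := by
        rw [← Real.exp_add]; simp [scale, sub_eq_add_neg, hi]
      calc c.scale t l l' (some i) * |(v (some i) : ℝ)|
          ≤ c.scale t l l' (some i) * (δ * Real.exp (c.wt i * t)) :=
            mul_le_mul_of_nonneg_left (hv i) (c.scale_pos _ _ _ _).le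
        _ = δ * Real.exp (-l') * (Real.exp (-(c.wt i * t)) * Real.exp (c.wt i * t)) := by
            rw [h3]; ring
        _ = 1 * δ * Real.exp (-l') := by rw [← Real.exp_add]; simp
        _ ≤ _ := by gcongr; linarith

/-- Counting separated points near which some vector of the family becomes short. -/
theorem exists_card_killed_le {μ : Measure ℝ} {X : Set ℝ} (hX0 : μ Xᶜ = 0)
    {a b α ρm Rg G γ ρ : ℝ} (ha : 0 < a) (hb : 0 ≤ b) (hG : 0 ≤ G)
    (hlow : ∀ x ∈ X, ∀ ρ, 0 < ρ → ρ ≤ ρm → ENNReal.ofReal (a * ρ ^ α) ≤ μ (Metric.ball x ρ))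
    (hup : ∀ x ∈ X, ∀ ρ, 0 < ρ → ρ ≤ ρm → μ (Metric.ball x ρ) ≤ ENNReal.ofReal (b * ρ ^ α))
    (hgood : ∀ D : Option ι → ℝ, UniformlyGood μ X (Metric.ball c.center Rg) α ρm G γ
      (fun W y => covol (Matrix.diagonal D * c.frame y) W))
    (hcont : ∀ i j, ∀ y ∈ Metric.ball c.center Rg, ContinuousAt (fun y => c.frame y i j) y)
    (hρ : 0 < ρ) (hρ1 : ρ ≤ 1) :
    ∃ A, 0 ≤ A ∧ ∀ (ρ₀ t l' δ y r : ℝ) (V : Set (Option ι → ℤ)) (s : Finset ℝ),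
      0 < ρ₀ → ρ₀ ≤ 1 → 0 ≤ t → 0 ≤ l' → (Fintype.card ι + 1) * l' ≤ t → 0 < δ →
      2 * (Fintype.card ι + 1) * (1 + 3 * (Fintype.card ι * c.K)) * δ ≤ ρ →
      y ∈ X → 0 < r → 5 ^ (Fintype.card ι + 2) * r ≤ ρm →
      Metric.ball y (5 ^ (Fintype.card ι + 2) * r) ⊆ Metric.ball c.center Rg →
      Metric.ball y r ⊆ Metric.ball c.center c.rad → (∀ v ∈ V, v ≠ 0) →
      (∀ W : Submodule ℚ (Option ι → ℚ), (∃ v ∈ V, ratCast v ∈ W) → ∃ z ∈ Metric.ball y r, ρ ≤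
        covol (Matrix.diagonal (c.scale t ((Fintype.card ι + 1) * l') l') * c.frame z) W) →
      ρ₀ * Real.exp (-((1 + c.wt c.top) * t)) ≤ ρm → (s : Set ℝ) ⊆ X →
      (∀ x ∈ s, ∀ x' ∈ s, x ≠ x' → 2 * (ρ₀ * Real.exp (-((1 + c.wt c.top) * t))) ≤ |x - x'|) →
      (∀ x ∈ s, Metric.closedBall x (ρ₀ * Real.exp (-((1 + c.wt c.top) * t))) ⊆
        Metric.ball y r) →
      (∀ x ∈ s, ∃ z ∈ Metric.closedBall x (ρ₀ * Real.exp (-((1 + c.wt c.top) * t))), ∃ v ∈ V,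
        |c.F₀ (fun j => v j) z| ≤ δ * Real.exp (-t) ∧
        (∀ i, |(v (some i) : ℝ)| ≤ δ * Real.exp (c.wt i * t)) ∧
        |c.F₁ (fun j => v j) z| ≤ Fintype.card ι * c.K * δ *
          Real.exp (c.wt c.top * t - (Fintype.card ι + 1) * l')) →
      s.card * (ρ₀ * Real.exp (-((1 + c.wt c.top) * t))) ^ α ≤
        A * (δ * Real.exp (-l')) ^ γ * r ^ α := by
  set n := Fintype.card ι with hn
  have hK := c.K_nonneg
  set N : ℝ := n * c.K with hN
  have hN0 : 0 ≤ N := by positivity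
  obtain ⟨C, hC, hmark⟩ := measure_not_marked_le (S := Submodule ℚ (Option ι → ℚ))
    (Reg := Metric.ball c.center Rg) (γ := γ) ha hb hG hlow hup (n + 2)
  refine ⟨C * (2 * (n + 1) * (1 + 3 * N) / ρ) ^ γ / a, by positivity, ?_⟩
  intro ρ₀ t l' δ y r V s hρ₀ hρ₀1 ht hl' hlt hδ hδρ hyX hr hrm hballRg hballrad hV hlarge hτm hsX
    hsep hsub hkill
  set τ := ρ₀ * Real.exp (-((1 + c.wt c.top) * t)) with hτ
  have hτpos : 0 < τ := by positivity
  set l := ((n : ℝ) + 1) * l' with hl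
  set ε := 2 * ((n : ℝ) + 1) * (1 + 3 * N) * (δ * Real.exp (-l')) with hε
  have hεpos : 0 < ε := by positivity
  have hερ : ε ≤ ρ := by
    refine le_trans ?_ hδρ
    have h1 : Real.exp (-l') ≤ 1 := Real.exp_le_one_iff.2 (by linarith)
    calc ε = 2 * ((n : ℝ) + 1) * (1 + 3 * N) * δ * Real.exp (-l') := by rw [hε]; ring
      _ ≤ 2 * ((n : ℝ) + 1) * (1 + 3 * N) * δ * 1 := by gcongr
      _ = _ := mul_one _
  set D := c.scale t l l' with hD
  set P : Set (Submodule ℚ (Option ι → ℚ)) := {W | ∃ v ∈ V, ratCast v ∈ W} with hP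
  have hZ := hmark (fun W y => covol (Matrix.diagonal D * c.frame y) W) (hgood D)
    (fun W y hy => continuousAt_covol (fun i j => by
      simp only [Matrix.diagonal_mul]
      exact continuousAt_const.mul (hcont i j y hy)) W) P
    (fun T _ hT => by
      have := card_chain_submodule_le T hT
      rwa [Fintype.card_option] at this) y hyX r hr hrm hballRg ε ρ hεpos hρ
    (fun W hW => hlarge W hW)
  have hcount := card_mul_le_of_balls_subset hX0 (q := a * τ ^ α)
    (by positivity : 0 ≤ C * (ε / ρ) ^ γ * r ^ α)
    (fun x hx => hlow x (hsX hx) τ hτpos hτm) hsep (fun x hx w hw => by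
      refine ⟨⟨hsub x hx (Metric.ball_subset_closedBall hw.1), hw.2⟩, fun hm => ?_⟩
      obtain ⟨z, hz, v, hvV, hv0, hv, hv1⟩ := hkill x hx
      have h1 := hm.le_of_abs_mulVec_le hερ hρ1 hvV (hV v hvV)
        (c.abs_scaled_frame_mulVec_le hlt ht hδ hρ₀1 (hballrad (hsub x hx hz))
          (hballrad (hsub x hx (Metric.ball_subset_closedBall hw.1))) (by
            have h2 : |w - x| < τ := hw.1
            have h3 : |z - x| ≤ τ := hz
            rw [abs_sub_comm] at h3
            have := abs_sub_le w x z
            linarith) hv0 hv hv1)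
      rw [Fintype.card_option, hε] at h1
      push_cast at h1
      have h4 : (0 : ℝ) < ((n : ℝ) + 1) * ((1 + 3 * N) * δ * Real.exp (-l')) := by positivity
      rw [← hn, ← hN] at h1
      linarith) hZ
  have h5 : (ε / ρ) ^ γ = (2 * (n + 1) * (1 + 3 * N) / ρ) ^ γ * (δ * Real.exp (-l')) ^ γ := by
    rw [← Real.mul_rpow (by positivity) (by positivity)]
    congr 1
    rw [hε]; ring
  rw [h5] at hcount
  have h6 : C * (2 * (n + 1) * (1 + 3 * N) / ρ) ^ γ / a * (δ * Real.exp (-l')) ^ γ * r ^ α =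
      (C * ((2 * (n + 1) * (1 + 3 * N) / ρ) ^ γ * (δ * Real.exp (-l')) ^ γ) * r ^ α) / a := by ring
  rw [h6, le_div_iff₀ ha]
  linarith

end WeightedCurve

theorem card_le_of_mul_exp_rpow_le {N A ρ₀ u u' x l' α γ : ℝ} (hρ₀ : 0 < ρ₀)
    (h : N * (ρ₀ * Real.exp (-u)) ^ α ≤
      A * (Real.exp (-x) * Real.exp (-l')) ^ γ * (ρ₀ * Real.exp (-u')) ^ α) :
    N ≤ A * Real.exp (-(γ * (x + l'))) * Real.exp (α * (u - u')) := by
  rw [Real.mul_rpow hρ₀.le (Real.exp_pos _).le, Real.mul_rpow hρ₀.le (Real.exp_pos _).le,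
    ← Real.exp_mul, ← Real.exp_mul, ← Real.exp_add, ← Real.exp_mul] at h
  have h1 : 0 < ρ₀ ^ α * Real.exp (-u * α) := by positivity
  refine le_of_mul_le_mul_right (h.trans (le_of_eq ?_)) h1
  have e1 : Real.exp (-u' * α) = Real.exp (α * (u - u')) * Real.exp (-u * α) := by
    rw [← Real.exp_add]; congr 1; ring
  have e2 : Real.exp ((-x + -l') * γ) = Real.exp (-(γ * (x + l'))) := by congr 1; ring
  rw [e1, e2]; ring

namespace WeightedCurve

variable {ι : Type*} [Fintype ι] (c : WeightedCurve ι)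

theorem exists_wt_lower : ∃ q : ℝ, 0 < q ∧ q ≤ 1 ∧ ∀ i, q ≤ c.wt i := by
  have : Nonempty ι := ⟨c.top⟩
  obtain ⟨i, hi⟩ := Finite.exists_min c.wt
  exact ⟨c.wt i, c.wt_pos i, c.wt_le_one i, hi⟩

/-- The radius of the balls of generation `k`. -/
noncomputable def radius (ρ₀ β : ℝ) (k : ℝ) : ℝ :=
  ρ₀ * Real.exp (-((1 + c.wt c.top) * (β * k)))

theorem radius_pos {ρ₀ β k : ℝ} (h : 0 < ρ₀) : 0 < c.radius ρ₀ β k := by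
  unfold radius; positivity

theorem radius_le {ρ₀ β k : ℝ} (h : 0 < ρ₀) (hβ : 0 ≤ β) (hk : 0 ≤ k) :
    c.radius ρ₀ β k ≤ ρ₀ := by
  refine mul_le_of_le_one_right h.le (Real.exp_le_one_iff.2 ?_)
  have := c.wt_pos c.top
  have : 0 ≤ (1 + c.wt c.top) * (β * k) := by positivity
  linarith

/-- `x` is a point near which some nonzero vector is `δ`-short at time `t`, with derivative at
most `M`. -/
def ShortNear (δ t τ M x : ℝ) (V : Set (Option ι → ℤ)) : Prop :=
  ∃ z ∈ Metric.closedBall x τ, ∃ v ∈ V, v ≠ 0 ∧ |c.F₀ (fun j => v j) z| ≤ δ * Real.exp (-t) ∧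
    (∀ i, |(v (some i) : ℝ)| ≤ δ * Real.exp (c.wt i * t)) ∧ |c.F₁ (fun j => v j) z| ≤ M

/-- The set of vectors whose derivative is at least `m` somewhere on the set. -/
def largeDeriv (m : ℝ) (I : Set ℝ) : Set (Option ι → ℤ) :=
  {v | ∃ x ∈ I, m ≤ |c.F₁ (fun j => v j) x|}

variable [DecidableEq ι]

theorem exists_counting {μ : Measure ℝ} {X : Set ℝ} (hX0 : μ Xᶜ = 0)
    {a b α ρm Rg G γ ρ₀ c₀ : ℝ} (ha : 0 < a) (hb : 0 ≤ b) (hG : 0 ≤ G)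
    (hlow : ∀ x ∈ X, ∀ ρ, 0 < ρ → ρ ≤ ρm → ENNReal.ofReal (a * ρ ^ α) ≤ μ (Metric.ball x ρ))
    (hup : ∀ x ∈ X, ∀ ρ, 0 < ρ → ρ ≤ ρm → μ (Metric.ball x ρ) ≤ ENNReal.ofReal (b * ρ ^ α))
    (hgood : ∀ D : Option ι → ℝ, UniformlyGood μ X (Metric.ball c.center Rg) α ρm G γ
      (fun W y => covol (Matrix.diagonal D * c.frame y) W)) (hγ : 0 < γ)
    (hcont : ∀ i j, ∀ y ∈ Metric.ball c.center Rg, ContinuousAt (fun y => c.frame y i j) y)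
    (hρ₀ : 0 < ρ₀) (hρ₀1 : ρ₀ ≤ 1) (hρ₀rad : 2 * ρ₀ ≤ c.rad)
    (hρ₀g : (5 ^ (Fintype.card ι + 2) + 1) * ρ₀ ≤ Rg)
    (hρ₀m : 5 ^ (Fintype.card ι + 2) * ρ₀ ≤ ρm) (hX : c.center ∈ X) (hc₀pos : 0 < c₀)
    (hc₀ : ∀ b : Option ι → ℝ, (∃ j, 1 ≤ |b j|) →
      ∃ z ∈ Metric.ball c.center ρ₀, c₀ ≤ |c.F₀ b z|) :
    ∃ A η g β₀ : ℝ, 0 ≤ A ∧ 0 < η ∧ Fintype.card ι * η ≤ 1 / 2 ∧ 0 < g ∧ 0 < β₀ ∧ ∀ β, β₀ ≤ β →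
      (∀ k m : ℕ, 1 ≤ m → 2 * m ≤ k → ∀ y ∈ X, |y - c.center| ≤ ρ₀ →
        c.NoShort (Real.exp (-(η * β))) (β * (k - m)) y → ∀ s : Finset ℝ, (s : Set ℝ) ⊆ X →
        (∀ x ∈ s, ∀ x' ∈ s, x ≠ x' → 2 * c.radius ρ₀ β k ≤ |x - x'|) →
        (∀ x ∈ s, Metric.closedBall x (c.radius ρ₀ β k) ⊆
          Metric.ball y (c.radius ρ₀ β (k - m))) →
        (∀ x ∈ s, c.ShortNear (Real.exp (-(η * β))) (β * k) (c.radius ρ₀ β k)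
          (Fintype.card ι * c.K * Real.exp (-(η * β)) *
            Real.exp (c.wt c.top * (β * k) - (m - 1) * (η * β))) x
          (c.largeDeriv (Real.exp (-(η * β)) *
            Real.exp (c.wt c.top * (β * k) - m * (η * β)))
            (Metric.ball y (c.radius ρ₀ β (k - m))))) →
        (s.card : ℝ) ≤ A * Real.exp (-(g * β * m)) * Real.exp ((1 + c.wt c.top) * α * β * m)) ∧
      (∀ k h : ℕ, 2 * h ≤ k → ∀ s : Finset ℝ, (s : Set ℝ) ⊆ X →
        (∀ x ∈ s, ∀ x' ∈ s, x ≠ x' → 2 * c.radius ρ₀ β k ≤ |x - x'|) →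
        (∀ x ∈ s, Metric.closedBall x (c.radius ρ₀ β k) ⊆ Metric.ball c.center ρ₀) →
        (∀ x ∈ s, c.ShortNear (Real.exp (-(η * β))) (β * k) (c.radius ρ₀ β k)
          (Fintype.card ι * c.K * Real.exp (-(η * β)) *
            Real.exp (c.wt c.top * (β * k) - h * (η * β))) x univ) →
        (s.card : ℝ) ≤
          A * Real.exp (-(g * β * (h + 1))) * Real.exp ((1 + c.wt c.top) * α * β * k)) := by
  obtain ⟨q, hq, hq1, hqw⟩ := c.exists_wt_lower
  set n := Fintype.card ι with hn
  set r₁ := c.wt c.top with hr₁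
  have hr₁pos : 0 < r₁ := c.wt_pos _
  have hK := c.K_nonneg
  set N : ℝ := n * c.K with hN
  have hN0 : 0 ≤ N := by positivity
  set ρ := min c.κ c₀ with hρdef
  have hρ : 0 < ρ := lt_min c.κ_pos hc₀pos
  have hρκ : ρ ≤ c.κ := min_le_left _ _
  have hρc : ρ ≤ c₀ := min_le_right _ _
  have hρ1 : ρ ≤ 1 := hρκ.trans c.κ_le_one
  obtain ⟨A, hA, hcount⟩ := c.exists_card_killed_le hX0 ha hb hG hlow hup hgood hcont hρ hρ1
  obtain ⟨Q, hQ, hloc⟩ := c.exists_le_covol_of_noShort hρ₀ hqw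
  set η : ℝ := q / (2 * (n + 3)) with hη
  have hηpos : 0 < η := by positivity
  have hηq : (n + 3) * η = q / 2 := by rw [hη]; field_simp
  have hηn : (0 : ℝ) ≤ n * η := by positivity
  have hη1 : η ≤ 1 := by linarith
  have hηq' : η ≤ q := by linarith
  obtain ⟨β₁, hβ₁⟩ : ∃ β₁ : ℝ, ∀ β, β₁ ≤ β → Q * Real.exp (-(q / 2 * β)) ≤ 1 ∧
      2 * (n + 1) * (1 + 3 * N) * Real.exp (-(η * β)) ≤ ρ := by
    have h1 : ∀ {C s e : ℝ}, 0 < s → 0 < e → ∀ᶠ β in atTop, C * Real.exp (-(s * β)) ≤ e := by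
      intro C s e hs he
      have h2 : Tendsto (fun β : ℝ => C * Real.exp (-(s * β))) atTop (nhds (C * 0)) :=
        (Real.tendsto_exp_neg_atTop_nhds_zero.comp
          (tendsto_id.const_mul_atTop hs)).const_mul C
      rw [mul_zero] at h2
      exact (h2.eventually_lt_const he).mono fun _ h => h.le
    exact eventually_atTop.1 ((h1 (half_pos hq) one_pos).and (h1 hηpos hρ))
  refine ⟨A, η, γ * η / (n + 1), max β₁ 1, hA, hηpos, by linarith, by positivity,
    lt_max_of_lt_right one_pos, fun β hβ => ?_⟩
  have hβ1 : 1 ≤ β := (le_max_right _ _).trans hβ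
  have hβ0 : 0 < β := by linarith
  obtain ⟨hβQ, hβδ⟩ := hβ₁ β ((le_max_left _ _).trans hβ)
  set δ := Real.exp (-(η * β)) with hδdef
  have hδ : 0 < δ := Real.exp_pos _
  have hηβ : 0 < η * β := by positivity
  have hδ1 : δ ≤ 1 := Real.exp_le_one_iff.2 (by linarith)
  have h5 : (1 : ℝ) ≤ 5 ^ (n + 2) := one_le_pow₀ (by norm_num)
  have hn1 : (0 : ℝ) < n + 1 := by positivity
  have hcard : ∀ j : ℝ, ((n : ℝ) + 1) * (j * (η * β) / (n + 1)) = j * (η * β) := fun j => by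
    field_simp
  have hrate : ∀ j : ℝ, 0 ≤ j → Real.exp (-(γ * (η * β + j * (η * β) / (n + 1)))) ≤
      Real.exp (-(γ * η / (n + 1) * β * (j + 1))) := by
    intro j hj
    refine Real.exp_le_exp.2 (neg_le_neg ?_)
    have h1 : γ * η / (n + 1) * β * (j + 1) = γ * (η * β / (n + 1) + j * (η * β) / (n + 1)) := by
      field_simp
      ring
    rw [h1]
    refine mul_le_mul_of_nonneg_left (add_le_add_left ?_ _) hγ.le
    rw [div_le_iff₀ hn1]
    have : (0 : ℝ) ≤ n := Nat.cast_nonneg n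
    nlinarith
  have hball : ∀ y, |y - c.center| ≤ ρ₀ → ∀ r, r ≤ ρ₀ →
      Metric.ball y (5 ^ (n + 2) * r) ⊆ Metric.ball c.center Rg ∧
      Metric.ball y r ⊆ Metric.ball c.center c.rad ∧ 5 ^ (n + 2) * r ≤ ρm := by
    intro y hy r hr
    have h6 : (5 : ℝ) ^ (n + 2) * r ≤ 5 ^ (n + 2) * ρ₀ :=
      mul_le_mul_of_nonneg_left hr (by positivity)
    refine ⟨Metric.ball_subset_ball' ?_, Metric.ball_subset_ball' ?_, h6.trans hρ₀m⟩
    · rw [Real.dist_eq]; linarith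
    · rw [Real.dist_eq]; linarith
  have hradm : ∀ k : ℕ, c.radius ρ₀ β k ≤ ρm := fun k =>
    (c.radius_le hρ₀ hβ0.le (Nat.cast_nonneg k)).trans (by nlinarith)
  constructor
  · intro k m hm hmk y hy hyc hE s hsX hsep hsub hkill
    have hmk' : 2 * (m : ℝ) ≤ k := by exact_mod_cast hmk
    have hm' : (1 : ℝ) ≤ m := by exact_mod_cast hm
    have hr := c.radius_le (k := k - m) hρ₀ hβ0.le (by linarith)
    obtain ⟨hb1, hb2, hb3⟩ := hball y hyc _ hr
    have hm0 : (0 : ℝ) ≤ m - 1 := by linarith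
    have hmβ : (1 : ℝ) * β ≤ m * β := by gcongr
    have hkβ : 2 * (m : ℝ) * β ≤ k * β := by gcongr
    have hηm : 0 ≤ (m : ℝ) * (η * β) := by positivity
    have hηm' : (m : ℝ) * (η * β) ≤ m * (1 * β) := by gcongr
    have hfin := hcount ρ₀ (β * k) ((m - 1) * (η * β) / (n + 1)) δ y (c.radius ρ₀ β (k - m))
      {v | v ≠ 0 ∧ (∀ i, |(v (some i) : ℝ)| ≤ δ * Real.exp (c.wt i * (β * k))) ∧
        v ∈ c.largeDeriv (δ * Real.exp (c.wt c.top * (β * k) - m * (η * β)))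
          (Metric.ball y (c.radius ρ₀ β (k - m)))} s hρ₀ hρ₀1 (by positivity) (by positivity)
      (by rw [hcard]; linarith) hδ hβδ hy (c.radius_pos hρ₀) hb3 hb1 hb2 (fun v hv => hv.1)
      (by
        rintro W ⟨v, ⟨-, hv, x, hx, hvx⟩, hvW⟩
        refine hloc δ η (β * (k - m)) (β * k) ((m - 1) * (η * β) / (n + 1)) y hδ hδ1 hηpos.le
          (by linarith) (by linarith) (by positivity) (by rw [hcard]; linarith) ?_ hb2 hE ρ hρκ v
          hv ⟨x, hx, ?_⟩ W hvW
        · rw [hδdef, ← Real.exp_nat_mul]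
          have h7 : Real.exp (-((q - 2 * η) * (β * k - β * (k - m)))) ≤
              Real.exp (-(q / 2 * β)) * Real.exp (((n + 1 : ℕ) : ℝ) * -(η * β)) := by
            rw [← Real.exp_add]
            refine Real.exp_le_exp.2 ?_
            push_cast
            have h8 : 0 ≤ (q - 2 * η) * (m * β - β) :=
              mul_nonneg (by linarith) (by linarith)
            have h9 : (n + 3) * η * β = q / 2 * β := by rw [hηq]
            linarith
          calc _ ≤ Q * (Real.exp (-(q / 2 * β)) * Real.exp (((n + 1 : ℕ) : ℝ) * -(η * β))) := by
                gcongr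
            _ = Q * Real.exp (-(q / 2 * β)) * Real.exp (((n + 1 : ℕ) : ℝ) * -(η * β)) := by ring
            _ ≤ 1 * Real.exp (((n + 1 : ℕ) : ℝ) * -(η * β)) := by gcongr
            _ = _ := one_mul _
        · have h7 : η * (β * k - β * (k - m)) = m * (η * β) := by ring
          rw [h7]; exact hvx)
      (hradm k) hsX hsep hsub (by
        intro x hx
        obtain ⟨z, hz, v, hvV, hv0, hF, hv, hF1⟩ := hkill x hx
        refine ⟨z, hz, v, ⟨hv0, hv, hvV⟩, hF, hv, ?_⟩
        rw [hcard]
        exact hF1)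
    refine (card_le_of_mul_exp_rpow_le hρ₀ hfin).trans ?_
    have h7 := hrate (m - 1) hm0
    rw [sub_add_cancel] at h7
    have h8 : α * ((1 + r₁) * (β * k) - (1 + r₁) * (β * (k - m))) = (1 + r₁) * α * β * m := by ring
    rw [h8]
    gcongr
  · intro k h hhk s hsX hsep hsub hkill
    have hhk' : 2 * (h : ℝ) ≤ k := by exact_mod_cast hhk
    have hh : (0 : ℝ) ≤ h := Nat.cast_nonneg h
    obtain ⟨hb1, hb2, hb3⟩ := hball c.center (by simpa using hρ₀.le) _ le_rfl
    have hkβ : 2 * (h : ℝ) * β ≤ k * β := by gcongr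
    have hhβ : 0 ≤ (h : ℝ) * β := by positivity
    have hηm' : (h : ℝ) * (η * β) ≤ h * (1 * β) := by gcongr
    have hfin := hcount ρ₀ (β * k) (h * (η * β) / (n + 1)) δ c.center ρ₀ {v | v ≠ 0} s hρ₀ hρ₀1
      (by positivity) (by positivity) (by rw [hcard]; linarith) hδ hβδ hX hρ₀ hb3 hb1 hb2
      (fun v hv => hv)
      (by
        rintro W ⟨v, hv0, hvW⟩
        refine c.exists_le_covol_of_top hρ₀ (by linarith) hqw hc₀ hc₀pos (by positivity)
          (by positivity) ?_ hρκ hρc hv0 hvW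
        rw [hcard]
        have h9 : (h : ℝ) * β * η ≤ h * β * q := by gcongr
        have h10 := mul_le_mul_of_nonneg_left (sub_nonneg.2 hkβ) hq.le
        have h11 : 0 ≤ q * ((h : ℝ) * β) := by positivity
        linarith)
      (hradm k) hsX hsep hsub (by
        intro x hx
        obtain ⟨z, hz, v, -, hv0, hF, hv, hF1⟩ := hkill x hx
        refine ⟨z, hz, v, hv0, hF, hv, ?_⟩
        rw [hcard]
        exact hF1)
    have hfin' : (s.card : ℝ) * (ρ₀ * Real.exp (-((1 + r₁) * (β * k)))) ^ α ≤
        A * (Real.exp (-(η * β)) * Real.exp (-(h * (η * β) / (n + 1)))) ^ γ *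
          (ρ₀ * Real.exp (-0)) ^ α := by
      rw [neg_zero, Real.exp_zero, mul_one]; exact hfin
    have h6 := card_le_of_mul_exp_rpow_le hρ₀ hfin'
    refine h6.trans ?_
    have h7 := hrate h hh
    have h8 : α * ((1 + r₁) * (β * k) - 0) = (1 + r₁) * α * β * k := by ring
    rw [h8]
    gcongr

end WeightedCurve

/-- A transference principle: a good simultaneous approximation forces an integer vector on which
the dual linear form is small. -/
theorem exists_dual_form_vector {ι : Type*} [Fintype ι] (y : ι → ℝ) {q : ℤ} (hq : q ≠ 0) (p : ι → ℤ)
    {T : ι → ℝ} (hT : ∀ i, 0 < T i) (hqT : 5 * |(q : ℝ)| < ∏ i, T i) {E : ℝ} (hE : E ≤ 1)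
    (hsum : ∑ i, T i * |q * y i - p i| ≤ E) :
    ∃ v : Option ι → ℤ, v ≠ 0 ∧ (∀ i, |(v (some i) : ℝ)| ≤ T i) ∧
      |v none + ∑ i, y i * v (some i)| * |(q : ℝ)| ≤ E := by
  classical
  have hq1 : (1 : ℝ) ≤ |(q : ℝ)| := by exact_mod_cast Int.one_le_abs hq
  set box : Finset (ι → ℕ) := Fintype.piFinset fun i => Finset.range (⌊T i⌋₊ + 1) with hbox
  have hmem : ∀ a ∈ box, ∀ i, (a i : ℝ) ≤ T i := by
    intro a ha i
    have h1 := Finset.mem_range.1 (Fintype.mem_piFinset.1 ha i)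
    exact (Nat.le_floor_iff (hT i).le).1 (by omega)
  set z : (ι → ℕ) → ℤ := fun a => -⌊∑ i, (a i : ℝ) * y i⌋ with hz
  set f : (ι → ℕ) → ℤ := fun a => z a * q + ∑ i, (a i : ℤ) * p i with hf
  have hfeq : ∀ a, (f a : ℝ) =
      q * (z a + ∑ i, (a i : ℝ) * y i) - ∑ i, (a i : ℝ) * (q * y i - p i) := by
    intro a
    simp only [hf, Int.cast_add, Int.cast_mul, Int.cast_sum, Int.cast_natCast]
    have : ∑ i, (a i : ℝ) * (q * y i - p i) =
        q * ∑ i, (a i : ℝ) * y i - ∑ i, (a i : ℝ) * p i := by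
      rw [Finset.mul_sum, ← Finset.sum_sub_distrib]
      exact Finset.sum_congr rfl fun i _ => by ring
    rw [this]; ring
  have hmaps : ∀ a ∈ box, f a ∈ Finset.Icc (-(2 * |q|)) (2 * |q|) := by
    intro a ha
    rw [Finset.mem_Icc, ← abs_le]
    have h1 : |(z a : ℝ) + ∑ i, (a i : ℝ) * y i| ≤ 1 := by
      have h2 : (z a : ℝ) + ∑ i, (a i : ℝ) * y i = Int.fract (∑ i, (a i : ℝ) * y i) := by
        rw [Int.fract, hz]; push_cast; ring
      rw [h2, abs_of_nonneg (Int.fract_nonneg _)]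
      exact (Int.fract_lt_one _).le
    have h3 : |∑ i, (a i : ℝ) * (q * y i - p i)| ≤ 1 := by
      refine (Finset.abs_sum_le_sum_abs _ _).trans (le_trans ?_ (hsum.trans hE))
      refine Finset.sum_le_sum fun i _ => ?_
      rw [abs_mul, Nat.abs_cast]
      exact mul_le_mul_of_nonneg_right (hmem a ha i) (abs_nonneg _)
    have h4 : |(f a : ℝ)| ≤ 2 * |(q : ℝ)| := by
      rw [hfeq]
      refine (abs_sub _ _).trans ?_
      rw [abs_mul]
      have := mul_le_mul_of_nonneg_left h1 (abs_nonneg (q : ℝ))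
      linarith
    exact_mod_cast h4
  have hcard : (Finset.Icc (-(2 * |q|)) (2 * |q|)).card < box.card := by
    have h1 : ((Finset.Icc (-(2 * |q|)) (2 * |q|)).card : ℝ) ≤ 5 * |(q : ℝ)| := by
      have h2 : ((Finset.Icc (-(2 * |q|)) (2 * |q|)).card : ℤ) ≤ 5 * |q| := by
        rw [Int.card_Icc]
        have := Int.one_le_abs hq
        omega
      exact_mod_cast h2
    have h3 : ∏ i, T i ≤ (box.card : ℝ) := by
      rw [hbox, Fintype.card_piFinset]
      push_cast
      refine Finset.prod_le_prod (fun i _ => (hT i).le) fun i _ => ?_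
      rw [Finset.card_range]
      push_cast
      exact (Nat.lt_floor_add_one _).le
    exact_mod_cast (h1.trans_lt hqT).trans_le h3
  obtain ⟨a, ha, a', ha', hne, hfa⟩ := Finset.exists_ne_map_eq_of_card_lt_of_maps_to hcard hmaps
  have hdiff : ∀ i, |(a i : ℝ) - a' i| ≤ T i := fun i =>
    abs_sub_le_of_nonneg_of_le (Nat.cast_nonneg _) (hmem a ha i) (Nat.cast_nonneg _)
      (hmem a' ha' i)
  refine ⟨fun j => j.elim (z a - z a') fun i => (a i : ℤ) - a' i, fun h0 => hne ?_, fun i => ?_, ?_⟩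
  · ext i
    have := congrFun h0 (some i)
    simp only [Option.elim, Pi.zero_apply] at this
    omega
  · simpa using hdiff i
  · have h1 : (q : ℝ) * (((z a - z a' : ℤ) : ℝ) + ∑ i, y i * (((a i : ℤ) - a' i : ℤ) : ℝ)) =
        ∑ i, ((a i : ℝ) - a' i) * (q * y i - p i) := by
      have h2 : (f a : ℝ) = f a' := by rw [hfa]
      rw [hfeq, hfeq] at h2
      have h3 : ∑ i, ((a i : ℝ) - a' i) * (q * y i - p i) =
          ∑ i, (a i : ℝ) * (q * y i - p i) - ∑ i, (a' i : ℝ) * (q * y i - p i) := by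
        rw [← Finset.sum_sub_distrib]
        exact Finset.sum_congr rfl fun i _ => by ring
      have h4 : ∑ i, y i * (((a i : ℤ) - a' i : ℤ) : ℝ) =
          ∑ i, (a i : ℝ) * y i - ∑ i, (a' i : ℝ) * y i := by
        rw [← Finset.sum_sub_distrib]
        refine Finset.sum_congr rfl fun i _ => ?_
        push_cast; ring
      rw [h3, h4]
      push_cast
      linarith
    simp only [Option.elim]
    rw [mul_comm, ← abs_mul, h1]
    refine (Finset.abs_sum_le_sum_abs _ _).trans (le_trans ?_ hsum)
    refine Finset.sum_le_sum fun i _ => ?_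
    rw [abs_mul]
    exact mul_le_mul_of_nonneg_right (hdiff i) (abs_nonneg _)

namespace WeightedCurve

variable {ι : Type*} [Fintype ι] (c : WeightedCurve ι)

/-- Good simultaneous approximations to a point without short vectors have large denominator. -/
theorem eq_zero_of_noShort {δ β y e : ℝ} {k : ℕ} (hβ : 0 ≤ β) (hδ : 0 < δ) (hδ1 : δ ≤ 1)
    (he : 0 ≤ e)
    (he1 : 5 * Fintype.card ι * (2 / δ) ^ Fintype.card ι * Real.exp β * e ≤ 1)
    (hE : ∀ j : ℕ, 1 ≤ j → j ≤ k → c.NoShort δ (β * j) y) {q : ℤ} {p : ι → ℤ}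
    (hq : 5 * |(q : ℝ)| < (δ / 2) ^ Fintype.card ι * Real.exp (β * k))
    (hp : ∀ i, |q * c.val i y - p i| ≤ e * Real.exp (-(c.wt i * (β * k)))) : q = 0 := by
  classical
  by_contra hq0
  set n := Fintype.card ι with hn
  have hn1 : (1 : ℝ) ≤ n := by
    have : Nonempty ι := ⟨c.top⟩
    exact_mod_cast Fintype.card_pos
  have hq1 : (1 : ℝ) ≤ |(q : ℝ)| := by exact_mod_cast Int.one_le_abs hq0
  have hex : ∃ j : ℕ, 5 * |(q : ℝ)| < (δ / 2) ^ n * Real.exp (β * j) := ⟨k, hq⟩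
  set j := Nat.find hex with hj
  have hjP : 5 * |(q : ℝ)| < (δ / 2) ^ n * Real.exp (β * j) := Nat.find_spec hex
  have hjk : j ≤ k := Nat.find_min' hex hq
  have hδn : (δ / 2) ^ n ≤ 1 := pow_le_one₀ (by positivity) (by linarith)
  have hj1 : 1 ≤ j := by
    by_contra h0
    have h0' : j = 0 := by omega
    rw [h0'] at hjP
    simp at hjP
    linarith
  have hjpred : (δ / 2) ^ n * Real.exp (β * ((j : ℝ) - 1)) ≤ 5 * |(q : ℝ)| := by
    have := Nat.find_min hex (m := j - 1) (by omega)
    rw [Nat.cast_sub hj1] at this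
    push_cast at this
    exact not_lt.1 this
  have hjexp : Real.exp (β * j) ≤ 5 * |(q : ℝ)| * (2 / δ) ^ n * Real.exp β := by
    have h1 : Real.exp (β * j) = (2 / δ) ^ n * ((δ / 2) ^ n * Real.exp (β * ((j : ℝ) - 1))) *
        Real.exp β := by
      rw [← mul_assoc, ← mul_pow]
      have : 2 / δ * (δ / 2) = 1 := by field_simp
      rw [this, one_pow, one_mul, ← Real.exp_add]
      congr 1; ring
    rw [h1]
    calc _ ≤ (2 / δ) ^ n * (5 * |(q : ℝ)|) * Real.exp β := by gcongr
      _ = _ := by ring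
  have hEbd : (n : ℝ) * (δ / 2 * e) ≤ 1 := by
    have h1 : (1 : ℝ) ≤ (2 / δ) ^ n := one_le_pow₀ (by rw [le_div_iff₀ hδ]; linarith)
    have h2 : 1 ≤ Real.exp β := Real.one_le_exp hβ
    refine le_trans ?_ he1
    calc (n : ℝ) * (δ / 2 * e) ≤ n * (1 * e) := by gcongr; linarith
      _ = 1 * n * 1 * 1 * e := by ring
      _ ≤ 5 * n * (2 / δ) ^ n * Real.exp β * e := by gcongr; norm_num
  obtain ⟨v, hv0, hv, hvF⟩ := exists_dual_form_vector (fun i => c.val i y) hq0 p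
    (T := fun i => δ / 2 * Real.exp (c.wt i * (β * j))) (fun i => by positivity) (by
      rw [Finset.prod_mul_distrib, Finset.prod_const, Finset.card_univ, ← Real.exp_sum,
        ← Finset.sum_mul, c.wt_sum, one_mul]
      exact hjP) hEbd (by
      calc ∑ i, δ / 2 * Real.exp (c.wt i * (β * j)) * |q * c.val i y - p i|
          ≤ ∑ _i : ι, δ / 2 * e := by
            refine Finset.sum_le_sum fun i _ => ?_
            calc _ ≤ δ / 2 * Real.exp (c.wt i * (β * j)) *
                  (e * Real.exp (-(c.wt i * (β * k)))) := by gcongr; exact hp i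
              _ = δ / 2 * e * (Real.exp (c.wt i * (β * j)) * Real.exp (-(c.wt i * (β * k)))) := by
                  ring
              _ ≤ δ / 2 * e * 1 := by
                  gcongr
                  rw [← Real.exp_add, Real.exp_le_one_iff]
                  have h1 : (j : ℝ) ≤ k := by exact_mod_cast hjk
                  have h2 := mul_le_mul_of_nonneg_left (mul_le_mul_of_nonneg_left h1 hβ)
                    (c.wt_pos i).le
                  linarith
              _ = _ := mul_one _
        _ = n * (δ / 2 * e) := by simp [hn])
  refine hE j hj1 hjk v hv0 ⟨?_, fun i => (hv i).trans_lt ?_⟩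
  · have h1 : |c.F₀ (fun j => v j) y| * |(q : ℝ)| ≤ n * (δ / 2 * e) := hvF
    have h2 : n * (δ / 2 * e) * Real.exp (β * j) ≤ δ / 2 * |(q : ℝ)| := by
      calc _ ≤ n * (δ / 2 * e) * (5 * |(q : ℝ)| * (2 / δ) ^ n * Real.exp β) := by gcongr
        _ = δ / 2 * |(q : ℝ)| * (5 * n * (2 / δ) ^ n * Real.exp β * e) := by ring
        _ ≤ δ / 2 * |(q : ℝ)| * 1 := by gcongr
        _ = _ := mul_one _
    rw [Real.exp_neg, ← div_eq_mul_inv, lt_div_iff₀ (Real.exp_pos _)]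
    have h3 : |c.F₀ (fun j => v j) y| * Real.exp (β * j) * |(q : ℝ)| ≤ δ / 2 * |(q : ℝ)| := by
      calc _ = |c.F₀ (fun j => v j) y| * |(q : ℝ)| * Real.exp (β * j) := by ring
        _ ≤ _ := (mul_le_mul_of_nonneg_right h1 (Real.exp_pos _).le).trans h2
    have h4 := le_of_mul_le_mul_right h3 (by linarith)
    linarith
  · have : 0 < Real.exp (c.wt i * (β * j)) := Real.exp_pos _
    nlinarith

theorem abs_val_sub_le (i : ι) {x y : ℝ} (hx : x ∈ Metric.ball c.center c.rad)
    (hy : y ∈ Metric.ball c.center c.rad) : |c.val i y - c.val i x| ≤ c.K * |y - x| := by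
  have := (convex_ball c.center c.rad).norm_image_sub_le_of_norm_hasDerivWithin_le
    (f := c.val i) (f' := c.vel i) (C := c.K)
    (fun u hu => (c.hasDerivAt_val i u hu).hasDerivWithinAt)
    (fun u hu => by rw [Real.norm_eq_abs]; exact c.abs_vel_le i u hu) hx hy
  simpa [Real.norm_eq_abs] using this

theorem κ_mul_abs_sub_le {x y : ℝ} (hx : x ∈ Metric.ball c.center c.rad)
    (hy : y ∈ Metric.ball c.center c.rad) :
    c.κ * |y - x| ≤ |c.val c.top y - c.val c.top x| := by
  wlog hxy : x < y generalizing x y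
  · rcases eq_or_lt_of_le (not_lt.1 hxy) with h | h
    · simp [h]
    · rw [abs_sub_comm y x, abs_sub_comm (c.val c.top y)]
      exact this hy hx h
  have hsub : Icc x y ⊆ Metric.ball c.center c.rad := by
    rw [← segment_eq_Icc hxy.le]
    exact (convex_ball _ _).segment_subset hx hy
  obtain ⟨ξ, hξ, hξe⟩ := exists_hasDerivAt_eq_slope (c.val c.top) (c.vel c.top) hxy
    (fun u hu => (c.hasDerivAt_val _ u (hsub hu)).continuousAt.continuousWithinAt)
    (fun u hu => c.hasDerivAt_val _ u (hsub (Ioo_subset_Icc_self hu)))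
  have h1 := c.κ_le_vel ξ (hsub (Ioo_subset_Icc_self hξ))
  rw [hξe, abs_div, le_div_iff₀ (abs_pos.2 (by linarith))] at h1
  exact h1

/-- `z` admits an inhomogeneous approximation with denominator in the window of generation `k`. -/
def Approximable (θ : ι → ℝ → ℝ) (β k z : ℝ) : Prop :=
  ∃ (q : ℤ) (p : ι → ℤ), Real.exp (β * (k - 3)) ≤ |(q : ℝ)| ∧ |(q : ℝ)| ≤ Real.exp (β * (k - 2)) ∧
    ∀ i, |q * c.val i z - θ i z - p i| ≤ Real.exp (-(6 * β)) * Real.exp (-(c.wt i * (β * k)))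

set_option maxHeartbeats 800000 in
theorem abs_sub_lt_of_approximable {θ : ι → ℝ → ℝ} {d ρ₀ η : ℝ} (hd : 0 ≤ d)
    (hθ : ∀ i, ∀ x ∈ Metric.ball c.center c.rad, ∀ y ∈ Metric.ball c.center c.rad,
      |θ i x - θ i y| ≤ d * |x - y|) (hρ₀ : 0 < ρ₀) (hρ₀1 : ρ₀ ≤ 1) (hη : 0 ≤ η)
    (hηn : Fintype.card ι * η ≤ 1 / 2) :
    ∃ β₁ : ℝ, ∀ β, β₁ ≤ β → ∀ k : ℕ, 4 ≤ k → ∀ y ∈ Metric.ball c.center c.rad,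
      (∀ j : ℕ, 1 ≤ j → j ≤ k → c.NoShort (Real.exp (-(η * β))) (β * j) y) →
      ∀ z ∈ Metric.ball c.center c.rad, ∀ z' ∈ Metric.ball c.center c.rad,
      |z - y| ≤ 2 * c.radius ρ₀ β k → |z' - y| ≤ 2 * c.radius ρ₀ β k →
      c.Approximable θ β k z → c.Approximable θ β k z' → |z - z'| < c.radius ρ₀ β (k + 1) := by
  set n := Fintype.card ι with hn
  set C := 2 * (1 + 2 * c.K + 2 * d) with hC
  have hK := c.one_le_K
  have hC1 : 1 ≤ C := by linarith
  have hκ := c.κ_pos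
  have hr₁ := c.wt_pos c.top
  have hr₁1 := c.wt_le_one c.top
  obtain ⟨β₁, hβ₁⟩ : ∃ β₁ : ℝ, ∀ β, β₁ ≤ β → 5 * n * 2 ^ n * C * Real.exp (-(β / 2)) ≤ 1 ∧
      C * Real.exp (-(β / 2)) ≤ 1 / 2 ∧
      10 * 2 ^ n * Real.exp (-(β / 2)) ≤ 1 / 2 ∧ 2 * d * Real.exp (-(β / 2)) ≤ c.κ ∧
      4 * Real.exp (-(β / 2)) ≤ c.κ * ρ₀ / 2 := by
    have h1 : ∀ {C e : ℝ}, 0 < e → ∀ᶠ β in atTop, C * Real.exp (-(β / 2)) ≤ e := by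
      intro C e he
      have h2 : Tendsto (fun β : ℝ => C * Real.exp (-(β / 2))) atTop (nhds (C * 0)) :=
        (Real.tendsto_exp_neg_atTop_nhds_zero.comp
          (tendsto_id.atTop_div_const two_pos)).const_mul C
      rw [mul_zero] at h2
      exact (h2.eventually_lt_const he).mono fun _ h => h.le
    exact eventually_atTop.1 ((h1 one_pos).and ((h1 one_half_pos).and ((h1 one_half_pos).and
      ((h1 hκ).and (h1 (by positivity))))))
  refine ⟨max β₁ 0, fun β hβ k hk y hy hE z hz z' hz' hzy hzy' hA hA' => ?_⟩
  have hβ0 : 0 ≤ β := (le_max_right _ _).trans hβ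
  obtain ⟨b1, b2, b3, b4, b5⟩ := hβ₁ β ((le_max_left _ _).trans hβ)
  have hk4 : (4 : ℝ) ≤ k := by exact_mod_cast hk
  have hle : ∀ {a b : ℝ}, a ≤ b → Real.exp a ≤ Real.exp b := fun h => Real.exp_le_exp.2 h
  set t := β * k with ht
  have ht4 : 4 * β ≤ t := by rw [ht]; nlinarith
  have hrad : c.radius ρ₀ β k ≤ Real.exp (-((1 + c.wt c.top) * t)) := by
    unfold radius
    exact mul_le_of_le_one_left (Real.exp_pos _).le hρ₀1
  have key : ∀ {q : ℤ} {p : ι → ℤ} {w : ℝ}, w ∈ Metric.ball c.center c.rad →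
      |w - y| ≤ 2 * c.radius ρ₀ β k → |(q : ℝ)| ≤ Real.exp (β * (k - 2)) →
      (∀ i, |q * c.val i w - θ i w - p i| ≤
        Real.exp (-(6 * β)) * Real.exp (-(c.wt i * t))) →
      ∀ i, |q * c.val i y - θ i y - p i| ≤
        C / 2 * Real.exp (-(2 * β)) * Real.exp (-(c.wt i * t)) := by
    intro q p w hw hwy hq h i
    have h1 := c.abs_val_sub_le i hy hw
    have h2 := hθ i w hw y hy
    have hwi := c.wt_le_top i
    have e1 : Real.exp (-(6 * β)) * Real.exp (-(c.wt i * t)) ≤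
        Real.exp (-(2 * β)) * Real.exp (-(c.wt i * t)) := by
      gcongr; norm_num
    have e2 : Real.exp (β * (k - 2)) * Real.exp (-((1 + c.wt c.top) * t)) ≤
        Real.exp (-(2 * β)) * Real.exp (-(c.wt i * t)) := by
      rw [← Real.exp_add, ← Real.exp_add]
      refine hle ?_
      have : 0 ≤ (c.wt c.top - c.wt i) * t := mul_nonneg (by linarith) (by linarith)
      have : β * (k - 2) = t - 2 * β := by rw [ht]; ring
      nlinarith
    have e3 : Real.exp (-((1 + c.wt c.top) * t)) ≤
        Real.exp (-(2 * β)) * Real.exp (-(c.wt i * t)) := by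
      refine le_trans ?_ e2
      refine le_mul_of_one_le_left (Real.exp_pos _).le (Real.one_le_exp ?_)
      exact mul_nonneg hβ0 (by linarith)
    set X := Real.exp (-(2 * β)) * Real.exp (-(c.wt i * t)) with hX
    have e4 : |(q : ℝ) * c.val i w - q * c.val i y| ≤ c.K * (2 * X) := by
      rw [← mul_sub, abs_mul]
      calc _ ≤ Real.exp (β * (k - 2)) * (c.K * (2 * Real.exp (-((1 + c.wt c.top) * t)))) := by
            refine mul_le_mul hq (h1.trans ?_) (abs_nonneg _) (Real.exp_pos _).le
            exact mul_le_mul_of_nonneg_left (hwy.trans (by linarith)) c.K_nonneg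
        _ = c.K * (2 * (Real.exp (β * (k - 2)) * Real.exp (-((1 + c.wt c.top) * t)))) := by ring
        _ ≤ _ := by
            have := c.K_nonneg
            gcongr
    have e5 : |θ i w - θ i y| ≤ d * (2 * X) :=
      h2.trans (mul_le_mul_of_nonneg_left (hwy.trans (by linarith)) hd)
    have e6 : q * c.val i y - θ i y - p i = (q * c.val i w - θ i w - p i) -
        (q * c.val i w - q * c.val i y) + (θ i w - θ i y) := by ring
    rw [e6]
    refine (abs_add_le _ _).trans ?_
    have e7 := abs_sub (q * c.val i w - θ i w - p i) (q * c.val i w - q * c.val i y)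
    have e8 := (h i).trans e1
    have e9 : C / 2 * Real.exp (-(2 * β)) * Real.exp (-(c.wt i * t)) =
        X + 2 * c.K * X + 2 * d * X := by rw [hX, hC]; ring
    rw [e9]
    linarith
  obtain ⟨q, p, hq3, hq2, hp⟩ := hA
  obtain ⟨q', p', hq3', hq2', hp'⟩ := hA'
  have h1 := key hz hzy hq2 hp
  have h2 := key hz' hzy' hq2' hp'
  have hdiff : ∀ i, |((q - q' : ℤ) : ℝ) * c.val i y - ((p i - p' i : ℤ) : ℝ)| ≤
      C * Real.exp (-(2 * β)) * Real.exp (-(c.wt i * t)) := by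
    intro i
    have : ((q - q' : ℤ) : ℝ) * c.val i y - ((p i - p' i : ℤ) : ℝ) =
        (q * c.val i y - θ i y - p i) - (q' * c.val i y - θ i y - p' i) := by push_cast; ring
    rw [this]
    refine (abs_sub _ _).trans ?_
    linarith [h1 i, h2 i]
  have hsmall : ∀ {s : ℝ}, 0 ≤ s → Real.exp (-(β / 2)) * Real.exp (-(s * β)) ≤
      Real.exp (-(β / 2)) := fun hs =>
    mul_le_of_le_one_right (Real.exp_pos _).le (Real.exp_le_one_iff.2 (by
      have := mul_nonneg hs hβ0; linarith))
  have hδn : (2 / Real.exp (-(η * β))) ^ n ≤ 2 ^ n * Real.exp (β / 2) := by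
    rw [div_pow, div_eq_mul_inv, ← Real.exp_nat_mul, ← Real.exp_neg]
    gcongr
    nlinarith
  have hδn' : (1 / 2) ^ n * Real.exp (-(β / 2)) ≤ (Real.exp (-(η * β)) / 2) ^ n := by
    rw [div_pow (Real.exp _), ← Real.exp_nat_mul, one_div, inv_pow, div_eq_inv_mul (Real.exp _)]
    gcongr
    nlinarith
  have hqq : q - q' = 0 := by
    refine c.eq_zero_of_noShort (p := fun i => p i - p' i) (e := C * Real.exp (-(2 * β)))
      hβ0 (Real.exp_pos _) (Real.exp_le_one_iff.2 (by
        have := mul_nonneg hη hβ0; linarith)) (by positivity) ?_ hE ?_ hdiff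
    · calc 5 * n * (2 / Real.exp (-(η * β))) ^ n * Real.exp β * (C * Real.exp (-(2 * β)))
          ≤ 5 * n * (2 ^ n * Real.exp (β / 2)) * Real.exp β * (C * Real.exp (-(2 * β))) := by
            gcongr
        _ = 5 * n * 2 ^ n * C * (Real.exp (β / 2) * Real.exp β * Real.exp (-(2 * β))) := by ring
        _ = 5 * n * 2 ^ n * C * Real.exp (-(β / 2)) := by
            rw [← Real.exp_add, ← Real.exp_add]; congr 2; ring
        _ ≤ 1 := b1
    · have h3 : |((q - q' : ℤ) : ℝ)| ≤ 2 * Real.exp (β * (k - 2)) := by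
        push_cast
        exact (abs_sub _ _).trans (by linarith)
      have h4 : 10 * Real.exp (β * (k - 2)) * 2 ^ n <
          Real.exp (-(β / 2)) * Real.exp (β * k) := by
        have h5 : Real.exp (β * (k - 2)) =
            Real.exp (-(β / 2)) * Real.exp (-(1 * β)) *
              (Real.exp (-(β / 2)) * Real.exp (β * k)) := by
          rw [← Real.exp_add, ← Real.exp_add, ← Real.exp_add]; congr 1; ring
        have h6 := hsmall (s := 1) zero_le_one
        rw [h5]
        have h7 : 0 < Real.exp (-(β / 2)) * Real.exp (β * k) := by positivity
        have h8 : 10 * (Real.exp (-(β / 2)) * Real.exp (-(1 * β))) * 2 ^ n ≤ 1 / 2 := by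
          refine le_trans ?_ b3
          calc _ ≤ 10 * Real.exp (-(β / 2)) * 2 ^ n := by gcongr
            _ = _ := by ring
        nlinarith
      have h5 : (2 : ℝ) ^ n * (1 / 2) ^ n = 1 := by rw [← mul_pow]; norm_num
      calc 5 * |((q - q' : ℤ) : ℝ)| ≤ 10 * Real.exp (β * (k - 2)) * 2 ^ n * (1 / 2) ^ n := by
            rw [mul_assoc, h5]; linarith
        _ < Real.exp (-(β / 2)) * Real.exp (β * k) * (1 / 2) ^ n :=
            mul_lt_mul_of_pos_right h4 (by positivity)
        _ = (1 / 2) ^ n * Real.exp (-(β / 2)) * Real.exp (β * k) := by ring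
        _ ≤ _ := by gcongr
  have hqq' : q = q' := by omega
  subst hqq'
  have hpp : ∀ i, p i = p' i := by
    intro i
    have h3 := hdiff i
    rw [sub_self, Int.cast_zero, zero_mul, zero_sub, abs_neg] at h3
    have h4 : |((p i - p' i : ℤ) : ℝ)| < 1 := by
      refine h3.trans_lt ?_
      have h5 : Real.exp (-(2 * β)) * Real.exp (-(c.wt i * t)) ≤ Real.exp (-(β / 2)) := by
        rw [← Real.exp_add]
        refine hle ?_
        have := mul_nonneg (c.wt_pos i).le (by linarith : 0 ≤ t)
        linarith
      calc _ = C * (Real.exp (-(2 * β)) * Real.exp (-(c.wt i * t))) := by ring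
        _ ≤ C * Real.exp (-(β / 2)) := by gcongr
        _ < 1 := by linarith
    have h5 : |p i - p' i| < 1 := by exact_mod_cast h4
    rw [Int.abs_lt_one_iff] at h5
    omega
  have h3 : (|(q : ℝ)| * c.κ - d) * |z - z'| ≤
      2 * (Real.exp (-(6 * β)) * Real.exp (-(c.wt c.top * t))) := by
    have h4 := c.κ_mul_abs_sub_le hz' hz
    have h5 := hθ c.top z hz z' hz'
    have h6 : |(q : ℝ)| * |c.val c.top z - c.val c.top z'| ≤
        2 * (Real.exp (-(6 * β)) * Real.exp (-(c.wt c.top * t))) + |θ c.top z - θ c.top z'| := by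
      rw [← abs_mul]
      have h7 : q * (c.val c.top z - c.val c.top z') =
          (q * c.val c.top z - θ c.top z - p c.top) -
          (q * c.val c.top z' - θ c.top z' - p' c.top) + (θ c.top z - θ c.top z') := by
        rw [hpp]; ring
      rw [h7]
      refine (abs_add_le _ _).trans ?_
      have := abs_sub (q * c.val c.top z - θ c.top z - p c.top)
        (q * c.val c.top z' - θ c.top z' - p' c.top)
      linarith [hp c.top, hp' c.top]
    have h7 := mul_le_mul_of_nonneg_left h4 (abs_nonneg (q : ℝ))
    linarith
  have hexpd : 2 * d ≤ c.κ * Real.exp (β * (k - 3)) := by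
    have h4 : 2 * d = 2 * d * Real.exp (-(β / 2)) * Real.exp (β / 2) := by
      rw [mul_assoc _ (Real.exp _), ← Real.exp_add, neg_add_cancel, Real.exp_zero, mul_one]
    rw [h4]
    refine mul_le_mul b4 (hle ?_) (Real.exp_pos _).le hκ.le
    nlinarith
  have h4 : c.κ / 2 * Real.exp (β * (k - 3)) * |z - z'| ≤
      2 * (Real.exp (-(6 * β)) * Real.exp (-(c.wt c.top * t))) := by
    refine le_trans (mul_le_mul_of_nonneg_right ?_ (abs_nonneg _)) h3
    have := mul_le_mul_of_nonneg_right hq3 hκ.le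
    linarith
  have h5 : c.κ * |z - z'| ≤ 4 * (Real.exp (-(6 * β)) * Real.exp (-(c.wt c.top * t)) *
      Real.exp (-(β * (k - 3)))) := by
    have h6 : Real.exp (β * (k - 3)) * Real.exp (-(β * (k - 3))) = 1 := by
      rw [← Real.exp_add, add_neg_cancel, Real.exp_zero]
    have := mul_le_mul_of_nonneg_right h4 (Real.exp_pos (-(β * (k - 3)))).le
    calc c.κ * |z - z'| = 2 * (c.κ / 2 * Real.exp (β * (k - 3)) * |z - z'| *
          Real.exp (-(β * (k - 3)))) := by
          rw [show c.κ / 2 * Real.exp (β * (k - 3)) * |z - z'| * Real.exp (-(β * (k - 3))) =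
            c.κ / 2 * |z - z'| * (Real.exp (β * (k - 3)) * Real.exp (-(β * (k - 3)))) by ring, h6]
          ring
      _ ≤ _ := by linarith
  have h6 : Real.exp (-(6 * β)) * Real.exp (-(c.wt c.top * t)) * Real.exp (-(β * (k - 3))) ≤
      Real.exp (-(β / 2)) * Real.exp (-((1 + c.wt c.top) * (β * (k + 1)))) := by
    rw [← Real.exp_add, ← Real.exp_add, ← Real.exp_add]
    refine hle ?_
    have : c.wt c.top * β ≤ β := mul_le_of_le_one_left hβ0 hr₁1
    have e1 : -((1 + c.wt c.top) * (β * (k + 1))) = -t - c.wt c.top * t - β - c.wt c.top * β := by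
      rw [ht]; ring
    have e2 : -(β * (k - 3)) = -t + 3 * β := by rw [ht]; ring
    rw [e1, e2]
    linarith
  have h7 : 0 < Real.exp (-((1 + c.wt c.top) * (β * (k + 1)))) := Real.exp_pos _
  unfold radius
  have h8 : c.κ * |z - z'| < c.κ * (ρ₀ * Real.exp (-((1 + c.wt c.top) * (β * (k + 1))))) := by
    have h9 := mul_le_mul_of_nonneg_right b5 h7.le
    have h10 : 0 < c.κ * ρ₀ * Real.exp (-((1 + c.wt c.top) * (β * (k + 1)))) := by positivity
    nlinarith
  exact lt_of_mul_lt_mul_left h8 hκ.le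

end WeightedCurve

theorem half_mul_le_of_recurrence {N : ℕ → ℝ} {M A θ Q B : ℝ} (hM : 4 ≤ M) (hA : 0 ≤ A)
    (hθ : 0 ≤ θ) (hQ0 : 0 ≤ Q) (hQ : Q ≤ M * B) (hB : 1 ≤ 2 * B)
    (hq : (2 * B) ^ 2 * θ ≤ 1 / 2) (hAq : A * ((2 * B) ^ 2 * θ) ≤ 1 / 12) (h0 : N 0 = 1)
    (hrec : ∀ k, M * N k ≤ N (k + 1) + N k +
      ∑ m ∈ Finset.Icc 1 ((k + 1) / 2), A * (θ * Q) ^ m * N (k + 1 - m) +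
      A * θ ^ ((k + 1) / 2 + 1) * Q ^ (k + 1)) :
    ∀ k, 0 < N k ∧ M / 2 * N k ≤ N (k + 1) := by
  set q := (2 * B) ^ 2 * θ with hqdef
  have hq0 : 0 ≤ q := by positivity
  have hB0 : 0 < B := by linarith
  have hM0 : 0 < M := by linarith
  intro k
  induction k using Nat.strong_induction_on with
  | _ k ih =>
  have hpos : ∀ j ≤ k, 0 < N j := by
    intro j hj
    rcases Nat.eq_zero_or_pos j with h | h
    · rw [h, h0]; exact one_pos
    · obtain ⟨i, rfl⟩ := Nat.exists_eq_succ_of_ne_zero h.ne'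
      have h1 := ih i (by omega)
      have : 0 < M / 2 * N i := mul_pos (by linarith) h1.1
      exact this.trans_le h1.2
  have hback : ∀ j ≤ k, (M / 2) ^ j * N (k - j) ≤ N k := by
    intro j
    induction j with
    | zero => intro _; simp
    | succ j ihj =>
      intro hj
      have h1 := (ih (k - (j + 1)) (by omega)).2
      rw [show k - (j + 1) + 1 = k - j by omega] at h1
      refine le_trans ?_ (ihj (by omega))
      rw [pow_succ, mul_assoc]
      exact mul_le_mul_of_nonneg_left h1 (by positivity)
  have hNk := hpos k le_rfl
  refine ⟨hNk, ?_⟩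
  set h := (k + 1) / 2 with hh
  have hpowB : ∀ {i m : ℕ}, i ≤ 2 * m → (2 * B) ^ i * θ ^ m ≤ q ^ m := by
    intro i m him
    rw [hqdef, mul_pow ((2 * B) ^ 2), ← pow_mul]
    exact mul_le_mul_of_nonneg_right (pow_le_pow_right₀ hB him) (by positivity)
  have hterm : ∀ m ∈ Finset.Icc 1 h, A * (θ * Q) ^ m * N (k + 1 - m) ≤
      A * (M / 2) * N k * q ^ m := by
    intro m hm
    obtain ⟨hm1, hmh⟩ := Finset.mem_Icc.1 hm
    obtain ⟨j, rfl⟩ := Nat.exists_eq_add_of_le' hm1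
    have h1 := hback j (by omega)
    rw [show k + 1 - (j + 1) = k - j by omega]
    have h2 : (θ * Q) ^ (j + 1) ≤ q ^ (j + 1) * (M / 2) ^ (j + 1) := by
      rw [← mul_pow]
      refine pow_le_pow_left₀ (by positivity) ?_ _
      have h3 := hpowB (i := 1) (m := 1) (by norm_num)
      rw [pow_one, pow_one, pow_one] at h3
      calc θ * Q ≤ θ * (M * B) := by gcongr
        _ = 2 * B * θ * (M / 2) := by ring
        _ ≤ _ := by gcongr
    have h4 := (hpos (k - j) (by omega)).le
    calc A * (θ * Q) ^ (j + 1) * N (k - j)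
        ≤ A * (q ^ (j + 1) * (M / 2) ^ (j + 1)) * N (k - j) := by gcongr
      _ = A * (M / 2) * q ^ (j + 1) * ((M / 2) ^ j * N (k - j)) := by ring
      _ ≤ A * (M / 2) * q ^ (j + 1) * N k := by gcongr
      _ = _ := by ring
  have hlast : A * θ ^ (h + 1) * Q ^ (k + 1) ≤ A * (M / 2) * N k * q ^ (h + 1) := by
    have h1 := hback k le_rfl
    rw [Nat.sub_self, h0, mul_one] at h1
    have h2 := hpowB (i := k + 1) (m := h + 1) (by omega)
    calc A * θ ^ (h + 1) * Q ^ (k + 1) ≤ A * θ ^ (h + 1) * (M * B) ^ (k + 1) := by gcongr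
      _ = A * ((2 * B) ^ (k + 1) * θ ^ (h + 1)) * ((M / 2) * (M / 2) ^ k) := by
          rw [show M * B = 2 * B * (M / 2) by ring, mul_pow, pow_succ (M / 2)]; ring
      _ ≤ A * q ^ (h + 1) * ((M / 2) * N k) := by gcongr
      _ = _ := by ring
  have hgeom : ∀ h : ℕ, ∑ m ∈ Finset.Icc 1 h, q ^ m + q ^ (h + 1) + q ^ (h + 1) ≤ 2 * q := by
    intro h
    induction h with
    | zero => simp; linarith
    | succ h ihh =>
      rw [Finset.sum_Icc_succ_top (by omega)]
      have : q ^ (h + 1 + 1) ≤ q ^ (h + 1) * (1 / 2) := by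
        rw [pow_succ]; exact mul_le_mul_of_nonneg_left hq (by positivity)
      linarith
  have hsum : ∑ m ∈ Finset.Icc 1 h, A * (θ * Q) ^ m * N (k + 1 - m) +
      A * θ ^ (h + 1) * Q ^ (k + 1) ≤ M / 12 * N k := by
    calc _ ≤ ∑ m ∈ Finset.Icc 1 h, A * (M / 2) * N k * q ^ m +
          A * (M / 2) * N k * q ^ (h + 1) := add_le_add (Finset.sum_le_sum hterm) hlast
      _ = A * (M / 2) * N k * (∑ m ∈ Finset.Icc 1 h, q ^ m + q ^ (h + 1)) := by
          rw [← Finset.mul_sum]; ring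
      _ ≤ A * (M / 2) * N k * (2 * q) := by
          have h1 := hgeom h
          have h2 : 0 ≤ q ^ (h + 1) := by positivity
          gcongr
          linarith
      _ = M * N k * (A * q) := by ring
      _ ≤ M * N k * (1 / 12) := by gcongr
      _ = _ := by ring
  have h1 := hrec k
  have h2 : 4 * N k ≤ M * N k := mul_le_mul_of_nonneg_right hM hNk.le
  linarith

/-- In an Ahlfors regular set every ball contains many separated points of the set. -/
theorem exists_separated_card_eq {μ : Measure ℝ} {X : Set ℝ} (hX0 : μ Xᶜ = 0) {a b α ρm : ℝ}
    (hb : 0 < b)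
    (hlow : ∀ x ∈ X, ∀ ρ, 0 < ρ → ρ ≤ ρm → ENNReal.ofReal (a * ρ ^ α) ≤ μ (Metric.ball x ρ))
    (hup : ∀ x ∈ X, ∀ ρ, 0 < ρ → ρ ≤ ρm → μ (Metric.ball x ρ) ≤ ENNReal.ofReal (b * ρ ^ α))
    {x : ℝ} (hx : x ∈ X) {ρ τ : ℝ} (hρ : 0 < ρ) (hρm : ρ ≤ ρm) (hτ : 0 < τ) (hτm : τ ≤ ρm)
    {M : ℕ} (hM1 : 1 ≤ M) (hM : ((M : ℝ) - 1) * (b * τ ^ α) < a * ρ ^ α) :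
    ∃ s : Finset ℝ, (s : Set ℝ) ⊆ X ∧ s.card = M ∧ (∀ y ∈ s, |y - x| < ρ) ∧
      ∀ y ∈ s, ∀ y' ∈ s, y ≠ y' → τ ≤ |y - y'| := by
  by_contra hcon
  obtain ⟨s, hsA, -, hsN, hcov⟩ := exists_cover_of_separated_card_le (A := X ∩ Metric.ball x ρ)
    (η := τ) (N := M - 1) (by
      intro s hs hsep
      by_contra hlt
      obtain ⟨s', hs's, hs'M⟩ := Finset.exists_subset_card_eq (show M ≤ s.card by omega)
      exact hcon ⟨s', fun y hy => (hs (hs's hy)).1, hs'M, fun y hy => (hs (hs's hy)).2,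
        fun y hy y' hy' => hsep y (hs's hy) y' (hs's hy')⟩)
  have h1 : μ (Metric.ball x ρ) ≤ μ (⋃ y ∈ s, Metric.ball y τ) := by
    have h2 : Metric.ball x ρ ⊆ (⋃ y ∈ s, Metric.ball y τ) ∪ Xᶜ := by
      intro z hz
      by_cases hzX : z ∈ X
      · left
        obtain ⟨y, hy, hzy⟩ := hcov z ⟨hzX, hz⟩
        refine mem_iUnion₂.2 ⟨y, hy, ?_⟩
        rcases hzy with rfl | h
        · exact Metric.mem_ball_self hτ
        · exact h
      · exact Or.inr hzX
    refine (measure_mono h2).trans ((measure_union_le _ _).trans ?_)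
    rw [hX0, add_zero]
  have hbτ : 0 ≤ b * τ ^ α := by positivity
  have h2 : μ (⋃ y ∈ s, Metric.ball y τ) ≤ ENNReal.ofReal (((M : ℝ) - 1) * (b * τ ^ α)) := by
    refine (measure_biUnion_finset_le _ _).trans ?_
    calc _ ≤ ∑ y ∈ s, ENNReal.ofReal (b * τ ^ α) :=
          Finset.sum_le_sum fun y hy => hup y (hsA hy).1 τ hτ hτm
      _ = ENNReal.ofReal (s.card * (b * τ ^ α)) := by
          rw [Finset.sum_const, nsmul_eq_mul, ENNReal.ofReal_mul (Nat.cast_nonneg _),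
            ENNReal.ofReal_natCast]
      _ ≤ _ := by
          refine ENNReal.ofReal_le_ofReal (mul_le_mul_of_nonneg_right ?_ hbτ)
          have : (s.card : ℝ) ≤ ((M - 1 : ℕ) : ℝ) := by exact_mod_cast hsN
          rwa [Nat.cast_sub hM1, Nat.cast_one] at this
  have h3 := ((hlow x hx ρ hρ hρm).trans h1).trans h2
  have hM0 : (0 : ℝ) ≤ (M : ℝ) - 1 := by
    have : (1 : ℝ) ≤ M := by exact_mod_cast hM1
    linarith
  rw [ENNReal.ofReal_le_ofReal_iff (mul_nonneg hM0 hbτ)] at h3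
  linarith

/-- Points surviving in a nested family of finite sets of balls converge to a point of the set. -/
theorem exists_mem_of_nested {X : Set ℝ} (hX : IsClosed X) {ρ : ℕ → ℝ}
    (hρ : Tendsto ρ atTop (nhds 0)) {S : ℕ → Finset ℝ} (hSX : ∀ k, (S k : Set ℝ) ⊆ X)
    (hne : ∀ k, (S k).Nonempty) (hρ0 : ∀ k, 0 ≤ ρ k)
    (hnest : ∀ k, ∀ x ∈ S (k + 1), ∃ y ∈ S k,
      Metric.closedBall x (ρ (k + 1)) ⊆ Metric.ball y (ρ k)) :
    ∃ x ∈ X, ∀ k, ∃ y ∈ S k, x ∈ Metric.closedBall y (ρ k) := by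
  have hcpt : ∀ k, IsCompact (⋃ y ∈ S k, Metric.closedBall y (ρ k)) := fun k =>
    (S k).isCompact_biUnion fun y _ => isCompact_closedBall y _
  obtain ⟨x, hx⟩ := IsCompact.nonempty_iInter_of_sequence_nonempty_isCompact_isClosed
    (fun k => ⋃ y ∈ S k, Metric.closedBall y (ρ k))
    (fun k z hz => by
      obtain ⟨x, hx, hzx⟩ := mem_iUnion₂.1 hz
      obtain ⟨y, hy, hsub⟩ := hnest k x hx
      exact mem_iUnion₂.2 ⟨y, hy, Metric.ball_subset_closedBall (hsub hzx)⟩)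
    (fun k => by
      obtain ⟨y, hy⟩ := hne k
      exact ⟨y, mem_iUnion₂.2 ⟨y, hy, Metric.mem_closedBall_self (hρ0 k)⟩⟩)
    (hcpt 0) (fun k => (hcpt k).isClosed)
  have hx' : ∀ k, ∃ y ∈ S k, x ∈ Metric.closedBall y (ρ k) := fun k => by
    obtain ⟨y, hy, h⟩ := mem_iUnion₂.1 (mem_iInter.1 hx k)
    exact ⟨y, hy, h⟩
  refine ⟨x, ?_, hx'⟩
  choose y hy hxy using hx'
  refine hX.mem_of_tendsto (f := y) (b := atTop) ?_ (Eventually.of_forall fun k => hSX k (hy k))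
  rw [tendsto_iff_dist_tendsto_zero]
  refine squeeze_zero (fun _ => dist_nonneg) (fun k => ?_) hρ
  rw [dist_comm]
  exact hxy k

/-- A tree of balls centred at points of `X`; at each step the candidates failing `P` are
rejected. -/
theorem exists_tree {X : Set ℝ} {x₀ : ℝ} (hx₀ : x₀ ∈ X) {ρ : ℕ → ℝ} (hρ : ∀ k, 0 < ρ k)
    (hρ2 : ∀ k, 2 * ρ (k + 1) ≤ ρ k) {M : ℕ}
    (hch : ∀ k, ∀ x ∈ X, ∃ s : Finset ℝ, (s : Set ℝ) ⊆ X ∧ s.card = M ∧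
      (∀ y ∈ s, |y - x| < ρ k / 2) ∧ ∀ y ∈ s, ∀ y' ∈ s, y ≠ y' → 4 * ρ (k + 1) ≤ |y - y'|)
    (P : ℕ → ℝ → Prop) :
    ∃ S T : ℕ → Finset ℝ, S 0 = {x₀} ∧ (∀ k, (S k : Set ℝ) ⊆ X) ∧ (∀ k, (T k : Set ℝ) ⊆ X) ∧
      (∀ k, ∀ x ∈ S (k + 1), P (k + 1) x) ∧ (∀ k, ∀ x ∈ T k, ¬P (k + 1) x) ∧
      (∀ k, ∀ j ≤ k, ∀ x ∈ S (k + 1), ∃ y ∈ S j,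
        Metric.closedBall x (ρ (k + 1)) ⊆ Metric.ball y (ρ j)) ∧
      (∀ k, ∀ j ≤ k, ∀ x ∈ T k, ∃ y ∈ S j,
        Metric.closedBall x (ρ (k + 1)) ⊆ Metric.ball y (ρ j)) ∧
      (∀ k, ∀ x ∈ T k, ∃ y ∈ S k, |x - y| < ρ k / 2) ∧
      (∀ k, ∀ y ∈ S k, ∀ x ∈ T k, ∀ x' ∈ T k, |x - y| < ρ k / 2 → |x' - y| < ρ k / 2 →
        x ≠ x' → 4 * ρ (k + 1) ≤ |x - x'|) ∧
      (∀ k, ∀ x ∈ T k, ∀ x' ∈ T k, x ≠ x' → 2 * ρ (k + 1) ≤ |x - x'|) ∧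
      ∀ k, M * (S k).card = (S (k + 1)).card + (T k).card := by
  classical
  have hch' : ∀ k x, ∃ s : Finset ℝ, x ∈ X → (s : Set ℝ) ⊆ X ∧ s.card = M ∧
      (∀ y ∈ s, |y - x| < ρ k / 2) ∧
      ∀ y ∈ s, ∀ y' ∈ s, y ≠ y' → 4 * ρ (k + 1) ≤ |y - y'| := by
    intro k x
    by_cases hx : x ∈ X
    · obtain ⟨s, hs⟩ := hch k x hx
      exact ⟨s, fun _ => hs⟩
    · exact ⟨∅, fun h => absurd h hx⟩
  choose ch hchs using hch'
  set S : ℕ → Finset ℝ := fun k => Nat.rec {x₀}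
    (fun k s => (s.biUnion (ch k)).filter (P (k + 1))) k with hS
  have hSs : ∀ k, S (k + 1) = ((S k).biUnion (ch k)).filter (P (k + 1)) := fun k => rfl
  set T : ℕ → Finset ℝ := fun k => ((S k).biUnion (ch k)).filter fun x => ¬P (k + 1) x with hT
  have hSX : ∀ k, (S k : Set ℝ) ⊆ X := by
    intro k
    induction k with
    | zero => intro x hx; rw [show x = x₀ from Finset.mem_singleton.1 hx]; exact hx₀
    | succ k ih =>
      intro x hx
      rw [Finset.mem_coe, hSs, Finset.mem_filter, Finset.mem_biUnion] at hx
      obtain ⟨⟨y, hy, hxy⟩, -⟩ := hx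
      exact (hchs k y (ih hy)).1 hxy
  have hCX : ∀ k, ∀ x ∈ (S k).biUnion (ch k), x ∈ X := by
    intro k x hx
    obtain ⟨y, hy, hxy⟩ := Finset.mem_biUnion.1 hx
    exact (hchs k y (hSX k hy)).1 hxy
  have hpar : ∀ k, ∀ x ∈ (S k).biUnion (ch k), ∃ y ∈ S k, x ∈ ch k y ∧ |x - y| < ρ k / 2 := by
    intro k x hx
    obtain ⟨y, hy, hxy⟩ := Finset.mem_biUnion.1 hx
    exact ⟨y, hy, hxy, (hchs k y (hSX k hy)).2.2.1 x hxy⟩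
  have hball : ∀ k x y, |x - y| < ρ k / 2 →
      Metric.closedBall x (ρ (k + 1)) ⊆ Metric.ball y (ρ k) := by
    intro k x y hxy
    refine Metric.closedBall_subset_ball' ?_
    rw [Real.dist_eq]
    linarith [hρ2 k]
  have hSC : ∀ k, ∀ x ∈ S (k + 1), x ∈ (S k).biUnion (ch k) := fun k x hx =>
    (Finset.mem_filter.1 hx).1
  have hanc : ∀ k, ∀ j ≤ k, ∀ x ∈ (S k).biUnion (ch k), ∃ y ∈ S j,
      Metric.closedBall x (ρ (k + 1)) ⊆ Metric.ball y (ρ j) := by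
    intro k
    induction k with
    | zero =>
      intro j hj x hx
      obtain ⟨y, hy, -, h⟩ := hpar 0 x hx
      rw [Nat.le_zero.1 hj]
      exact ⟨y, hy, hball 0 x y h⟩
    | succ k ih =>
      intro j hj x hx
      obtain ⟨y, hy, -, h⟩ := hpar (k + 1) x hx
      rcases Nat.lt_or_ge j (k + 1) with hlt | hge
      · obtain ⟨y', hy', hsub⟩ := ih j (by omega) y (hSC k y hy)
        exact ⟨y', hy', ((hball _ x y h).trans Metric.ball_subset_closedBall).trans hsub⟩
      · rw [show j = k + 1 by omega]
        exact ⟨y, hy, hball _ x y h⟩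
  have hsepC : ∀ k, (∀ x ∈ S k, ∀ x' ∈ S k, x ≠ x' → 2 * ρ k ≤ |x - x'|) →
      ∀ x ∈ (S k).biUnion (ch k), ∀ x' ∈ (S k).biUnion (ch k), x ≠ x' →
        2 * ρ (k + 1) ≤ |x - x'| := by
    intro k hk x hx x' hx' hne
    obtain ⟨y, hy, hxy, h⟩ := hpar k x hx
    obtain ⟨y', hy', hxy', h'⟩ := hpar k x' hx'
    by_cases hyy : y = y'
    · subst hyy
      have := (hchs k y (hSX k hy)).2.2.2 x hxy x' hxy' hne
      linarith [hρ (k + 1)]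
    · have h1 := hk y hy y' hy' hyy
      have h2 := abs_sub_le y x y'
      have h3 := abs_sub_le x x' y'
      rw [abs_sub_comm y x] at h2
      linarith [hρ2 k]
  have hsepS : ∀ k, ∀ x ∈ S k, ∀ x' ∈ S k, x ≠ x' → 2 * ρ k ≤ |x - x'| := by
    intro k
    induction k with
    | zero =>
      intro x hx x' hx' hne
      exact absurd ((Finset.mem_singleton.1 hx).trans (Finset.mem_singleton.1 hx').symm) hne
    | succ k ih =>
      intro x hx x' hx'
      exact hsepC k ih x (hSC k x hx) x' (hSC k x' hx')
  have huniq : ∀ k, ∀ y ∈ S k, ∀ x ∈ (S k).biUnion (ch k), |x - y| < ρ k / 2 → x ∈ ch k y := by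
    intro k y hy x hx hxy
    obtain ⟨y', hy', hxy', h⟩ := hpar k x hx
    by_cases hyy : y = y'
    · rwa [hyy]
    · have h1 := hsepS k y hy y' hy' hyy
      have h2 := abs_sub_le y x y'
      rw [abs_sub_comm y x] at h2
      linarith [hρ k]
  have hTC : ∀ k, ∀ x ∈ T k, x ∈ (S k).biUnion (ch k) := fun k x hx =>
    (Finset.mem_filter.1 hx).1
  refine ⟨S, T, rfl, hSX, fun k x hx => hCX k x (hTC k x hx),
    fun k x hx => (Finset.mem_filter.1 hx).2, fun k x hx => (Finset.mem_filter.1 hx).2,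
    fun k j hj x hx => hanc k j hj x (hSC k x hx), fun k j hj x hx => hanc k j hj x (hTC k x hx),
    fun k x hx => ?_, fun k y hy x hx x' hx' h h' => ?_, fun k x hx x' hx' =>
      hsepC k (hsepS k) x (hTC k x hx) x' (hTC k x' hx'), fun k => ?_⟩
  · obtain ⟨y, hy, -, h⟩ := hpar k x (hTC k x hx)
    exact ⟨y, hy, h⟩
  · exact (hchs k y (hSX k hy)).2.2.2 x (huniq k y hy x (hTC k x hx) h) x'
      (huniq k y hy x' (hTC k x' hx') h')
  · rw [hSs, Finset.card_filter_add_card_filter_not, Finset.card_biUnion,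
      Finset.sum_congr rfl fun y hy => (hchs k y (hSX k hy)).2.1, Finset.sum_const, smul_eq_mul,
      mul_comm]
    intro y hy y' hy' hne
    refine Finset.disjoint_left.2 fun x hx hx' => ?_
    have h1 := (hchs k y (hSX k hy)).2.2.1 x hx
    have h2 := (hchs k y' (hSX k hy')).2.2.1 x hx'
    have h3 := hsepS k y hy y' hy' hne
    have h4 := abs_sub_le y x y'
    rw [abs_sub_comm y x] at h4
    linarith [hρ k]

namespace WeightedCurve

variable {ι : Type*} [Fintype ι] (c : WeightedCurve ι)

/-- The local counting estimate below a ball on whose centre no vector is short. -/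
def LocalCount (X : Set ℝ) (α ρ₀ A η g β : ℝ) : Prop :=
  ∀ k m : ℕ, 1 ≤ m → 2 * m ≤ k → ∀ y ∈ X, |y - c.center| ≤ ρ₀ →
    c.NoShort (Real.exp (-(η * β))) (β * (k - m)) y → ∀ s : Finset ℝ, (s : Set ℝ) ⊆ X →
    (∀ x ∈ s, ∀ x' ∈ s, x ≠ x' → 2 * c.radius ρ₀ β k ≤ |x - x'|) →
    (∀ x ∈ s, Metric.closedBall x (c.radius ρ₀ β k) ⊆
      Metric.ball y (c.radius ρ₀ β (k - m))) →
    (∀ x ∈ s, c.ShortNear (Real.exp (-(η * β))) (β * k) (c.radius ρ₀ β k)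
      (Fintype.card ι * c.K * Real.exp (-(η * β)) *
        Real.exp (c.wt c.top * (β * k) - (m - 1) * (η * β))) x
      (c.largeDeriv (Real.exp (-(η * β)) *
        Real.exp (c.wt c.top * (β * k) - m * (η * β)))
        (Metric.ball y (c.radius ρ₀ β (k - m))))) →
    (s.card : ℝ) ≤ A * Real.exp (-(g * β * m)) * Real.exp ((1 + c.wt c.top) * α * β * m)

/-- The global counting estimate for vectors with small derivative. -/
def GlobalCount (X : Set ℝ) (α ρ₀ A η g β : ℝ) : Prop :=
  ∀ k h : ℕ, 2 * h ≤ k → ∀ s : Finset ℝ, (s : Set ℝ) ⊆ X →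
    (∀ x ∈ s, ∀ x' ∈ s, x ≠ x' → 2 * c.radius ρ₀ β k ≤ |x - x'|) →
    (∀ x ∈ s, Metric.closedBall x (c.radius ρ₀ β k) ⊆ Metric.ball c.center ρ₀) →
    (∀ x ∈ s, c.ShortNear (Real.exp (-(η * β))) (β * k) (c.radius ρ₀ β k)
      (Fintype.card ι * c.K * Real.exp (-(η * β)) *
        Real.exp (c.wt c.top * (β * k) - h * (η * β))) x univ) →
    (s.card : ℝ) ≤
      A * Real.exp (-(g * β * (h + 1))) * Real.exp ((1 + c.wt c.top) * α * β * k)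

theorem radius_zero {ρ₀ β : ℝ} : c.radius ρ₀ β 0 = ρ₀ := by simp [radius]

theorem card_short_le {X : Set ℝ} {α ρ₀ A η g β : ℝ} (hρ₀rad : ρ₀ ≤ c.rad)
    (hβ : 0 ≤ β) (hloc : c.LocalCount X α ρ₀ A η g β) (hglob : c.GlobalCount X α ρ₀ A η g β)
    {S : ℕ → Finset ℝ} (hS0 : S 0 = {c.center}) (hSX : ∀ j, (S j : Set ℝ) ⊆ X) {l : ℕ} (hl : 1 ≤ l)
    (hSc : ∀ j, ∀ y ∈ S j, |y - c.center| ≤ ρ₀)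
    (hSE : ∀ j, 1 ≤ j → ∀ y ∈ S j, c.NoShort (Real.exp (-(η * β))) (β * j) y)
    {T : Finset ℝ} (hTX : (T : Set ℝ) ⊆ X)
    (hsep : ∀ x ∈ T, ∀ x' ∈ T, x ≠ x' → 2 * c.radius ρ₀ β l ≤ |x - x'|)
    (hanc : ∀ j < l, ∀ x ∈ T, ∃ y ∈ S j,
      Metric.closedBall x (c.radius ρ₀ β l) ⊆ Metric.ball y (c.radius ρ₀ β j))
    (hT : ∀ x ∈ T, ∃ z ∈ Metric.closedBall x (c.radius ρ₀ β l),
      ¬c.NoShort (Real.exp (-(η * β))) (β * l) z) :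
    (T.card : ℝ) ≤ ∑ m ∈ Finset.Icc 1 (l / 2),
        A * (Real.exp (-(g * β)) * Real.exp ((1 + c.wt c.top) * α * β)) ^ m * (S (l - m)).card +
      A * Real.exp (-(g * β)) ^ (l / 2 + 1) * Real.exp ((1 + c.wt c.top) * α * β) ^ l := by
  classical
  set δ := Real.exp (-(η * β)) with hδ
  set t := β * (l : ℝ) with ht
  set N : ℝ := Fintype.card ι * c.K with hN
  set r₁ := c.wt c.top with hr₁
  have hN1 : 1 ≤ N := by
    have : Nonempty ι := ⟨c.top⟩
    have h1 : (1 : ℝ) ≤ Fintype.card ι := by exact_mod_cast Fintype.card_pos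
    exact one_le_mul_of_one_le_of_one_le h1 c.one_le_K
  have hδ0 : 0 < δ := Real.exp_pos _
  have ht0 : 0 ≤ t := by positivity
  set Vg := T.filter fun x => c.ShortNear δ t (c.radius ρ₀ β l)
    (N * δ * Real.exp (r₁ * t - (l / 2 : ℕ) * (η * β))) x univ with hVg
  set V : ℕ → ℝ → Finset ℝ := fun m y => T.filter fun x =>
    Metric.closedBall x (c.radius ρ₀ β l) ⊆ Metric.ball y (c.radius ρ₀ β (l - m)) ∧
    c.ShortNear δ t (c.radius ρ₀ β l) (N * δ * Real.exp (r₁ * t - (m - 1) * (η * β))) x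
      (c.largeDeriv (δ * Real.exp (r₁ * t - m * (η * β)))
        (Metric.ball y (c.radius ρ₀ β (l - m)))) with hV
  have hcenter : ∀ x ∈ T, Metric.closedBall x (c.radius ρ₀ β l) ⊆ Metric.ball c.center ρ₀ := by
    intro x hx
    obtain ⟨y, hy, hsub⟩ := hanc 0 (by omega) x hx
    rw [hS0, Finset.mem_singleton] at hy
    rw [hy, Nat.cast_zero, radius_zero] at hsub
    exact hsub
  have hcover : T ⊆ (Finset.Icc 1 (l / 2)).biUnion (fun m => (S (l - m)).biUnion (V m)) ∪ Vg := by
    intro x hx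
    obtain ⟨z, hz, hzE⟩ := hT x hx
    obtain ⟨v, hv0, hv1, hv2⟩ : ∃ v : Option ι → ℤ, v ≠ 0 ∧
        |c.F₀ (fun j => v j) z| < δ * Real.exp (-t) ∧
        ∀ i, |(v (some i) : ℝ)| < δ * Real.exp (c.wt i * t) := by
      unfold NoShort at hzE
      push Not at hzE
      exact hzE
    have hzc : z ∈ Metric.ball c.center c.rad :=
      Metric.ball_subset_ball hρ₀rad (hcenter x hx hz)
    have hf : |c.F₁ (fun j => v j) z| ≤ N * δ * Real.exp (r₁ * t) := by
      have := c.abs_F₁_le (b := fun j => (v j : ℝ)) (M := δ * Real.exp (r₁ * t)) (fun i =>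
        (hv2 i).le.trans (mul_le_mul_of_nonneg_left (Real.exp_le_exp.2
          (mul_le_mul_of_nonneg_right (c.wt_le_top i) ht0)) hδ0.le)) hzc
      rwa [← mul_assoc] at this
    have hNδ : ∀ {u : ℝ}, δ * Real.exp u ≤ N * δ * Real.exp u := fun {u} => by
      rw [mul_assoc]
      exact le_mul_of_one_le_left (by positivity) hN1
    by_cases hex : ∃ m : ℕ, 1 ≤ m ∧ m ≤ l / 2 ∧
        δ * Real.exp (r₁ * t - m * (η * β)) ≤ |c.F₁ (fun j => v j) z|
    · set m := Nat.find hex with hm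
      obtain ⟨hm1, hm2, hm3⟩ := Nat.find_spec hex
      have hml : m < l := by omega
      have hcast : ((l - m : ℕ) : ℝ) = l - m := by rw [Nat.cast_sub hml.le]
      obtain ⟨y, hy, hsub⟩ := hanc (l - m) (by omega) x hx
      rw [hcast] at hsub
      refine Finset.mem_union_left _ (Finset.mem_biUnion.2 ⟨m, Finset.mem_Icc.2 ⟨hm1, hm2⟩,
        Finset.mem_biUnion.2 ⟨y, hy, Finset.mem_filter.2 ⟨hx, hsub, z, hz, v,
          ⟨z, hsub hz, hm3⟩, hv0, hv1.le, fun i => (hv2 i).le, ?_⟩⟩⟩)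
      rcases Nat.lt_or_ge 1 m with h1 | h1
      · have h2 := Nat.find_min hex (m := m - 1) (by omega)
        have h3 : |c.F₁ (fun j => v j) z| < δ * Real.exp (r₁ * t - (m - 1) * (η * β)) := by
          by_contra h4
          refine h2 ⟨by omega, by omega, ?_⟩
          rw [Nat.cast_sub hm1, Nat.cast_one]
          exact not_lt.1 h4
        exact h3.le.trans hNδ
      · have h2 : (m : ℝ) = 1 := by
          have : m = 1 := by omega
          exact_mod_cast this
        rw [h2]
        simpa using hf
    · refine Finset.mem_union_right _ (Finset.mem_filter.2 ⟨hx, z, hz, v, mem_univ _, hv0, hv1.le,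
        fun i => (hv2 i).le, ?_⟩)
      rcases Nat.eq_zero_or_pos (l / 2) with h1 | h1
      · rw [h1]
        simpa using hf
      · have h2 : ¬ δ * Real.exp (r₁ * t - (l / 2 : ℕ) * (η * β)) ≤ |c.F₁ (fun j => v j) z| :=
          fun h => hex ⟨l / 2, h1, le_rfl, h⟩
        exact (not_le.1 h2).le.trans hNδ
  have hVcard : ∀ m ∈ Finset.Icc 1 (l / 2), ∀ y ∈ S (l - m), ((V m y).card : ℝ) ≤
      A * (Real.exp (-(g * β)) * Real.exp ((1 + r₁) * α * β)) ^ m := by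
    intro m hm y hy
    obtain ⟨hm1, hm2⟩ := Finset.mem_Icc.1 hm
    have hcast : ((l - m : ℕ) : ℝ) = l - m := by rw [Nat.cast_sub (by omega)]
    have hE := hSE (l - m) (by omega) y hy
    rw [hcast] at hE
    have := hloc l m hm1 (by omega) y (hSX _ hy) (hSc _ y hy) hE (V m y)
      (fun x hx => hTX (Finset.mem_filter.1 hx).1)
      (fun x hx x' hx' => hsep x (Finset.mem_filter.1 hx).1 x' (Finset.mem_filter.1 hx').1)
      (fun x hx => (Finset.mem_filter.1 hx).2.1) (fun x hx => (Finset.mem_filter.1 hx).2.2)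
    refine this.trans (le_of_eq ?_)
    rw [mul_pow, ← Real.exp_nat_mul, ← Real.exp_nat_mul, mul_assoc]
    congr 3 <;> ring
  have hVgcard : (Vg.card : ℝ) ≤
      A * Real.exp (-(g * β)) ^ (l / 2 + 1) * Real.exp ((1 + r₁) * α * β) ^ l := by
    have := hglob l (l / 2) (by omega) Vg (fun x hx => hTX (Finset.mem_filter.1 hx).1)
      (fun x hx x' hx' => hsep x (Finset.mem_filter.1 hx).1 x' (Finset.mem_filter.1 hx').1)
      (fun x hx => hcenter x (Finset.mem_filter.1 hx).1) (fun x hx => (Finset.mem_filter.1 hx).2)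
    refine this.trans (le_of_eq ?_)
    rw [← Real.exp_nat_mul, ← Real.exp_nat_mul]
    push_cast
    congr 2
    · congr 2; ring
    · ring
  have h1 : (T.card : ℝ) ≤ ∑ m ∈ Finset.Icc 1 (l / 2), ∑ y ∈ S (l - m), ((V m y).card : ℝ) +
      Vg.card := by
    have h2 := (Finset.card_le_card hcover).trans (Finset.card_union_le _ _)
    have h3 := Finset.card_biUnion_le (s := Finset.Icc 1 (l / 2))
      (t := fun m => (S (l - m)).biUnion (V m))
    have h4 : ∑ m ∈ Finset.Icc 1 (l / 2), ((S (l - m)).biUnion (V m)).card ≤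
        ∑ m ∈ Finset.Icc 1 (l / 2), ∑ y ∈ S (l - m), (V m y).card :=
      Finset.sum_le_sum fun m _ => Finset.card_biUnion_le
    exact_mod_cast h2.trans (Nat.add_le_add_right (h3.trans h4) _)
  refine h1.trans (add_le_add (Finset.sum_le_sum fun m hm => ?_) hVgcard)
  refine (Finset.sum_le_sum (hVcard m hm)).trans (le_of_eq ?_)
  rw [Finset.sum_const, nsmul_eq_mul, mul_comm]

theorem radius_add_one {ρ₀ β k : ℝ} :
    c.radius ρ₀ β (k + 1) = c.radius ρ₀ β k * Real.exp (-((1 + c.wt c.top) * β)) := by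
  unfold radius
  rw [mul_assoc, ← Real.exp_add]
  congr 2; ring

theorem tendsto_radius {ρ₀ β : ℝ} (hβ : 0 < β) :
    Tendsto (fun k : ℕ => c.radius ρ₀ β k) atTop (nhds 0) := by
  have hw := c.wt_pos c.top
  have h1 : Tendsto (fun k : ℕ => ρ₀ * Real.exp (-((1 + c.wt c.top) * (β * (k : ℝ))))) atTop
      (nhds (ρ₀ * 0)) := by
    refine (Real.tendsto_exp_neg_atTop_nhds_zero.comp ?_).const_mul ρ₀
    exact (tendsto_natCast_atTop_atTop.const_mul_atTop hβ).const_mul_atTop (by linarith)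
  rwa [mul_zero] at h1

/-- Some point of the regular set has no good inhomogeneous approximations. -/
theorem exists_not_approximable {μ : Measure ℝ} {X : Set ℝ} (hXc : IsClosed X) (hX0 : μ Xᶜ = 0)
    {a b α ρm ρ₀ A η g β₀ d : ℝ} (ha : 0 < a) (hab : a ≤ b) (hα : 0 < α)
    (hlow : ∀ x ∈ X, ∀ ρ, 0 < ρ → ρ ≤ ρm → ENNReal.ofReal (a * ρ ^ α) ≤ μ (Metric.ball x ρ))
    (hup : ∀ x ∈ X, ∀ ρ, 0 < ρ → ρ ≤ ρm → μ (Metric.ball x ρ) ≤ ENNReal.ofReal (b * ρ ^ α))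
    (hρ₀ : 0 < ρ₀) (hρ₀1 : ρ₀ ≤ 1) (hρ₀rad : ρ₀ ≤ c.rad) (hρ₀m : 4 * ρ₀ ≤ ρm)
    (hX : c.center ∈ X) (hA : 0 ≤ A) (hη : 0 ≤ η) (hηn : Fintype.card ι * η ≤ 1 / 2) (hg : 0 < g)
    (hcount : ∀ β, β₀ ≤ β → c.LocalCount X α ρ₀ A η g β ∧ c.GlobalCount X α ρ₀ A η g β)
    {θ : ι → ℝ → ℝ} (hd : 0 ≤ d)
    (hθ : ∀ i, ∀ x ∈ Metric.ball c.center c.rad, ∀ y ∈ Metric.ball c.center c.rad,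
      |θ i x - θ i y| ≤ d * |x - y|) :
    ∃ β : ℝ, 0 < β ∧ ∃ x ∈ X, x ∈ Metric.closedBall c.center ρ₀ ∧
      ∀ k : ℕ, 4 ≤ k → ¬c.Approximable θ β k x := by
  classical
  have hb : 0 < b := ha.trans_le hab
  obtain ⟨β₁, hβ₁⟩ := c.abs_sub_lt_of_approximable hd hθ hρ₀ hρ₀1 hη hηn
  have hw := c.wt_pos c.top
  set r₁ := c.wt c.top with hr₁
  set e : ℝ := a / (b * 8 ^ α) with he
  have h8 : (1 : ℝ) ≤ 8 ^ α := Real.one_le_rpow (by norm_num) hα.le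
  have he0 : 0 < e := by positivity
  have he1 : e ≤ 1 := by
    rw [he, div_le_one (by positivity)]
    calc a ≤ b * 1 := by linarith
      _ ≤ _ := mul_le_mul_of_nonneg_left h8 hb.le
  obtain ⟨β₂, hβ₂⟩ : ∃ β₂ : ℝ, ∀ β, β₂ ≤ β → 0 < β ∧ Real.exp (-(1 * β)) ≤ 1 / 2 ∧
      (2 * e⁻¹) ^ 2 * Real.exp (-(g * β)) ≤ 1 / 2 ∧
      A * (2 * e⁻¹) ^ 2 * Real.exp (-(g * β)) ≤ 1 / 12 ∧
      Real.exp (-((1 + r₁) * α * β)) ≤ e / 4 := by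
    have h1 : ∀ {C s e : ℝ}, 0 < s → 0 < e → ∀ᶠ β in atTop, C * Real.exp (-(s * β)) ≤ e := by
      intro C s e hs he
      have h2 : Tendsto (fun β : ℝ => C * Real.exp (-(s * β))) atTop (nhds (C * 0)) :=
        (Real.tendsto_exp_neg_atTop_nhds_zero.comp
          (tendsto_id.const_mul_atTop hs)).const_mul C
      rw [mul_zero] at h2
      exact (h2.eventually_lt_const he).mono fun _ h => h.le
    have h3 := h1 (C := 1) one_pos (one_half_pos (α := ℝ))
    have h4 := h1 (C := 1) (s := (1 + r₁) * α) (e := e / 4) (by positivity) (by positivity)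
    simp only [one_mul] at h3 h4
    simp only [one_mul]
    exact eventually_atTop.1 ((eventually_gt_atTop 0).and (h3.and ((h1 hg one_half_pos).and
      ((h1 hg (by norm_num)).and h4))))
  set β := max β₀ (max β₁ β₂) with hβ
  obtain ⟨hβ0, hβhalf, hq, hAq, hβe⟩ :=
    hβ₂ β ((le_max_right _ _).trans (le_max_right _ _))
  have happ := hβ₁ β ((le_max_left _ _).trans (le_max_right _ _))
  obtain ⟨hloc, hglob⟩ := hcount β (le_max_left _ _)
  set Q := Real.exp ((1 + r₁) * α * β) with hQ
  have hQe : 4 ≤ e * Q := by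
    have h1 := mul_le_mul_of_nonneg_right hβe (Real.exp_pos ((1 + r₁) * α * β)).le
    rw [← Real.exp_add, neg_add_cancel, Real.exp_zero] at h1
    linarith
  set M := ⌈e * Q⌉₊ with hM
  have hMQ : e * Q ≤ M := Nat.le_ceil _
  have hM4 : (4 : ℝ) ≤ M := hQe.trans hMQ
  have hMlt : (M : ℝ) - 1 < e * Q := by linarith [Nat.ceil_lt_add_one (by linarith : 0 ≤ e * Q)]
  set ρ : ℕ → ℝ := fun k => c.radius ρ₀ β k with hρ
  have hρpos : ∀ k, 0 < ρ k := fun k => c.radius_pos hρ₀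
  have hρle : ∀ k, ρ k ≤ ρ₀ := fun k => c.radius_le hρ₀ hβ0.le (Nat.cast_nonneg k)
  have hρsucc : ∀ k, ρ (k + 1) = ρ k * Real.exp (-((1 + r₁) * β)) := fun k => by
    simp only [hρ, Nat.cast_add_one]
    exact c.radius_add_one
  have hρ2 : ∀ k, 2 * ρ (k + 1) ≤ ρ k := by
    intro k
    have h1 : Real.exp (-((1 + r₁) * β)) ≤ 1 / 2 := by
      refine le_trans (Real.exp_le_exp.2 ?_) hβhalf
      have := mul_pos hw hβ0
      linarith
    rw [hρsucc]
    nlinarith [hρpos k]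
  have hch : ∀ k, ∀ x ∈ X, ∃ s : Finset ℝ, (s : Set ℝ) ⊆ X ∧ s.card = M ∧
      (∀ y ∈ s, |y - x| < ρ k / 2) ∧
      ∀ y ∈ s, ∀ y' ∈ s, y ≠ y' → 4 * ρ (k + 1) ≤ |y - y'| := by
    intro k x hx
    have h1 := hρpos k
    have h2 := hρpos (k + 1)
    have h3 := hρle k
    have h4 := hρle (k + 1)
    refine exists_separated_card_eq hX0 hb hlow hup hx (half_pos h1) (by linarith)
      (by linarith) (by linarith) (Nat.one_le_ceil_iff.2 (by linarith)) ?_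
    have h5 : 4 * ρ (k + 1) = ρ k / 2 * (8 * Real.exp (-((1 + r₁) * β))) := by
      rw [hρsucc]; ring
    have h6 : (8 * Real.exp (-((1 + r₁) * β))) ^ α = 8 ^ α * Q⁻¹ := by
      rw [Real.mul_rpow (by norm_num) (Real.exp_pos _).le, ← Real.exp_mul, hQ, ← Real.exp_neg]
      congr 2; ring
    rw [h5, Real.mul_rpow (by linarith) (by positivity), h6]
    have h7 : 0 < (ρ k / 2) ^ α := by positivity
    have hQ0 : 0 < Q := Real.exp_pos _
    calc ((M : ℝ) - 1) * (b * ((ρ k / 2) ^ α * (8 ^ α * Q⁻¹)))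
        = ((M : ℝ) - 1) * (b * (ρ k / 2) ^ α * 8 ^ α * Q⁻¹) := by ring
      _ < e * Q * (b * (ρ k / 2) ^ α * 8 ^ α * Q⁻¹) :=
          mul_lt_mul_of_pos_right hMlt (by positivity)
      _ = a * (ρ k / 2) ^ α := by
          rw [he]; field_simp
  obtain ⟨S, T, hS0, hSX, hTX, hSP, hTP, hSanc, hTanc, hTpar, hTsep4, hTsep2, hcard⟩ :=
    exists_tree hX hρpos hρ2 hch (fun l x =>
      (∀ z ∈ Metric.closedBall x (ρ l), c.NoShort (Real.exp (-(η * β))) (β * l) z) ∧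
      ∀ k : ℕ, 4 ≤ k → l = k + 1 → ∀ z ∈ Metric.closedBall x (ρ l), ¬c.Approximable θ β k z)
  have hρzero : ρ 0 = ρ₀ := by
    simp only [hρ, Nat.cast_zero]
    exact c.radius_zero
  have hSball : ∀ k, ∀ x ∈ S k, Metric.closedBall x (ρ k) ⊆ Metric.closedBall c.center ρ₀ := by
    intro k x hx
    rcases k with _ | k
    · rw [hS0, Finset.mem_singleton] at hx
      rw [hx, hρzero]
    · obtain ⟨y, hy, hsub⟩ := hSanc k 0 (Nat.zero_le _) x hx
      rw [hS0, Finset.mem_singleton] at hy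
      rw [hy, hρzero] at hsub
      exact hsub.trans Metric.ball_subset_closedBall
  have hSc : ∀ k, ∀ x ∈ S k, |x - c.center| ≤ ρ₀ := fun k x hx =>
    hSball k x hx (Metric.mem_closedBall_self (hρpos k).le)
  have hTball : ∀ k, ∀ x ∈ T k, Metric.closedBall x (ρ (k + 1)) ⊆ Metric.ball c.center ρ₀ := by
    intro k x hx
    obtain ⟨y, hy, hsub⟩ := hTanc k 0 (Nat.zero_le _) x hx
    rw [hS0, Finset.mem_singleton] at hy
    rwa [hy, hρzero] at hsub
  have hSE : ∀ j, 1 ≤ j → ∀ y ∈ S j, ∀ z ∈ Metric.closedBall y (ρ j),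
      c.NoShort (Real.exp (-(η * β))) (β * j) z := by
    intro j hj y hy
    obtain ⟨i, rfl⟩ := Nat.exists_eq_add_of_le' hj
    exact (hSP i y hy).1
  have hSE' : ∀ k, ∀ y ∈ S k, ∀ j : ℕ, 1 ≤ j → j ≤ k →
      c.NoShort (Real.exp (-(η * β))) (β * j) y := by
    intro k y hy j hj hjk
    have hself := Metric.mem_closedBall_self (x := y) (hρpos k).le
    rcases Nat.lt_or_ge j k with hlt | hge
    · obtain ⟨i, rfl⟩ := Nat.exists_eq_add_of_le' (show 1 ≤ k by omega)
      obtain ⟨y', hy', hsub⟩ := hSanc i j (by omega) y hy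
      exact hSE j hj y' hy' y (Metric.ball_subset_closedBall (hsub hself))
    · have : j = k := by omega
      subst this
      exact hSE j hj y hy y hself
  have hrec : ∀ k, (M : ℝ) * (S k).card ≤ (S (k + 1)).card + (S k).card +
      ∑ m ∈ Finset.Icc 1 ((k + 1) / 2),
        A * (Real.exp (-(g * β)) * Q) ^ m * (S (k + 1 - m)).card +
      A * Real.exp (-(g * β)) ^ ((k + 1) / 2 + 1) * Q ^ (k + 1) := by
    intro k
    set W := (T k).filter fun x =>
      4 ≤ k ∧ ∃ z ∈ Metric.closedBall x (ρ (k + 1)), c.Approximable θ β k z with hW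
    set V := (T k).filter fun x => ∃ z ∈ Metric.closedBall x (ρ (k + 1)),
      ¬c.NoShort (Real.exp (-(η * β))) (β * (k + 1 : ℕ)) z with hV
    have hTWV : T k ⊆ W ∪ V := by
      intro x hx
      by_contra hcon
      rw [Finset.mem_union, not_or] at hcon
      refine hTP k x hx ⟨fun z hz => ?_, fun k' hk' hkk z hz hz' => ?_⟩
      · by_contra h
        exact hcon.2 (Finset.mem_filter.2 ⟨hx, z, hz, h⟩)
      · have : k' = k := by omega
        subst this
        exact hcon.1 (Finset.mem_filter.2 ⟨hx, hk', z, hz, hz'⟩)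
    have hWcard : W.card ≤ (S k).card := by
      refine Finset.card_le_card_of_forall_subsingleton (fun x y => |x - y| < ρ k / 2)
        (fun x hx => hTpar k x (Finset.mem_filter.1 hx).1) fun y hy => ?_
      rintro x ⟨hx, hxy⟩ x' ⟨hx', hxy'⟩
      obtain ⟨hxT, hk4, z, hz, hzA⟩ := Finset.mem_filter.1 hx
      obtain ⟨hxT', -, z', hz', hzA'⟩ := Finset.mem_filter.1 hx'
      by_contra hne
      have h1 := hTsep4 k y hy x hxT x' hxT' hxy hxy' hne
      have hin : Metric.ball c.center ρ₀ ⊆ Metric.ball c.center c.rad :=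
        Metric.ball_subset_ball hρ₀rad
      have hyT : y ∈ Metric.ball c.center c.rad := by
        rcases Nat.eq_zero_or_pos k with h0 | h0
        · omega
        · obtain ⟨i, rfl⟩ := Nat.exists_eq_add_of_le' h0
          obtain ⟨y', hy', hsub⟩ := hSanc i 0 (Nat.zero_le _) y hy
          rw [hS0, Finset.mem_singleton] at hy'
          rw [hy', hρzero] at hsub
          exact hin (hsub (Metric.mem_closedBall_self (hρpos _).le))
      have hclose : ∀ {x z : ℝ}, |x - y| < ρ k / 2 → z ∈ Metric.closedBall x (ρ (k + 1)) →
          |z - y| ≤ 2 * ρ k := by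
        intro x z hxy hz
        rw [Metric.mem_closedBall, Real.dist_eq] at hz
        linarith [abs_sub_le z x y, hρ2 k, hρpos k]
      have h2 := happ k hk4 y hyT (hSE' k y hy) z (hin (hTball k x hxT hz)) z'
        (hin (hTball k x' hxT' hz')) (hclose hxy hz) (hclose hxy' hz') hzA hzA'
      have h3 : c.radius ρ₀ β (k + 1) = ρ (k + 1) := by simp only [hρ, Nat.cast_add_one]
      rw [h3] at h2
      rw [Metric.mem_closedBall, Real.dist_eq] at hz hz'
      rw [abs_sub_comm] at hz
      linarith [abs_sub_le x z x', abs_sub_le z z' x', hρpos (k + 1)]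
    have hVcard := c.card_short_le hρ₀rad hβ0.le hloc hglob hS0 hSX (l := k + 1) (by omega) hSc
      (fun j hj y hy => hSE j hj y hy y (Metric.mem_closedBall_self (hρpos j).le)) (T := V)
      (fun x hx => hTX k (Finset.mem_filter.1 hx).1)
      (fun x hx x' hx' => hTsep2 k x (Finset.mem_filter.1 hx).1 x' (Finset.mem_filter.1 hx').1)
      (fun j hj x hx => hTanc k j (by omega) x (Finset.mem_filter.1 hx).1)
      (fun x hx => (Finset.mem_filter.1 hx).2)
    have h1 : ((T k).card : ℝ) ≤ (S k).card + V.card := by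
      exact_mod_cast (Finset.card_le_card hTWV).trans ((Finset.card_union_le _ _).trans
        (Nat.add_le_add_right hWcard _))
    have h2 : (M : ℝ) * (S k).card = (S (k + 1)).card + (T k).card := by exact_mod_cast hcard k
    rw [h2]
    linarith
  have hpos := half_mul_le_of_recurrence (N := fun k => ((S k).card : ℝ)) hM4 hA
    (Real.exp_pos (-(g * β))).le (Real.exp_pos _).le (B := e⁻¹) (Q := Q) (by
      rw [← div_eq_mul_inv, le_div_iff₀ he0]; linarith) (by
      have := (one_le_inv₀ he0).2 he1
      linarith) hq (by rwa [← mul_assoc]) (by simp [hS0]) hrec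
  obtain ⟨x, hxX, hx⟩ := exists_mem_of_nested hXc (c.tendsto_radius hβ0) hSX
    (fun k => Finset.card_pos.1 (by exact_mod_cast (hpos k).1)) (fun k => (hρpos k).le)
    (fun k x hx => hSanc k k le_rfl x hx)
  refine ⟨β, hβ0, x, hxX, ?_, fun k hk => ?_⟩
  · obtain ⟨y, hy, hxy⟩ := hx 0
    exact hSball 0 y hy hxy
  · obtain ⟨y, hy, hxy⟩ := hx (k + 1)
    exact (hSP k y hy).2 k hk rfl x hxy

end WeightedCurve

theorem WeightedCurve.exists_le_rpow_distInt_mul {ι : Type*} [Fintype ι] (c : WeightedCurve ι)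
    {θ : ι → ℝ → ℝ} {β x : ℝ} (hβ : 0 < β) (hx : ∀ k : ℕ, 4 ≤ k → ¬c.Approximable θ β k x) :
    ∃ σ : ℝ, 0 < σ ∧ ∀ q : ℤ, Real.exp β ≤ |(q : ℝ)| →
      ∃ i, σ ≤ distInt (q * c.val i x - θ i x) ^ (1 / c.wt i) * |(q : ℝ)| := by
  refine ⟨Real.exp (-(∑ i, 6 * β / c.wt i) - 3 * β), Real.exp_pos _, fun q hq => ?_⟩
  have hq0 : 0 < |(q : ℝ)| := (Real.exp_pos _).trans_le hq
  have hlog : β ≤ Real.log |(q : ℝ)| := (Real.le_log_iff_exp_le hq0).2 hq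
  set m := ⌊Real.log |(q : ℝ)| / β⌋₊ with hm
  have hm1 : 1 ≤ m := Nat.le_floor (by rw [Nat.cast_one, one_le_div hβ]; exact hlog)
  have hml : β * m ≤ Real.log |(q : ℝ)| := by
    rw [mul_comm, ← le_div_iff₀ hβ]
    exact Nat.floor_le (div_nonneg (hβ.le.trans hlog) hβ.le)
  have hmu : Real.log |(q : ℝ)| < β * (m + 1) := by
    rw [mul_comm, ← div_lt_iff₀ hβ]
    exact Nat.lt_floor_add_one _
  have hqm : Real.exp (β * m) ≤ |(q : ℝ)| := (Real.le_log_iff_exp_le hq0).1 hml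
  have hqM : |(q : ℝ)| ≤ Real.exp (β * (m + 1)) := (Real.log_le_iff_le_exp hq0).1 hmu.le
  by_contra! hcon
  refine hx (m + 3) (by omega) ⟨q, fun i => round (q * c.val i x - θ i x), ?_, ?_, fun i => ?_⟩
  · convert hqm using 2; push_cast; ring
  · convert hqM using 2; push_cast; ring
  · by_contra! hlt
    refine absurd (hcon i) (not_lt.2 ?_)
    have hw := c.wt_pos i
    rw [← Real.exp_add] at hlt
    calc Real.exp (-(∑ i, 6 * β / c.wt i) - 3 * β)
        ≤ Real.exp ((-(6 * β) + -(c.wt i * (β * (m + 3 : ℕ)))) * (1 / c.wt i)) *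
          Real.exp (β * m) := by
          rw [← Real.exp_add]
          refine Real.exp_le_exp.2 ?_
          have h1 : 6 * β / c.wt i ≤ ∑ i, 6 * β / c.wt i :=
            Finset.single_le_sum (f := fun i => 6 * β / c.wt i)
              (fun j _ => div_nonneg (by positivity) (c.wt_pos j).le) (Finset.mem_univ i)
          have h2 : (-(6 * β) + -(c.wt i * (β * (m + 3 : ℕ)))) * (1 / c.wt i) =
              -(6 * β / c.wt i) - β * (m + 3) := by
            push_cast; field_simp; ring
          rw [h2]; linarith
      _ ≤ _ := by
          rw [Real.exp_mul]
          exact mul_le_mul (Real.rpow_le_rpow (Real.exp_pos _).le hlt.le (by positivity)) hqm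
            (Real.exp_pos _).le (Real.rpow_nonneg (abs_nonneg _) _)

theorem badLiminf_pos {n : ℕ} {r y θv : Fin n → ℝ} {σ N : ℝ} (hσ : 0 < σ)
    (h : ∀ q : ℤ, N ≤ |(q : ℝ)| → ∃ i, σ ≤ wpow (distInt (q * y i - θv i)) (r i) * |(q : ℝ)|) :
    0 < badLiminf r y θv := by
  refine (ENNReal.ofReal_pos.2 hσ).trans_le (le_liminf_of_le (by isBoundedDefault) ?_)
  refine eventually_comap.2 ((eventually_ge_atTop ⌈N⌉).mono fun m hm q hq => ?_)
  obtain ⟨i, hi⟩ := h q (by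
    have h1 : (⌈N⌉ : ℝ) ≤ m := by exact_mod_cast hm
    have h2 : (m : ℝ) = |(q : ℝ)| := by rw [← hq]; push_cast; rfl
    linarith [Int.le_ceil N])
  refine ENNReal.ofReal_le_ofReal (hi.trans (mul_le_mul_of_nonneg_right ?_ (abs_nonneg _)))
  exact le_ciSup (f := fun i => wpow (distInt (q * y i - θv i)) (r i))
    (Finite.bddAbove_range _) i

theorem isClosed_msupport (μ : Measure ℝ) : IsClosed (msupport μ) := by
  refine isOpen_compl_iff.1 (Metric.isOpen_iff.2 fun x hx => ?_)
  simp only [msupport, mem_compl_iff, mem_ofPred_eq, not_forall, not_lt, nonpos_iff_eq_zero] at hx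
  obtain ⟨ρ, hρ, h0⟩ := hx
  refine ⟨ρ / 2, half_pos hρ, fun y hy hy' => (hy' (ρ / 2) (half_pos hρ)).ne' ?_⟩
  refine measure_mono_null (Metric.ball_subset_ball' ?_) h0
  rw [Metric.mem_ball] at hy
  linarith

theorem measure_compl_msupport (μ : Measure ℝ) : μ (msupport μ)ᶜ = 0 := by
  refine measure_null_of_locally_null _ fun x hx => ?_
  simp only [msupport, mem_compl_iff, mem_ofPred_eq, not_forall, not_lt, nonpos_iff_eq_zero] at hx
  obtain ⟨ρ, hρ, h0⟩ := hx
  exact ⟨_, mem_nhdsWithin_of_mem_nhds (Metric.ball_mem_nhds x hρ), h0⟩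

/-- A support point around which balls have polynomially small measure is not isolated in the
support. -/
theorem exists_mem_msupport_ne {μ : Measure ℝ} {C α ρ₀ x₀ : ℝ} (hα : 0 < α)
    (hρ₀ : 0 < ρ₀) (hup : ∀ ρ, 0 < ρ → ρ ≤ ρ₀ → μ (Metric.ball x₀ ρ) ≤ ENNReal.ofReal (C * ρ ^ α))
    (hx₀ : x₀ ∈ msupport μ) {p : ℝ → Prop} (hp : ∀ᶠ x in nhdsWithin x₀ {x₀}ᶜ, p x) :
    ∃ x ∈ msupport μ, p x := by
  by_contra! hcon
  obtain ⟨ρ, hρ, hball⟩ := Metric.mem_nhdsWithin_iff.1 hp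
  have hatom : μ {x₀} = 0 := by
    have h1 : Tendsto (fun ρ : ℝ => ENNReal.ofReal (C * ρ ^ α)) (nhdsWithin 0 (Ioi 0)) (nhds 0) := by
      have h2 : Tendsto (fun ρ : ℝ => C * ρ ^ α) (nhds 0) (nhds (C * 0 ^ α)) :=
        ((Real.continuousAt_rpow_const 0 α (Or.inr hα.le)).tendsto).const_mul C
      rw [Real.zero_rpow hα.ne', mul_zero] at h2
      simpa using (ENNReal.tendsto_ofReal h2).mono_left nhdsWithin_le_nhds
    refine nonpos_iff_eq_zero.1 (ge_of_tendsto h1 ?_)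
    filter_upwards [Ioc_mem_nhdsGT hρ₀] with s hs
    exact (measure_mono (singleton_subset_iff.2 (Metric.mem_ball_self hs.1))).trans (hup s hs.1 hs.2)
  refine (hx₀ ρ hρ).ne' (measure_mono_null (t := {x₀} ∪ (msupport μ)ᶜ) (fun x hx => ?_)
    (measure_union_null hatom (measure_compl_msupport μ)))
  by_cases hxx : x = x₀
  · exact Or.inl hxx
  · exact Or.inr fun hxs => hcon x hxs (hball ⟨hx, hxx⟩)

/-- Linearly independent functions have combinations bounded below uniformly in the
coefficients. -/
theorem exists_le_abs_sum_mul {J : Type*} [Fintype J] {g : J → ℝ → ℝ} {B : Set ℝ}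
    (hind : ∀ b : J → ℝ, b ≠ 0 → ∃ z ∈ B, ∑ j, b j * g j z ≠ 0) :
    ∃ c₀ : ℝ, 0 < c₀ ∧ ∀ b : J → ℝ, (∃ j, 1 ≤ |b j|) → ∃ z ∈ B, c₀ ≤ |∑ j, b j * g j z| := by
  have hcont : ∀ z, Continuous fun b : J → ℝ => |∑ j, b j * g j z| := fun z => by fun_prop
  obtain ⟨k, hk⟩ := (isCompact_sphere (0 : J → ℝ) 1).elim_directed_cover
    (fun k : ℕ => ⋃ z ∈ B, {b : J → ℝ | 1 / ((k : ℝ) + 1) < |∑ j, b j * g j z|})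
    (fun k => isOpen_biUnion fun z _ => isOpen_lt continuous_const (hcont z))
    (fun b hb => by
      obtain ⟨z, hz, hne⟩ := hind b (ne_zero_of_mem_unit_sphere ⟨b, hb⟩)
      obtain ⟨k, hk⟩ := exists_nat_one_div_lt (abs_pos.2 hne)
      exact mem_iUnion.2 ⟨k, mem_iUnion₂.2 ⟨z, hz, hk⟩⟩)
    (directed_of_isDirected_le fun k l hkl => iUnion₂_mono fun z _ b hb => by
      rw [mem_ofPred_eq] at hb ⊢
      exact (one_div_le_one_div_of_le (α := ℝ) (Nat.cast_add_one_pos k)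
        (add_le_add_left (Nat.cast_le.2 hkl) 1)).trans_lt hb)
  refine ⟨1 / ((k : ℝ) + 1), by positivity, fun b ⟨j, hj⟩ => ?_⟩
  have hb1 : 1 ≤ ‖b‖ := hj.trans (norm_le_pi_norm b j)
  have hb0 : 0 < ‖b‖ := zero_lt_one.trans_le hb1
  have hmem : ‖b‖⁻¹ • b ∈ Metric.sphere (0 : J → ℝ) 1 := by
    rw [mem_sphere_zero_iff_norm, norm_smul, norm_inv, norm_norm, inv_mul_cancel₀ hb0.ne']
  obtain ⟨z, hz, hlt⟩ := mem_iUnion₂.1 (hk hmem)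
  refine ⟨z, hz, ?_⟩
  have h1 : ∑ j, (‖b‖⁻¹ • b) j * g j z = ‖b‖⁻¹ * ∑ j, b j * g j z := by
    rw [Finset.mul_sum]
    exact Finset.sum_congr rfl fun j _ => by rw [Pi.smul_apply, smul_eq_mul, mul_assoc]
  rw [mem_ofPred_eq, h1, abs_mul, abs_of_pos (inv_pos.2 hb0)] at hlt
  exact hlt.le.trans (mul_le_of_le_one_left (abs_nonneg _) (inv_le_one_of_one_le₀ hb1))

/-- An analytic curve restricts to a weighted curve near a point where the coordinate of largest
weight has nonvanishing derivative. -/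
theorem exists_weightedCurve {ι : Type*} [Fintype ι] {f : ι → ℝ → ℝ} {w : ι → ℝ}
    (hw : ∀ i, 0 < w i) (hw1 : ∑ i, w i = 1) {t : ι} (ht : ∀ i, w i ≤ w t) {x₀ : ℝ}
    (hf : ∀ i, AnalyticAt ℝ (f i) x₀) (ht0 : deriv (f t) x₀ ≠ 0) {U : Set ℝ} (hU : U ∈ nhds x₀) :
    ∃ c : WeightedCurve ι, c.val = f ∧ c.vel = (fun i => deriv (f i)) ∧ c.wt = w ∧
      c.center = x₀ ∧ 0 < c.rad ∧ Metric.ball x₀ c.rad ⊆ U := by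
  set K : ℝ := 1 + ∑ i, (|deriv (f i) x₀| + |deriv (deriv (f i)) x₀|) with hK
  have hK' : ∀ i, |deriv (f i) x₀| < K ∧ |deriv (deriv (f i)) x₀| < K := fun i => by
    have h1 := Finset.single_le_sum (f := fun i => |deriv (f i) x₀| + |deriv (deriv (f i)) x₀|)
      (fun j _ => by positivity) (Finset.mem_univ i)
    constructor <;> linarith [abs_nonneg (deriv (f i) x₀), abs_nonneg (deriv (deriv (f i)) x₀)]
  have hd : ∀ i, AnalyticAt ℝ (deriv (f i)) x₀ := fun i => (hf i).deriv
  have hdd : ∀ i, AnalyticAt ℝ (deriv (deriv (f i))) x₀ := fun i => (hd i).deriv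
  set κ : ℝ := min 1 (|deriv (f t) x₀| / 2) with hκ
  have hκlt : κ < |deriv (f t) x₀| :=
    (min_le_right _ _).trans_lt (half_lt_self (abs_pos.2 ht0))
  have hev : ∀ᶠ x in nhds x₀, x ∈ U ∧ κ < |deriv (f t) x| ∧ ∀ i, AnalyticAt ℝ (f i) x ∧
      |deriv (f i) x| < K ∧ |deriv (deriv (f i)) x| < K := by
    refine (eventually_mem_set.2 hU).and
      (((hd t).continuousAt.abs.eventually_const_lt hκlt).and (eventually_all.2 fun i => ?_))
    exact (hf i).eventually_analyticAt.and (((hd i).continuousAt.abs.eventually_lt_const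
      (hK' i).1).and ((hdd i).continuousAt.abs.eventually_lt_const (hK' i).2))
  obtain ⟨R, hR, hball⟩ := Metric.eventually_nhds_iff_ball.1 hev
  let c : WeightedCurve ι :=
    { val := f
      vel := fun i => deriv (f i)
      acc := fun i => deriv (deriv (f i))
      wt := w
      top := t
      center := x₀
      rad := R
      K := K
      κ := κ
      wt_pos := hw
      wt_sum := hw1
      wt_le_top := ht
      one_le_K := le_add_of_nonneg_right (Finset.sum_nonneg fun i _ => by positivity)
      κ_pos := lt_min one_pos (half_pos (abs_pos.2 ht0))
      κ_le_one := min_le_left _ _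
      hasDerivAt_val := fun i x hx => ((hball x hx).2.2 i).1.differentiableAt.hasDerivAt
      hasDerivAt_vel := fun i x hx => ((hball x hx).2.2 i).1.deriv.differentiableAt.hasDerivAt
      abs_vel_le := fun i x hx => ((hball x hx).2.2 i).2.1.le
      abs_acc_le := fun i x hx => ((hball x hx).2.2 i).2.2.le
      κ_le_vel := fun x hx => (hball x hx).2.1.le }
  exact ⟨c, rfl, rfl, rfl, rfl, hR, fun x hx => (hball x hx).1⟩

theorem WeightedCurve.analyticAt_frame {ι : Type*} [Fintype ι] [DecidableEq ι]
    (c : WeightedCurve ι) {x : ℝ} (hval : ∀ i, AnalyticAt ℝ (c.val i) x)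
    (hvel : ∀ i, AnalyticAt ℝ (c.vel i) x) (i j : Option ι) :
    AnalyticAt ℝ (fun y => c.frame y i j) x := by
  rcases i with _ | i
  · rcases j with _ | j
    · exact analyticAt_const
    · exact hval j
  · by_cases hi : i = c.top
    · rcases j with _ | j
      · simpa [WeightedCurve.frame, hi] using analyticAt_const
      · simpa [WeightedCurve.frame, hi] using hvel j
    · simpa [WeightedCurve.frame, hi] using analyticAt_const

theorem UniformlyGood.mono_region {S : Type*} {μ : Measure ℝ} {X Reg Reg' : Set ℝ}
    {α ρm G γ : ℝ} {ψ : S → ℝ → ℝ} (h : UniformlyGood μ X Reg α ρm G γ ψ) (hsub : Reg' ⊆ Reg) :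
    UniformlyGood μ X Reg' α ρm G γ ψ :=
  fun s x hx r hr hrm hball => h s x hx r hr hrm (hball.trans hsub)

/-- The badly approximable points of a nondegenerate analytic curve with positive weights meet the
support of a regular measure. -/
theorem exists_mem_msupport_le_rpow_distInt_mul {ι : Type*} [Fintype ι] {w : ι → ℝ}
    (hw : ∀ i, 0 < w i) (hw1 : ∑ i, w i = 1) {U : Set ℝ} (hU : IsOpen U) (hUc : IsPreconnected U)
    {f : ι → ℝ → ℝ} (hf : ∀ i, AnalyticOnNhd ℝ (f i) U)
    (hnd : ∀ (a : ℝ) (b : ι → ℝ), (∀ x ∈ U, a + ∑ i, b i * f i x = 0) → a = 0 ∧ b = 0)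
    {θ : ι → ℝ → ℝ}
    (hθ : ∀ i, ∃ d > 0, ∀ x ∈ U, ∀ y ∈ U, |θ i x - θ i y| ≤ d * |x - y|)
    {C α : ℝ} (hC : 1 ≤ C) (hα : 0 < α) {μ : Measure ℝ}
    (hμ : ∃ ρ₀ > 0, ∀ x ∈ msupport μ, ∀ ρ : ℝ, 0 < ρ → ρ ≤ ρ₀ →
      ENNReal.ofReal (C⁻¹ * ρ ^ α) ≤ μ (Metric.ball x ρ) ∧
        μ (Metric.ball x ρ) ≤ ENNReal.ofReal (C * ρ ^ α))
    (hUμ : (U ∩ msupport μ).Nonempty) :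
    ∃ x ∈ U ∩ msupport μ, ∃ σ N : ℝ, 0 < σ ∧ ∀ q : ℤ, N ≤ |(q : ℝ)| →
      ∃ i, σ ≤ distInt (q * f i x - θ i x) ^ (1 / w i) * |(q : ℝ)| := by
  classical
  have hne : Nonempty ι := by
    by_contra hemp
    rw [not_nonempty_iff] at hemp
    simp at hw1
  obtain ⟨t, ht⟩ := Finite.exists_max w
  obtain ⟨ρm, hρm, hreg⟩ := hμ
  obtain ⟨x₀, hx₀U, hx₀X⟩ := hUμ
  have hdt : AnalyticOnNhd ℝ (deriv (f t)) U := (hf t).deriv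
  have hxs : ∃ x ∈ msupport μ, x ∈ U ∧ deriv (f t) x ≠ 0 := by
    rcases (hdt x₀ hx₀U).eventually_eq_zero_or_eventually_ne_zero with h0 | h0
    · exfalso
      have h1 : EqOn (deriv (f t)) 0 U := hdt.eqOn_zero_of_preconnected_of_eventuallyEq_zero hUc
        hx₀U h0
      obtain ⟨a, ha⟩ := hU.exists_is_const_of_deriv_eq_zero hUc
        (fun x hx => (hf t x hx).differentiableAt.differentiableWithinAt) h1
      have h2 := (hnd (-a) (Pi.single t 1) fun x hx => by
        simp [Pi.single_apply, ha x hx]).2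
      simpa using congr_fun h2 t
    · have h1 : ∀ᶠ x in nhdsWithin x₀ {x₀}ᶜ, x ∈ U :=
        mem_nhdsWithin_of_mem_nhds (hU.mem_nhds hx₀U)
      exact exists_mem_msupport_ne hα hρm (fun ρ hρ hρ' => (hreg x₀ hx₀X ρ hρ hρ').2) hx₀X
        (h1.and h0)
  obtain ⟨xs, hxsX, hxsU, hxs0⟩ := hxs
  obtain ⟨c, hval, hvel, hwt, hcen, hrad, hradU⟩ := exists_weightedCurve hw hw1 ht
    (fun i => hf i xs hxsU) hxs0 (hU.mem_nhds hxsU)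
  have hframe : ∀ x ∈ U, ∀ i j, AnalyticAt ℝ (fun y => c.frame y i j) x := fun x hx =>
    c.analyticAt_frame (fun i => hval ▸ hf i x hx) (fun i => hvel ▸ (hf i x hx).deriv)
  have hC0 : 0 < C := zero_lt_one.trans_le hC
  have hlow : ∀ x ∈ msupport μ, ∀ ρ, 0 < ρ → ρ ≤ ρm →
      ENNReal.ofReal (C⁻¹ * ρ ^ α) ≤ μ (Metric.ball x ρ) := fun x hx ρ h h' => (hreg x hx ρ h h').1
  have hup : ∀ x ∈ msupport μ, ∀ ρ, 0 < ρ → ρ ≤ ρm →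
      μ (Metric.ball x ρ) ≤ ENNReal.ofReal (C * ρ ^ α) := fun x hx ρ h h' => (hreg x hx ρ h h').2
  obtain ⟨R, hR, G, γ, hG, hγ, hgood⟩ :=
    exists_uniformlyGood_covol c.frame xs (hframe xs hxsU) hα hC0.le hup
  set n := Fintype.card ι with hn
  have h5 : (4 : ℝ) ≤ 5 ^ (n + 2) :=
    calc (4 : ℝ) ≤ 5 ^ 2 := by norm_num
      _ ≤ 5 ^ (n + 2) := pow_le_pow_right₀ (by norm_num) (by omega)
  set Q : ℝ := 5 ^ (n + 2) + 1 with hQ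
  have hQ0 : 0 < Q := by linarith
  set m := min (min 1 ρm) (min R c.rad) with hm
  have hm0 : 0 < m := lt_min (lt_min one_pos hρm) (lt_min hR hrad)
  have hm1 : m ≤ 1 := (min_le_left _ _).trans (min_le_left _ _)
  have hmρ : m ≤ ρm := (min_le_left _ _).trans (min_le_right _ _)
  have hmR : m ≤ min R c.rad := min_le_right _ _
  have hmr : m ≤ c.rad := hmR.trans (min_le_right _ _)
  set ρ₀ := m / Q with hρ₀def
  have hρ₀ : 0 < ρ₀ := div_pos hm0 hQ0
  have hQρ : Q * ρ₀ = m := mul_div_cancel₀ _ hQ0.ne'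
  have hρ₀1 : ρ₀ ≤ 1 := by nlinarith
  have hρ₀rad : 2 * ρ₀ ≤ c.rad := by nlinarith
  have hρ₀m : 5 ^ (n + 2) * ρ₀ ≤ ρm := by nlinarith
  obtain ⟨c₀, hc₀, hF⟩ := exists_le_abs_sum_mul (J := Option ι) (B := Metric.ball xs ρ₀)
    (g := fun j z => j.elim 1 fun i => f i z) (fun b hb => by
      by_contra! hcon
      have han : AnalyticOnNhd ℝ (fun z => b none + ∑ i, b (some i) * f i z) U := fun x hx =>
        analyticAt_const.add (Finset.analyticAt_fun_sum _ fun i _ =>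
          analyticAt_const.mul (hf i x hx))
      have h1 := han.eqOn_zero_of_preconnected_of_eventuallyEq_zero hUc hxsU (by
        filter_upwards [Metric.ball_mem_nhds xs hρ₀] with z hz
        simpa [Fintype.sum_option] using hcon z hz)
      obtain ⟨h2, h3⟩ := hnd (b none) (fun i => b (some i)) fun x hx => h1 hx
      exact hb (funext fun j => by
        rcases j with _ | i
        · exact h2
        · exact congr_fun h3 i))
  obtain ⟨A, η, g, β₀, hA, hη, hηn, hg, -, hcount⟩ := c.exists_counting (Rg := min R c.rad)
    (measure_compl_msupport μ)
    (inv_pos.2 hC0) hC0.le hG hlow hup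
    (fun D => hcen ▸ (hgood D).mono_region (Metric.ball_subset_ball (min_le_left _ _))) hγ
    (fun i j y hy => (hframe y (hradU (Metric.ball_subset_ball (min_le_right _ _)
      (hcen ▸ hy))) i j).continuousAt)
    hρ₀ hρ₀1 hρ₀rad (hQρ.trans_le hmR) hρ₀m (hcen ▸ hxsX) hc₀ (fun b hb => by
      obtain ⟨z, hz, hle⟩ := hF b hb
      refine ⟨z, hcen ▸ hz, hle.trans_eq ?_⟩
      simp [WeightedCurve.F₀, Fintype.sum_option, hval, mul_comm])
  choose d hd hθd using hθ
  have hdsum : ∀ i, d i ≤ ∑ i, d i := fun i =>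
    Finset.single_le_sum (fun j _ => (hd j).le) (Finset.mem_univ i)
  obtain ⟨β, hβ, x, hxX, hxball, hx⟩ := c.exists_not_approximable (isClosed_msupport μ)
    (measure_compl_msupport μ) (inv_pos.2 hC0) ((inv_le_one_of_one_le₀ hC).trans hC) hα hlow hup
    hρ₀ hρ₀1 (by linarith) (by nlinarith) (hcen ▸ hxsX) hA hη.le hηn hg hcount
    (Finset.sum_nonneg fun i _ => (hd i).le) (fun i x hx y hy =>
      (hθd i x (hradU (hcen ▸ hx)) y (hradU (hcen ▸ hy))).trans
        (mul_le_mul_of_nonneg_right (hdsum i) (abs_nonneg _)))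
  obtain ⟨σ, hσ, hq⟩ := c.exists_le_rpow_distInt_mul hβ hx
  subst hval hwt hcen
  exact ⟨x, ⟨hradU (Metric.closedBall_subset_ball (by linarith) hxball), hxX⟩, σ, Real.exp β, hσ,
    hq⟩

theorem stmt18 {n : ℕ} (hn : 1 ≤ n) (r : Fin n → ℝ)
    (hr_nonneg : ∀ i, 0 ≤ r i) (hr_sum : ∑ i, r i = 1)
    (U : Set ℝ) (hU_open : IsOpen U) (hU_conn : U.OrdConnected)
    (φ : ℝ → Fin n → ℝ)
    (hφ_an : AnalyticOnNhd ℝ φ U)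
    -- nondegeneracy: `1, φ₁, …, φₙ` are linearly independent over `ℝ`
    (hφ_nd : ∀ (a : ℝ) (b : Fin n → ℝ),
      (∀ x ∈ U, a + ∑ i, b i * φ x i = 0) → a = 0 ∧ b = 0)
    (θ : Fin n → ℝ → ℝ)
    -- each `θ̃ᵢ` is Lipschitz on `U`
    (hθ_lip : ∀ i, ∃ d > 0, ∀ x ∈ U, ∀ y ∈ U, |θ i x - θ i y| ≤ d * |x - y|)
    (C α : ℝ) (hC : 1 ≤ C) (hα : 0 < α)
    (μ : Measure ℝ)
    -- `μ` is `(C,α)`-Ahlfors regular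
    (hμ_reg : ∃ ρ₀ > 0, ∀ x ∈ msupport μ, ∀ ρ : ℝ, 0 < ρ → ρ ≤ ρ₀ →
      ENNReal.ofReal (C⁻¹ * ρ ^ α) ≤ μ (Metric.ball x ρ) ∧
        μ (Metric.ball x ρ) ≤ ENNReal.ofReal (C * ρ ^ α))
    (hUμ : (U ∩ msupport μ).Nonempty) :
    ({x ∈ U | 0 < badLiminf r (φ x) (fun i => θ i x)} ∩ msupport μ).Nonempty := by
  have hr1 : ∑ i : {i // 0 < r i}, r i = 1 := by
    rw [← hr_sum, ← Finset.sum_filter_of_ne (s := Finset.univ) (p := fun i => 0 < r i)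
      fun i _ hi => (hr_nonneg i).lt_of_ne' hi]
    exact (Finset.sum_subtype _ (by simp) _).symm
  obtain ⟨x, hx, σ, N, hσ, hq⟩ := exists_mem_msupport_le_rpow_distInt_mul
    (ι := {i // 0 < r i}) (w := fun i => r i) (f := fun i x => φ x i) (θ := fun i => θ i)
    (fun i => i.2) hr1 hU_open hU_conn.isPreconnected
    (fun i x hx => (analyticAt_pi_iff.1 (hφ_an x hx)) i)
    (fun a b hab => by
      have h := hφ_nd a (fun i => if hi : 0 < r i then b ⟨i, hi⟩ else 0) fun x hx => by
        refine Eq.trans ?_ (hab x hx)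
        rw [← Finset.sum_filter_of_ne (s := Finset.univ) (p := fun i => 0 < r i)
          (fun i _ hi => by
            by_contra hri
            simp [hri] at hi), Finset.sum_subtype (p := fun i => 0 < r i) _ (by simp)]
        exact congr_arg _ (Finset.sum_congr rfl fun i _ => by rw [dif_pos i.2])
      exact ⟨h.1, funext fun i => by simpa [i.2] using congr_fun h.2 i⟩)
    (fun i => hθ_lip i) hC hα hμ_reg hUμ
  refine ⟨x, ⟨hx.1, badLiminf_pos (N := N) hσ fun q hqN => ?_⟩, hx.2⟩
  obtain ⟨i, hi⟩ := hq q hqN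
  exact ⟨i, by rwa [wpow, if_neg i.2.ne']⟩
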